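/- There exists an absolute constant κ ≥ 1 such that for every sufficiently large constant C₀ > 1 there is a threshold A₀(C₀) with the following property. Let A ≥ A₀(C₀) be dyadic, let M ≥ C₀^{−1}, and let ψ: H → ℝ^{29} be a smooth map satisfying: (i) C₀^{−1}M ≤ |Xψ(p)|, |Yψ(p)| ≤ C₀M and |Xψ(p) ∧ Yψ(p)| ≥ C₀^{−6}M² for all p ∈ H; (ii) |⋀_{W = X,Y,Z,XX,YY,XY} Wψ(p)| ≥ C₀^{−20}A^{−4}M² for all p ∈ H; (iii) ‖∇²ψ‖_{C^{18,α}_A} ≤ C₀²A^{−1}. Then there exists a smooth map φ: H → ℝ^{29} such that: (iv) |Xφ(p)|, |Yφ(p)| ≥ κ^{−1} and |X(ψ+φ)(p) ∧ Y(ψ+φ)(p)|² − |Xψ(p) ∧ Yψ(p)|² ≥ κ^{−1}C₀^{−4}M² for all p ∈ H; (v) |⋀_{W = X,Y,Z,XX,YY,XY} W(ψ+φ)(p)| ≥ κ^{−1}C₀^{−12}M² for all p ∈ H; (vi) ‖φ‖_{C^{20,α}} ≤ κ; and (vii) B(φ,ψ) = 0 identically on H. -/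

import Mathlib

open scoped ENNReal NNReal RealInnerProductSpace BigOperators

noncomputable section

/-- The Heisenberg group `H`, identified as a set with `ℝ³`. -/
abbrev H : Type := ℝ × ℝ × ℝ

namespace Heisenberg

/-- The group law `[a,b,c]·[x,y,z] = [x+a, y+b, z+c+a·y]`. -/
def mul (p q : H) : H := (q.1 + p.1, q.2.1 + p.2.1, q.2.2 + p.2.2 + p.1 * q.2.1)

/-- The group inverse `[x,y,z]⁻¹ = [−x,−y,−z+xy]`. -/
def inv (p : H) : H := (-p.1, -p.2.1, -p.2.2 + p.1 * p.2.1)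

/-- Membership in the integer lattice `Γ`. -/
def inGamma (p : H) : Prop :=
  (∃ a : ℤ, p.1 = (a : ℝ)) ∧ (∃ b : ℤ, p.2.1 = (b : ℝ)) ∧ (∃ c : ℤ, p.2.2 = (c : ℝ))

/-- Flow along the vector field `X`: `exp(tX)[x,y,z] = [x+t, y, z+t·y]`. -/
def flowX (t : ℝ) (p : H) : H := (p.1 + t, p.2.1, p.2.2 + t * p.2.1)

/-- Flow along the vector field `Y`: `exp(tY)[x,y,z] = [x, y+t, z]`. -/
def flowY (t : ℝ) (p : H) : H := (p.1, p.2.1 + t, p.2.2)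

def flow : Bool → ℝ → H → H
  | true => flowX
  | false => flowY

/-- `applyFlows [(W₁,t₁),…,(W_k,t_k)] p = exp(t₁W₁)⋯exp(t_kW_k) p`. -/
def applyFlows : List (Bool × ℝ) → H → H
  | [], p => p
  | wt :: l, p => flow wt.1 wt.2 (applyFlows l p)

/-- The Carnot–Carathéodory metric on `H`. -/
def ccDist (p p' : H) : ℝ :=
  sInf { s | ∃ l : List (Bool × ℝ), applyFlows l p = p' ∧ s = (l.map fun wt => |wt.2|).sum }

/-- The parabolic dilation `δ_λ[x,y,z] = [λx, λy, λ²z]`. -/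
def dilate (lam : ℝ) (p : H) : H := (lam * p.1, lam * p.2.1, lam ^ 2 * p.2.2)

variable {E : Type*} [NormedAddCommGroup E] [NormedSpace ℝ E]

/-- The right-invariant vector field `X = ∂/∂x + y ∂/∂z` acting on functions. -/
def XD (φ : H → E) : H → E := fun p => fderiv ℝ φ p (1, 0, p.2.1)

/-- The right-invariant vector field `Y = ∂/∂y` acting on functions. -/
def YD (φ : H → E) : H → E := fun p => fderiv ℝ φ p (0, 1, 0)

/-- The vector field `Z = ∂/∂z` acting on functions. -/
def ZD (φ : H → E) : H → E := fun p => fderiv ℝ φ p (0, 0, 1)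

def WD : Bool → (H → E) → H → E
  | true => XD
  | false => YD

/-- `X`, `Y`, `Z` indexed by `Fin 3`. -/
def WD3 : Fin 3 → (H → E) → H → E := ![XD, YD, ZD]

/-- The pointwise (Euclidean) norm `|∇^j φ(p)|` of the `j`-th iterated horizontal
gradient `∇^jφ`, computed via the words of length `j` in `X, Y`. -/
def gradNorm (j : ℕ) (φ : H → E) (p : H) : ℝ :=
  Real.sqrt (∑ w : Fin j → Bool, ‖(List.ofFn w).foldr WD φ p‖ ^ 2)

/-- `‖∇^m φ‖_{C^k_R}`, valued in `ℝ≥0∞`. -/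
def CkRS (m k : ℕ) (R : ℝ) (φ : H → E) : ℝ≥0∞ :=
  ∑ j ∈ Finset.range (k + 1),
    ENNReal.ofReal (R ^ j) * ⨆ p : H, ENNReal.ofReal (gradNorm (m + j) φ p)

/-- The homogeneous Hölder seminorm `‖∇^m φ‖_{Ċ^{0,α}}`, valued in `ℝ≥0∞`. -/
def gradHolderS (m : ℕ) (α : ℝ) (φ : H → E) : ℝ≥0∞ :=
  ⨆ (p : H) (q : H) (_ : p ≠ q),
    ENNReal.ofReal (Real.sqrt (∑ w : Fin m → Bool,
        ‖(List.ofFn w).foldr WD φ p - (List.ofFn w).foldr WD φ q‖ ^ 2)) /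
      ENNReal.ofReal (ccDist p q ^ α)

/-- `‖∇^m φ‖_{C^{k,α}_R}`, valued in `ℝ≥0∞`. -/
def CkAS (m k : ℕ) (α R : ℝ) (φ : H → E) : ℝ≥0∞ :=
  CkRS m k R φ + ENNReal.ofReal (R ^ ((k : ℝ) + α)) * gradHolderS (m + k) α φ

/-- `‖φ‖_{C^k_R}`. -/
abbrev CkR (k : ℕ) (R : ℝ) (φ : H → E) : ℝ≥0∞ := CkRS 0 k R φ

/-- `‖φ‖_{C^{k,α}_R}`. -/
abbrev CkA (k : ℕ) (α R : ℝ) (φ : H → E) : ℝ≥0∞ := CkAS 0 k α R φ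

/-- A dyadic number is one of the form `2^m`, `m ∈ ℤ`. -/
def IsDyadic (A : ℝ) : Prop := ∃ m : ℤ, A = 2 ^ m

/-- The norm `|v₁ ∧ ⋯ ∧ v_k|` of a wedge product of vectors of `ℝ^D`, via the
Cauchy–Binet (Gram determinant) formula. -/
def wedgeNorm {D k : ℕ} (v : Fin k → EuclideanSpace ℝ (Fin D)) : ℝ :=
  Real.sqrt (Matrix.det (Matrix.of fun i j => ⟪v i, v j⟫))

end Heisenberg

open Heisenberg
open scoped RealInnerProductSpace

set_option linter.unusedSectionVars false

namespace Heisenberg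

section Calculus

variable {E F G V : Type*} [NormedAddCommGroup E] [NormedSpace ℝ E]
  [NormedAddCommGroup F] [NormedSpace ℝ F] [NormedAddCommGroup G] [NormedSpace ℝ G]
  [NormedAddCommGroup V] [NormedSpace ℝ V]

/-- Smooth maps between real normed spaces. -/
abbrev Smooth (f : V → F) : Prop := ContDiff ℝ (⊤ : ℕ∞) f

/-- The vector fields `X` and `Y`, as maps into the tangent space `ℝ³`. -/
def vf : Bool → H → H
  | true => fun p => (1, 0, p.2.1)
  | false => fun _ => (0, 1, 0)

theorem WD_apply (b : Bool) (f : H → E) (p : H) : WD b f p = fderiv ℝ f p (vf b p) := by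
  cases b <;> rfl

theorem smooth_vf (b : Bool) : Smooth (vf b) := by
  cases b <;> (unfold vf Smooth; simp only; fun_prop)

theorem Smooth.differentiable {f : V → F} (hf : Smooth f) : Differentiable ℝ f :=
  ContDiff.differentiable hf (by simp)

theorem Smooth.fderiv {f : V → F} (hf : Smooth f) : Smooth (fderiv ℝ f) :=
  ContDiff.fderiv_right hf (by simp)

theorem Smooth.comp {g : F → G} {f : V → F} (hg : Smooth g) (hf : Smooth f) :
    Smooth (fun x => g (f x)) :=
  ContDiff.comp hg hf

theorem Smooth.fderiv_apply {f : V → F} {v : V → V} (hf : Smooth f) (hv : Smooth v) :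
    Smooth (fun p => _root_.fderiv ℝ f p (v p)) :=
  ContDiff.clm_apply hf.fderiv hv

theorem Smooth.WD {f : H → E} (hf : Smooth f) (b : Bool) : Smooth (WD b f) := by
  have : Heisenberg.WD b f = fun p => _root_.fderiv ℝ f p (vf b p) := funext (WD_apply b f)
  rw [this]
  exact hf.fderiv_apply (smooth_vf b)

/-- The iterated derivative along the word `w`. -/
def DD (w : List Bool) (f : H → E) : H → E := w.foldr WD f

@[simp] theorem DD_nil (f : H → E) : DD [] f = f := rfl
@[simp] theorem DD_cons (b : Bool) (w : List Bool) (f : H → E) :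
    DD (b :: w) f = WD b (DD w f) := rfl

theorem DD_append (v w : List Bool) (f : H → E) : DD (v ++ w) f = DD v (DD w f) := by
  simp [DD, List.foldr_append]

theorem DD_concat (w : List Bool) (b : Bool) (f : H → E) :
    DD (w ++ [b]) f = DD w (WD b f) := DD_append w [b] f

theorem Smooth.DD {f : H → E} (hf : Smooth f) (w : List Bool) : Smooth (DD w f) := by
  induction w with
  | nil => exact hf
  | cons b w ih => exact ih.WD b

theorem WD_add {f g : H → E} (hf : Smooth f) (hg : Smooth g) (b : Bool) :
    WD b (fun p => f p + g p) = fun p => WD b f p + WD b g p := by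
  funext p
  simp only [WD_apply]
  rw [fderiv_fun_add (hf.differentiable p) (hg.differentiable p)]; rfl

theorem WD_sub {f g : H → E} (hf : Smooth f) (hg : Smooth g) (b : Bool) :
    WD b (fun p => f p - g p) = fun p => WD b f p - WD b g p := by
  funext p
  simp only [WD_apply]
  rw [fderiv_fun_sub (hf.differentiable p) (hg.differentiable p)]; rfl

theorem WD_neg (f : H → E) (b : Bool) :
    WD b (fun p => - f p) = fun p => - WD b f p := by
  funext p
  simp only [WD_apply]
  rw [fderiv_fun_neg]; rfl

theorem WD_clm (L : E →L[ℝ] F) {f : H → E} (hf : Smooth f) (b : Bool) :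
    WD b (fun p => L (f p)) = fun p => L (WD b f p) := by
  funext p
  simp only [WD_apply]
  have := (L.hasFDerivAt (x := f p)).comp p (hf.differentiable p).hasFDerivAt
  rw [HasFDerivAt.fderiv (f := fun p => L (f p)) this]; rfl

theorem WD_const_smul (c : ℝ) {f : H → E} (hf : Smooth f) (b : Bool) :
    WD b (fun p => c • f p) = fun p => c • WD b f p :=
  WD_clm (c • ContinuousLinearMap.id ℝ E) hf b

theorem WD_const (c : E) (b : Bool) : WD b (fun _ : H => c) = fun _ => 0 := by
  funext p; simp [WD_apply]

theorem WD_bilin (B : E →L[ℝ] F →L[ℝ] G) {f : H → E} {g : H → F} (hf : Smooth f)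
    (hg : Smooth g) (b : Bool) :
    WD b (fun p => B (f p) (g p)) = fun p => B (WD b f p) (g p) + B (f p) (WD b g p) := by
  funext p
  simp only [WD_apply]
  have := B.hasFDerivAt_of_bilinear (hf.differentiable p).hasFDerivAt
    (hg.differentiable p).hasFDerivAt
  rw [HasFDerivAt.fderiv (f := fun p => B (f p) (g p)) this]
  simp [add_comm]

theorem Smooth.bilin (B : E →L[ℝ] F →L[ℝ] G) {f : V → E} {g : V → F} (hf : Smooth f)
    (hg : Smooth g) : Smooth (fun p => B (f p) (g p)) :=
  ContDiff.clm_apply (B.contDiff.comp hf) hg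

theorem DD_add {f g : H → E} (hf : Smooth f) (hg : Smooth g) (w : List Bool) :
    DD w (fun p => f p + g p) = fun p => DD w f p + DD w g p := by
  induction w with
  | nil => rfl
  | cons b w ih => rw [DD_cons, ih, WD_add (hf.DD w) (hg.DD w)]; rfl

theorem DD_sub {f g : H → E} (hf : Smooth f) (hg : Smooth g) (w : List Bool) :
    DD w (fun p => f p - g p) = fun p => DD w f p - DD w g p := by
  induction w with
  | nil => rfl
  | cons b w ih => rw [DD_cons, ih, WD_sub (hf.DD w) (hg.DD w)]; rfl

theorem DD_neg (f : H → E) (w : List Bool) :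
    DD w (fun p => - f p) = fun p => - DD w f p := by
  induction w with
  | nil => rfl
  | cons b w ih => rw [DD_cons, ih, WD_neg]; rfl

theorem DD_clm (L : E →L[ℝ] F) {f : H → E} (hf : Smooth f) (w : List Bool) :
    DD w (fun p => L (f p)) = fun p => L (DD w f p) := by
  induction w with
  | nil => rfl
  | cons b w ih => rw [DD_cons, ih, WD_clm L (hf.DD w)]; rfl

theorem DD_const_smul (c : ℝ) {f : H → E} (hf : Smooth f) (w : List Bool) :
    DD w (fun p => c • f p) = fun p => c • DD w f p :=
  DD_clm (c • ContinuousLinearMap.id ℝ E) hf w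

theorem DD_zero (w : List Bool) : DD w (fun _ : H => (0 : E)) = fun _ => 0 := by
  induction w with
  | nil => rfl
  | cons b w ih => rw [DD_cons, ih, WD_const]

theorem Smooth.finset_sum {ι : Type*} (s : Finset ι) {f : ι → V → F} (hf : ∀ i ∈ s, Smooth (f i)) :
    Smooth (fun p => ∑ i ∈ s, f i p) :=
  ContDiff.sum hf

theorem DD_sum {ι : Type*} (s : Finset ι) {f : ι → H → E} (hf : ∀ i ∈ s, Smooth (f i))
    (w : List Bool) :
    DD w (fun p => ∑ i ∈ s, f i p) = fun p => ∑ i ∈ s, DD w (f i) p := by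
  classical
  induction s using Finset.induction_on with
  | empty => simp [DD_zero]
  | insert a s ha ih =>
    simp only [Finset.sum_insert ha]
    rw [DD_add (hf a (by simp)) (Smooth.finset_sum s fun i hi => hf i (by simp [hi])),
      ih fun i hi => hf i (by simp [hi])]

theorem WD_congr_of_eventuallyEq {f g : H → E} {p : H} (h : f =ᶠ[nhds p] g) (b : Bool) :
    WD b f =ᶠ[nhds p] WD b g := by
  filter_upwards [h.fderiv (𝕜 := ℝ)] with q hq
  rw [WD_apply, WD_apply, hq]

theorem DD_congr_of_eventuallyEq {f g : H → E} {p : H} (h : f =ᶠ[nhds p] g) (w : List Bool) :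
    DD w f =ᶠ[nhds p] DD w g := by
  induction w with
  | nil => exact h
  | cons b w ih => exact WD_congr_of_eventuallyEq ih b

/-- Commutator formula for derivatives along vector fields. -/
theorem fderiv_fderiv_apply {f : V → F} {v : V → V} (hf : Smooth f) (hv : Smooth v) (p x : V) :
    fderiv ℝ (fun q => fderiv ℝ f q (v q)) p x
      = fderiv ℝ (fderiv ℝ f) p x (v p) + fderiv ℝ f p (fderiv ℝ v p x) := by
  have h := (hf.fderiv.differentiable p).hasFDerivAt.clm_apply (hv.differentiable p).hasFDerivAt
  rw [h.fderiv]; simp [add_comm]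

theorem fderiv_fderiv_symm {f : V → F} (hf : Smooth f) (p x y : V) :
    fderiv ℝ (fderiv ℝ f) p x y = fderiv ℝ (fderiv ℝ f) p y x := by
  have : IsSymmSndFDerivAt ℝ f p := (hf.contDiffAt).isSymmSndFDerivAt
    (by simp only [minSmoothness_of_isRCLikeNormedField]; exact WithTop.coe_le_coe.2 (le_top : (2 : ℕ∞) ≤ ⊤))
  exact this x y

theorem fderiv_vf (b : Bool) (p x : H) :
    fderiv ℝ (vf b) p x = if b then (0, 0, x.2.1) else 0 := by
  cases b
  · have : vf false = fun _ => (0, 1, 0) := rfl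
    simp [this]
  · have h : HasFDerivAt (vf true) ((0 : H →L[ℝ] ℝ).prod ((0 : H →L[ℝ] ℝ).prod
      ((ContinuousLinearMap.fst ℝ ℝ ℝ).comp (ContinuousLinearMap.snd ℝ ℝ (ℝ × ℝ))))) p := by
      refine (hasFDerivAt_const _ _).prodMk ((hasFDerivAt_const _ _).prodMk ?_)
      exact ((ContinuousLinearMap.fst ℝ ℝ ℝ).comp
        (ContinuousLinearMap.snd ℝ ℝ (ℝ × ℝ))).hasFDerivAt
    rw [h.fderiv]; rfl

theorem ZD_eq {f : H → E} (hf : Smooth f) (p : H) :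
    ZD f p = YD (XD f) p - XD (YD f) p := by
  have hX : XD f = fun q => fderiv ℝ f q (vf true q) := rfl
  have hY : YD f = fun q => fderiv ℝ f q (vf false q) := rfl
  have h1 : YD (XD f) p = fderiv ℝ (XD f) p (vf false p) := rfl
  have h2 : XD (YD f) p = fderiv ℝ (YD f) p (vf true p) := rfl
  rw [h1, h2, hX, hY, fderiv_fderiv_apply hf (smooth_vf _), fderiv_fderiv_apply hf (smooth_vf _),
    fderiv_vf, fderiv_vf, fderiv_fderiv_symm hf p (vf false p)]
  simp [ZD, vf]

/-! ### Pointwise symbol-type bounds -/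

/-- All derivatives of `f` at `p` of order `j ≤ J` are bounded by `a N ^ j`. -/
def SB (f : H → E) (p : H) (a N : ℝ) (J : ℕ) : Prop :=
  ∀ w : List Bool, w.length ≤ J → ‖DD w f p‖ ≤ a * N ^ w.length

theorem SB.mono {f : H → E} {p : H} {a a' N : ℝ} {J J' : ℕ} (h : SB f p a N J) (ha : a ≤ a')
    (hN : 0 ≤ N) (hJ : J' ≤ J) : SB f p a' N J' := fun w hw =>
  (h w (hw.trans hJ)).trans (by gcongr)

theorem SB.mono_scale {f : H → E} {p : H} {a N N' : ℝ} {J : ℕ} (h : SB f p a N J) (ha : 0 ≤ a)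
    (hN : 0 ≤ N) (hN' : N ≤ N') : SB f p a N' J := fun w hw =>
  (h w hw).trans (by gcongr)

theorem SB.add {f g : H → E} (hf : Smooth f) (hg : Smooth g) {p : H} {a b N : ℝ} {J : ℕ}
    (h : SB f p a N J) (h' : SB g p b N J) : SB (fun p => f p + g p) p (a + b) N J := by
  intro w hw
  rw [DD_add hf hg, add_mul]
  exact (norm_add_le _ _).trans (add_le_add (h w hw) (h' w hw))

theorem SB.sub {f g : H → E} (hf : Smooth f) (hg : Smooth g) {p : H} {a b N : ℝ} {J : ℕ}
    (h : SB f p a N J) (h' : SB g p b N J) : SB (fun p => f p - g p) p (a + b) N J := by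
  intro w hw
  rw [DD_sub hf hg, add_mul]
  exact (norm_sub_le _ _).trans (add_le_add (h w hw) (h' w hw))

theorem SB.neg {f : H → E} {p : H} {a N : ℝ} {J : ℕ}
    (h : SB f p a N J) : SB (fun p => - f p) p a N J := by
  intro w hw
  rw [DD_neg, norm_neg]
  exact h w hw

theorem SB.clm (L : E →L[ℝ] F) {f : H → E} (hf : Smooth f) {p : H} {a N : ℝ} {J : ℕ}
    (h : SB f p a N J) : SB (fun p => L (f p)) p (‖L‖ * a) N J := by
  intro w hw
  rw [DD_clm L hf, mul_assoc]
  exact (L.le_opNorm _).trans (by gcongr; exact h w hw)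

theorem SB.const_smul (c : ℝ) {f : H → E} (hf : Smooth f) {p : H} {a N : ℝ} {J : ℕ}
    (h : SB f p a N J) : SB (fun p => c • f p) p (|c| * a) N J := by
  intro w hw
  rw [DD_const_smul c hf, mul_assoc, norm_smul, Real.norm_eq_abs]
  gcongr; exact h w hw

theorem SB.WD {f : H → E} {p : H} {a N : ℝ} {J : ℕ}
    (h : SB f p a N (J + 1)) (b : Bool) : SB (WD b f) p (a * N) N J := by
  intro w hw
  have := h (w ++ [b]) (by simpa using hw)
  rw [DD_concat] at this
  simpa [pow_succ', mul_assoc] using this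

theorem SB.norm_le {f : H → E} {p : H} {a N : ℝ} {J : ℕ} (h : SB f p a N J) : ‖f p‖ ≤ a := by
  simpa using h [] (by simp)

theorem SB.nonneg {f : H → E} {p : H} {a N : ℝ} {J : ℕ} (h : SB f p a N J) : 0 ≤ a :=
  (norm_nonneg _).trans h.norm_le

/-- The class only sees the norm at one derivative plus the class of the first derivatives. -/
theorem SB.of_WD {f : H → E} {p : H} {a N : ℝ} {J : ℕ} (h0 : ‖f p‖ ≤ a)
    (h : ∀ b, SB (Heisenberg.WD b f) p (a * N) N J) : SB f p a N (J + 1) := by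
  intro w hw
  rcases List.eq_nil_or_concat w with rfl | ⟨v, b, rfl⟩
  · simpa using h0
  · rw [List.concat_eq_append] at hw ⊢
    rw [DD_concat]
    have := h b v (by simpa using hw)
    simpa [pow_succ', mul_assoc] using this

theorem SB.bilin (B : E →L[ℝ] F →L[ℝ] G) {f : H → E} {g : H → F} (hf : Smooth f)
    (hg : Smooth g) {p : H} {a b N : ℝ} {J : ℕ} (hN : 0 ≤ N) (h : SB f p a N J)
    (h' : SB g p b N J) : SB (fun p => B (f p) (g p)) p (2 ^ J * ‖B‖ * a * b) N J := by
  induction J generalizing f g a b with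
  | zero =>
    intro w hw
    obtain rfl : w = [] := by simpa using hw
    simp only [DD_nil, pow_zero, one_mul, mul_one, List.length_nil]
    have h1 := h.norm_le
    have h2 := h'.norm_le
    have := h.nonneg
    exact (B.le_opNorm₂ _ _).trans (by gcongr)
  | succ J ih =>
    have ha := h.nonneg
    have hb := h'.nonneg
    refine SB.of_WD ?_ fun c => ?_
    · have h1 := h.norm_le
      have h2 := h'.norm_le
      refine (B.le_opNorm₂ _ _).trans ?_
      calc ‖B‖ * ‖f p‖ * ‖g p‖ ≤ 1 * ‖B‖ * a * b := by rw [one_mul]; gcongr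
        _ ≤ 2 ^ (J + 1) * ‖B‖ * a * b := by
          gcongr; exact one_le_pow₀ (by norm_num)
    · rw [WD_bilin B hf hg]
      have e1 := ih (hf.WD c) hg (h.WD c) (h'.mono le_rfl hN (Nat.le_succ J))
      have e2 := ih hf (hg.WD c) (h.mono le_rfl hN (Nat.le_succ J)) (h'.WD c)
      refine (e1.add (((hf.WD c)).bilin B hg) (hf.bilin B (hg.WD c)) e2).mono (le_of_eq ?_) hN le_rfl
      ring

end Calculus

section Metric

variable {E F : Type*} [NormedAddCommGroup E] [NormedSpace ℝ E]
  [NormedAddCommGroup F] [NormedSpace ℝ F]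

theorem hasFDerivAt_mul_right (γ p : H) :
    HasFDerivAt (fun q => mul q γ)
      ((ContinuousLinearMap.fst ℝ ℝ (ℝ × ℝ)).prod
        (((ContinuousLinearMap.fst ℝ ℝ ℝ).comp (ContinuousLinearMap.snd ℝ ℝ (ℝ × ℝ))).prod
          ((ContinuousLinearMap.snd ℝ ℝ ℝ).comp (ContinuousLinearMap.snd ℝ ℝ (ℝ × ℝ))
            + γ.2.1 • ContinuousLinearMap.fst ℝ ℝ (ℝ × ℝ)))) p := by
  have h1 : HasFDerivAt (fun q : H => q.1) (ContinuousLinearMap.fst ℝ ℝ (ℝ × ℝ)) p :=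
    (ContinuousLinearMap.fst ℝ ℝ (ℝ × ℝ)).hasFDerivAt
  have h2 : HasFDerivAt (fun q : H => q.2.1)
      ((ContinuousLinearMap.fst ℝ ℝ ℝ).comp (ContinuousLinearMap.snd ℝ ℝ (ℝ × ℝ))) p :=
    ((ContinuousLinearMap.fst ℝ ℝ ℝ).comp (ContinuousLinearMap.snd ℝ ℝ (ℝ × ℝ))).hasFDerivAt
  have h3 : HasFDerivAt (fun q : H => q.2.2)
      ((ContinuousLinearMap.snd ℝ ℝ ℝ).comp (ContinuousLinearMap.snd ℝ ℝ (ℝ × ℝ))) p :=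
    ((ContinuousLinearMap.snd ℝ ℝ ℝ).comp (ContinuousLinearMap.snd ℝ ℝ (ℝ × ℝ))).hasFDerivAt
  exact (h1.const_add γ.1).prodMk ((h2.const_add γ.2.1).prodMk
    ((h3.const_add γ.2.2).add (h1.mul_const γ.2.1)))

theorem smooth_mul_right (γ : H) : Smooth (fun q : H => mul q γ) := by
  unfold mul Smooth
  fun_prop

theorem WD_mul_right {f : H → E} (hf : Smooth f) (γ : H) (b : Bool) :
    WD b (fun p => f (mul p γ)) = fun p => WD b f (mul p γ) := by
  funext p
  have h := (hf.differentiable (mul p γ)).hasFDerivAt.comp p (hasFDerivAt_mul_right γ p)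
  rw [WD_apply, WD_apply, HasFDerivAt.fderiv (f := fun p => f (mul p γ)) h]
  simp only [ContinuousLinearMap.comp_apply]
  congr 1
  cases b <;> simp [vf, mul, add_comm]

theorem DD_mul_right {f : H → E} (hf : Smooth f) (γ : H) (w : List Bool) :
    DD w (fun p => f (mul p γ)) = fun p => DD w f (mul p γ) := by
  induction w with
  | nil => rfl
  | cons b w ih => rw [DD_cons, ih, WD_mul_right (hf.DD w)]; rfl

theorem mul_assoc' (p q r : H) : mul (mul p q) r = mul p (mul q r) := by
  simp only [mul, Prod.mk.injEq]; refine ⟨by ring, by ring, by ring⟩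

theorem mul_inv_self (p : H) : mul p (inv p) = 0 := by
  simp [mul, inv]

theorem inv_mul_self (p : H) : mul (inv p) p = 0 := by
  simp [mul, inv]

theorem mul_zero' (p : H) : mul p 0 = p := by simp [mul]

theorem mul_inv_cancel_right' (p γ : H) : mul (mul p (inv γ)) γ = p := by
  rw [mul_assoc', inv_mul_self, mul_zero']

theorem mul_inv_cancel_right'' (p γ : H) : mul (mul p γ) (inv γ) = p := by
  rw [mul_assoc', mul_inv_self, mul_zero']

theorem hasDerivAt_flow (b : Bool) (t : ℝ) (p : H) :
    HasDerivAt (fun s => flow b s p) (vf b (flow b t p)) t := by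
  cases b
  · simp only [flow, flowY, vf]
    exact (hasDerivAt_const _ _).prodMk (((hasDerivAt_id t).const_add _).prodMk
      (hasDerivAt_const _ _))
  · simp only [flow, flowX, vf]
    refine ((hasDerivAt_id t).const_add _).prodMk ((hasDerivAt_const _ _).prodMk ?_)
    simpa using ((hasDerivAt_id t).mul_const p.2.1).const_add p.2.2

theorem flow_zero (b : Bool) (p : H) : flow b 0 p = p := by
  cases b <;> simp [flow, flowX, flowY]

theorem norm_flow_sub_le {f : H → E} (hf : Smooth f) {K : ℝ}
    (hK : ∀ b p, ‖WD b f p‖ ≤ K) (b : Bool) (t : ℝ) (p : H) :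
    ‖f (flow b t p) - f p‖ ≤ K * |t| := by
  have h : ∀ s ∈ (Set.univ : Set ℝ),
      HasDerivWithinAt (fun s => f (flow b s p)) (WD b f (flow b s p)) Set.univ s := by
    intro s _
    rw [WD_apply]
    exact ((hf.differentiable _).hasFDerivAt.comp_hasDerivAt s
      (hasDerivAt_flow b s p)).hasDerivWithinAt
  have := convex_univ.norm_image_sub_le_of_norm_hasDerivWithin_le h
    (fun s _ => hK b _) (Set.mem_univ 0) (Set.mem_univ t)
  simpa [flow_zero] using this

theorem norm_applyFlows_sub_le {f : H → E} (hf : Smooth f) {K : ℝ}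
    (hK : ∀ b p, ‖WD b f p‖ ≤ K) (l : List (Bool × ℝ)) (p : H) :
    ‖f (applyFlows l p) - f p‖ ≤ K * (l.map fun wt => |wt.2|).sum := by
  induction l with
  | nil => simp [applyFlows]
  | cons a l ih =>
    simp only [applyFlows, List.map_cons, List.sum_cons, mul_add]
    calc _ = ‖(f (flow a.1 a.2 (applyFlows l p)) - f (applyFlows l p))
          + (f (applyFlows l p) - f p)‖ := by congr 1; abel
      _ ≤ _ := (norm_add_le _ _).trans (add_le_add (norm_flow_sub_le hf hK _ _ _) ih)

/-- An explicit horizontal path from `p` to `g · p`. -/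
theorem exists_path (g p : H) : ∃ l : List (Bool × ℝ), applyFlows l p = mul g p ∧
    (l.map fun wt => |wt.2|).sum = |g.1| + |g.2.1| + 4 * √|g.2.2| := by
  obtain ⟨a, b, c⟩ := g
  obtain ⟨x, y, z⟩ := p
  obtain ⟨t, ht, hst⟩ : ∃ t : ℝ, |t| = √|c| ∧ √|c| * t = c := by
    rcases le_total 0 c with h | h
    · exact ⟨√|c|, abs_of_nonneg (Real.sqrt_nonneg _), by
        rw [Real.mul_self_sqrt (abs_nonneg _), abs_of_nonneg h]⟩
    · exact ⟨-√|c|, by rw [abs_neg, abs_of_nonneg (Real.sqrt_nonneg _)], by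
        rw [mul_neg, Real.mul_self_sqrt (abs_nonneg _), abs_of_nonpos h, neg_neg]⟩
  refine ⟨[(false, b), (true, a), (true, √|c|), (false, t), (true, -√|c|), (false, -t)], ?_, ?_⟩
  · simp only [applyFlows, flow, flowX, flowY, mul, Prod.mk.injEq]
    refine ⟨by ring, by ring, ?_⟩
    linear_combination hst
  · simp only [List.map_cons, List.map_nil, List.sum_cons, List.sum_nil, abs_neg, ht,
      abs_of_nonneg (Real.sqrt_nonneg |c|)]
    ring

theorem ccDist_set_nonempty (p q : H) :
    { s | ∃ l : List (Bool × ℝ), applyFlows l p = q ∧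
      s = (l.map fun wt => |wt.2|).sum }.Nonempty := by
  obtain ⟨l, hl, -⟩ := exists_path (mul q (inv p)) p
  rw [mul_inv_cancel_right'] at hl
  exact ⟨_, l, hl, rfl⟩

theorem sum_abs_nonneg (l : List (Bool × ℝ)) : 0 ≤ (l.map fun wt => |wt.2|).sum := by
  apply List.sum_nonneg
  simp only [List.mem_map]
  rintro x ⟨a, -, rfl⟩
  exact abs_nonneg _

theorem ccDist_nonneg (p q : H) : 0 ≤ ccDist p q := by
  apply Real.sInf_nonneg
  rintro s ⟨l, -, rfl⟩
  exact sum_abs_nonneg l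

theorem norm_sub_le_ccDist {f : H → E} (hf : Smooth f) {K : ℝ}
    (hK : ∀ b p, ‖WD b f p‖ ≤ K) (p q : H) : ‖f p - f q‖ ≤ K * ccDist p q := by
  have hK0 : 0 ≤ K := (norm_nonneg _).trans (hK true p)
  rw [norm_sub_rev]
  rcases hK0.eq_or_lt with rfl | hpos
  · obtain ⟨s, l, hl, -⟩ := ccDist_set_nonempty p q
    have := norm_applyFlows_sub_le hf hK l p
    rw [hl] at this
    simpa using this
  · rw [← div_le_iff₀' hpos]
    refine le_csInf (ccDist_set_nonempty p q) ?_
    rintro s ⟨l, hl, rfl⟩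
    rw [div_le_iff₀' hpos, ← hl]
    exact norm_applyFlows_sub_le hf hK l p

theorem ccDist_mul_left_le (g p : H) :
    ccDist p (mul g p) ≤ |g.1| + |g.2.1| + 4 * √|g.2.2| := by
  obtain ⟨l, hl, hs⟩ := exists_path g p
  refine csInf_le ⟨0, ?_⟩ ⟨l, hl, hs.symm⟩
  rintro s ⟨l, -, rfl⟩
  exact sum_abs_nonneg l

theorem ccDist_dilate_mul_left_le {r : ℝ} (hr : 0 ≤ r) (g p : H) :
    ccDist p (mul (dilate r g) p) ≤ r * (|g.1| + |g.2.1| + 4 * √|g.2.2|) := by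
  refine (ccDist_mul_left_le _ _).trans (le_of_eq ?_)
  simp only [dilate, abs_mul, abs_of_nonneg hr, abs_of_nonneg (sq_nonneg r),
    Real.sqrt_mul (sq_nonneg r), Real.sqrt_sq hr]
  ring

/-! ### Smooth inverses of operator-valued maps -/

theorem Smooth.ringInverse [CompleteSpace F] {f : H → F →L[ℝ] F} (hf : Smooth f)
    (hu : ∀ p, IsUnit (f p)) : Smooth (fun p => Ring.inverse (f p)) := by
  refine contDiff_iff_contDiffAt.2 fun p => ?_
  obtain ⟨u, hu⟩ := hu p
  have h1 : ContDiffAt ℝ (⊤ : ℕ∞) Ring.inverse (f p) := by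
    rw [← hu]; exact contDiffAt_ringInverse ℝ u
  exact h1.comp p hf.contDiffAt

theorem WD_ringInverse [CompleteSpace F] {f : H → F →L[ℝ] F} (hf : Smooth f)
    (hu : ∀ p, IsUnit (f p)) (b : Bool) :
    WD b (fun p => Ring.inverse (f p))
      = fun p => -((Ring.inverse (f p) * WD b f p) * Ring.inverse (f p)) := by
  funext p
  obtain ⟨u, hu⟩ := hu p
  have h1 := hasFDerivAt_ringInverse (𝕜 := ℝ) u
  rw [hu] at h1
  have h2 := h1.comp p (hf.differentiable p).hasFDerivAt
  rw [WD_apply, WD_apply, HasFDerivAt.fderiv (f := fun p => Ring.inverse (f p)) h2, ← hu,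
    Ring.inverse_unit]
  simp [mul_assoc]

theorem SB.mul [CompleteSpace F] {f g : H → F →L[ℝ] F} (hf : Smooth f) (hg : Smooth g) {p : H}
    {a b N : ℝ} {J : ℕ} (hN : 0 ≤ N) (h : SB f p a N J) (h' : SB g p b N J) :
    SB (fun p => f p * g p) p (2 ^ J * a * b) N J := by
  refine (SB.bilin (ContinuousLinearMap.mul ℝ (F →L[ℝ] F)) hf hg hN h h').mono ?_ hN le_rfl
  have ha := h.nonneg
  have hb := h'.nonneg
  have : ‖ContinuousLinearMap.mul ℝ (F →L[ℝ] F)‖ ≤ 1 := ContinuousLinearMap.opNorm_mul_le _ _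
  gcongr
  nlinarith [pow_pos (two_pos : (0 : ℝ) < 2) J]

theorem exists_SB_ringInverse (J : ℕ) (a c : ℝ) : ∃ K : ℝ, 0 ≤ K ∧
    ∀ {F : Type} [NormedAddCommGroup F] [NormedSpace ℝ F] [CompleteSpace F]
      {f : H → F →L[ℝ] F}, Smooth f → (∀ p, IsUnit (f p)) → ∀ {p : H} {N : ℝ}, 0 ≤ N →
      SB f p a N J → ‖Ring.inverse (f p)‖ ≤ c →
      SB (fun p => Ring.inverse (f p)) p K N J := by
  induction J with
  | zero =>
    refine ⟨|c|, abs_nonneg c, ?_⟩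
    intro F _ _ _ f hf hu p N hN h hc w hw
    obtain rfl : w = [] := by simpa using hw
    simpa using hc.trans (le_abs_self c)
  | succ J ih =>
    obtain ⟨K, hK0, hK⟩ := ih
    refine ⟨|c| + 2 ^ J * (2 ^ J * K * |a|) * K, by positivity, ?_⟩
    intro F _ _ _ f hf hu p N hN h hc
    have hi := hK hf hu hN (h.mono le_rfl hN (Nat.le_succ J)) hc
    have hsi := hf.ringInverse hu
    refine SB.of_WD ?_ fun b => ?_
    · refine hc.trans ((le_abs_self c).trans ?_)
      have : 0 ≤ 2 ^ J * (2 ^ J * K * |a|) * K := by positivity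
      linarith
    · rw [WD_ringInverse hf hu]
      have hs2 : Smooth (fun p => Ring.inverse (f p) * Heisenberg.WD b f p) :=
        hsi.bilin (ContinuousLinearMap.mul ℝ (F →L[ℝ] F)) (hf.WD b)
      refine (((hi.mul hsi (hf.WD b) hN (h.WD b)).mul hs2 hsi hN hi).neg).mono ?_ hN le_rfl
      calc 2 ^ J * (2 ^ J * K * (a * N)) * K ≤ 2 ^ J * (2 ^ J * K * (|a| * N)) * K := by
            gcongr; exact le_abs_self a
        _ ≤ _ := by
          have : 0 ≤ |c| * N := by positivity
          nlinarith

/-! ### Comparison with the norms of iterated gradients -/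

theorem norm_DD_le_gradNorm (w : List Bool) (f : H → E) (p : H) :
    ‖DD w f p‖ ≤ gradNorm w.length f p := by
  unfold gradNorm
  apply Real.le_sqrt_of_sq_le
  have := Finset.single_le_sum (f := fun v : Fin w.length → Bool => ‖(List.ofFn v).foldr WD f p‖ ^ 2)
    (fun _ _ => sq_nonneg _) (Finset.mem_univ w.get)
  simpa [DD] using this

theorem sqrt_sum_sq_le {j : ℕ} {g : (Fin j → Bool) → E} {a : ℝ} (ha : 0 ≤ a)
    (h : ∀ w, ‖g w‖ ≤ a) : √(∑ w : Fin j → Bool, ‖g w‖ ^ 2) ≤ 2 ^ j * a := by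
  refine Real.sqrt_le_iff.2 ⟨by positivity, ?_⟩
  calc ∑ w : Fin j → Bool, ‖g w‖ ^ 2 ≤ ∑ _w : Fin j → Bool, a ^ 2 := by
        gcongr with w; exact h w
    _ = 2 ^ j * a ^ 2 := by simp
    _ ≤ (2 ^ j * a) ^ 2 := by
      rw [mul_pow]
      gcongr
      exact le_self_pow₀ (one_le_pow₀ (by norm_num)) (by norm_num)

theorem norm_le_sqrt_sum_sq {j : ℕ} (g : List Bool → E) (w : List Bool) (hw : w.length = j) :
    ‖g w‖ ≤ √(∑ v : Fin j → Bool, ‖g (List.ofFn v)‖ ^ 2) := by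
  subst hw
  apply Real.le_sqrt_of_sq_le
  have := Finset.single_le_sum (f := fun v : Fin w.length → Bool => ‖g (List.ofFn v)‖ ^ 2)
    (fun _ _ => sq_nonneg _) (Finset.mem_univ w.get)
  simpa using this

theorem norm_DD_le_of_CkAS {m k : ℕ} {α R c : ℝ} {f : H → E} (hR : 0 < R) (hc : 0 ≤ c)
    (h : CkAS m k α R f ≤ ENNReal.ofReal c) {j : ℕ} (hj : j ≤ k) (w : List Bool)
    (hw : w.length = m + j) (p : H) : ‖DD w f p‖ ≤ c * (R ^ j)⁻¹ := by
  have h1 : ENNReal.ofReal (R ^ j) * ⨆ p : H, ENNReal.ofReal (gradNorm (m + j) f p)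
      ≤ ENNReal.ofReal c :=
    (Finset.single_le_sum (f := fun j => ENNReal.ofReal (R ^ j) *
      ⨆ p : H, ENNReal.ofReal (gradNorm (m + j) f p)) (fun _ _ => zero_le)
      (Finset.mem_range.2 (Nat.lt_succ_of_le hj))).trans (le_self_add.trans h)
  have h2 : ENNReal.ofReal (R ^ j) * ENNReal.ofReal (gradNorm (m + j) f p) ≤ ENNReal.ofReal c :=
    (mul_le_mul_right (le_iSup (fun p => ENNReal.ofReal (gradNorm (m + j) f p)) p) _).trans h1
  rw [← ENNReal.ofReal_mul (by positivity), ENNReal.ofReal_le_ofReal_iff hc] at h2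
  have h3 := norm_DD_le_gradNorm w f p
  rw [hw] at h3
  refine h3.trans ?_
  rw [← div_eq_mul_inv, le_div_iff₀ (by positivity), mul_comm]
  exact h2

theorem holder_of_CkAS {m k : ℕ} {α R c : ℝ} {f : H → E} (hR : 0 < R) (hc : 0 < c)
    (h : CkAS m k α R f ≤ ENNReal.ofReal c) (w : List Bool)
    (hw : w.length = m + k) (p q : H) :
    ‖DD w f p - DD w f q‖ ≤ c * (R ^ ((k : ℝ) + α))⁻¹ * ccDist p q ^ α := by
  have hd : 0 ≤ ccDist p q ^ α := Real.rpow_nonneg (ccDist_nonneg p q) _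
  rcases eq_or_ne p q with rfl | hpq
  · simp only [sub_self, norm_zero]; positivity
  have hRp : 0 < R ^ ((k : ℝ) + α) := Real.rpow_pos_of_pos hR _
  set S := √(∑ w : Fin (m + k) → Bool,
        ‖(List.ofFn w).foldr WD f p - (List.ofFn w).foldr WD f q‖ ^ 2) with hS
  have h1 : ENNReal.ofReal S / ENNReal.ofReal (ccDist p q ^ α) ≤ gradHolderS (m + k) α f :=
    le_iSup₂_of_le p q (le_iSup_of_le hpq le_rfl)
  have h2 : ENNReal.ofReal (R ^ ((k : ℝ) + α)) * (ENNReal.ofReal S / ENNReal.ofReal (ccDist p q ^ α))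
      ≤ ENNReal.ofReal c :=
    (mul_le_mul_right h1 _).trans (le_add_self.trans h)
  rw [← mul_div_assoc, ENNReal.div_le_iff_le_mul (Or.inr ENNReal.ofReal_ne_top)
    (Or.inl ENNReal.ofReal_ne_top), ← ENNReal.ofReal_mul hRp.le,
    ← ENNReal.ofReal_mul hc.le, ENNReal.ofReal_le_ofReal_iff (by positivity)] at h2
  refine (norm_le_sqrt_sum_sq (fun w => DD w f p - DD w f q) w hw).trans ?_
  change S ≤ _
  rw [mul_right_comm, ← div_eq_mul_inv, le_div_iff₀ hRp, mul_comm]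
  exact h2

theorem CkA_le {k : ℕ} {α B K : ℝ} {f : H → E} (hB : 0 ≤ B) (hK : 0 ≤ K)
    (h : ∀ w : List Bool, w.length ≤ k → ∀ p, ‖DD w f p‖ ≤ B)
    (h' : ∀ w : List Bool, w.length = k → ∀ p q, ‖DD w f p - DD w f q‖ ≤ K * ccDist p q ^ α) :
    CkA k α 1 f ≤ ENNReal.ofReal ((k + 1) * 2 ^ k * B + 2 ^ k * K) := by
  unfold CkA CkAS CkRS
  rw [ENNReal.ofReal_add (by positivity) (by positivity)]
  refine add_le_add ?_ ?_
  · calc _ ≤ ∑ _j ∈ Finset.range (k + 1), ENNReal.ofReal (2 ^ k * B) := by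
          refine Finset.sum_le_sum fun j hj => ?_
          have hj' : j ≤ k := Nat.lt_succ_iff.1 (Finset.mem_range.1 hj)
          simp only [one_pow, ENNReal.ofReal_one, one_mul]
          refine iSup_le fun p => ENNReal.ofReal_le_ofReal ?_
          refine (sqrt_sum_sq_le hB fun w => h _ (by simpa using hj') p).trans ?_
          gcongr
          · norm_num
          · omega
      _ = _ := by
          rw [Finset.sum_const, Finset.card_range, nsmul_eq_mul, mul_assoc,
            ENNReal.ofReal_mul (p := (k : ℝ) + 1) (by positivity), ← Nat.cast_add_one,
            ENNReal.ofReal_natCast]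
  · simp only [Real.one_rpow, ENNReal.ofReal_one, one_mul, zero_add]
    refine iSup_le fun p => iSup_le fun q => iSup_le fun _ => ?_
    refine ENNReal.div_le_of_le_mul ?_
    have hd : 0 ≤ ccDist p q ^ α := Real.rpow_nonneg (ccDist_nonneg p q) _
    rw [← ENNReal.ofReal_mul (by positivity)]
    apply ENNReal.ofReal_le_ofReal
    rw [mul_assoc]
    refine sqrt_sum_sq_le (by positivity) fun w => ?_
    have := h' (List.ofFn w) (by simp) p q
    exact this

end Metric

section ParametricIntegral

open MeasureTheory

variable {P V : Type} [NormedAddCommGroup P] [NormedSpace ℝ P] [ProperSpace P]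
  [NormedAddCommGroup V] [NormedSpace ℝ V] [SecondCountableTopology V] [MeasurableSpace V]
  [BorelSpace V] {μ : Measure V} [IsFiniteMeasureOnCompacts μ] {K : Set V}

theorem integrableOn_compact_slice {E : Type*} [NormedAddCommGroup E] {Φ : P × V → E}
    (hK : IsCompact K) (hΦ : Continuous Φ) (p : P) : IntegrableOn (fun v => Φ (p, v)) K μ :=
  (hΦ.comp (by fun_prop : Continuous fun v : V => (p, v))).continuousOn.integrableOn_compact hK

theorem hasFDerivAt_integral_compact {E : Type*} [NormedAddCommGroup E] [NormedSpace ℝ E]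
    {Φ : P × V → E} (hK : IsCompact K) (hΦ : Smooth Φ) (p : P) :
    HasFDerivAt (fun p => ∫ v in K, Φ (p, v) ∂μ)
      (∫ v in K, (fderiv ℝ Φ (p, v)).comp (ContinuousLinearMap.inl ℝ P V) ∂μ) p := by
  have hc : Continuous fun q : P × V => (fderiv ℝ Φ q).comp (ContinuousLinearMap.inl ℝ P V) :=
    hΦ.fderiv.continuous.clm_comp continuous_const
  obtain ⟨C, hC⟩ := ((isCompact_closedBall p 1).prod hK).exists_bound_of_continuousOn
    hc.continuousOn
  have hfin : IsFiniteMeasure (μ.restrict K) := ⟨by simpa using hK.measure_lt_top⟩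
  refine hasFDerivAt_integral_of_dominated_of_fderiv_le
    (F' := fun p v => (fderiv ℝ Φ (p, v)).comp (ContinuousLinearMap.inl ℝ P V))
    (bound := fun _ => C) (Metric.closedBall_mem_nhds p one_pos) ?_ ?_ ?_ ?_ ?_ ?_
  · exact Filter.Eventually.of_forall fun q => (integrableOn_compact_slice hK hΦ.continuous q).1
  · exact integrableOn_compact_slice hK hΦ.continuous p
  · exact (integrableOn_compact_slice hK hc p).1
  · refine ae_restrict_of_forall_mem hK.measurableSet fun v hv q hq => hC (q, v) ⟨hq, hv⟩
  · exact integrable_const _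
  · refine Filter.Eventually.of_forall fun v q _ => ?_
    exact (hΦ.differentiable (q, v)).hasFDerivAt.comp q (hasFDerivAt_prodMk_left q v)

theorem fderiv_integral_compact {E : Type*} [NormedAddCommGroup E] [NormedSpace ℝ E]
    {Φ : P × V → E} (hK : IsCompact K) (hΦ : Smooth Φ) (p w : P) :
    fderiv ℝ (fun p => ∫ v in K, Φ (p, v) ∂μ) p w
      = ∫ v in K, fderiv ℝ (fun q => Φ (q, v)) p w ∂μ := by
  have hc : Continuous fun q : P × V => (fderiv ℝ Φ q).comp (ContinuousLinearMap.inl ℝ P V) :=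
    hΦ.fderiv.continuous.clm_comp continuous_const
  rw [(hasFDerivAt_integral_compact hK hΦ p).fderiv, ContinuousLinearMap.integral_apply
    (integrableOn_compact_slice hK hc p)]
  congr 1 with v
  have := HasFDerivAt.comp p (g := Φ) (f := fun q => (q, v))
    (hΦ.differentiable (p, v)).hasFDerivAt (hasFDerivAt_prodMk_left p v)
  rw [HasFDerivAt.fderiv (f := fun q => Φ (q, v)) this]

theorem smooth_integral_compact {E : Type*} [NormedAddCommGroup E] [NormedSpace ℝ E]
    {Φ : P × V → E} (hK : IsCompact K) (hΦ : Smooth Φ) :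
    Smooth (fun p => ∫ v in K, Φ (p, v) ∂μ) := by
  refine contDiff_infty.2 fun n => ?_
  induction n generalizing E with
  | zero =>
    refine contDiff_zero.2 (continuous_iff_continuousAt.2 fun p => ?_)
    exact (hasFDerivAt_integral_compact hK hΦ p).continuousAt
  | succ n ih =>
    refine (contDiff_succ_iff_hasFDerivAt (n := n)).2
      ⟨_, ?_, fun p => hasFDerivAt_integral_compact hK hΦ p⟩
    exact ih (Φ := fun q : P × V => (fderiv ℝ Φ q).comp (ContinuousLinearMap.inl ℝ P V))
      (ContDiff.clm_comp hΦ.fderiv contDiff_const)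

end ParametricIntegral

section Bump

open MeasureTheory

variable {E F V : Type*} [NormedAddCommGroup E] [NormedSpace ℝ E]
  [NormedAddCommGroup F] [NormedSpace ℝ F] [NormedAddCommGroup V] [NormedSpace ℝ V]

/-- Smooth compactly supported functions. -/
structure Bump (h : V → E) : Prop where
  smooth : Smooth h
  supp : HasCompactSupport h

theorem Bump.add {f g : V → E} (hf : Bump f) (hg : Bump g) : Bump (fun p => f p + g p) :=
  ⟨ContDiff.add hf.smooth hg.smooth, hf.supp.add hg.supp⟩

theorem Bump.neg {f : V → E} (hf : Bump f) : Bump (fun p => - f p) :=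
  ⟨ContDiff.neg hf.smooth, hf.supp.neg⟩

theorem Bump.sub {f g : V → E} (hf : Bump f) (hg : Bump g) : Bump (fun p => f p - g p) := by
  simpa [sub_eq_add_neg] using hf.add hg.neg

theorem Bump.smul {u : V → ℝ} {f : V → E} (hu : Bump u) (hf : Smooth f) :
    Bump (fun p => u p • f p) :=
  ⟨ContDiff.smul hu.smooth hf, hu.supp.smul_right⟩

theorem Bump.smul' {c : V → ℝ} {f : V → E} (hf : Bump f) (hc : Smooth c) :
    Bump (fun p => c p • f p) :=
  ⟨ContDiff.smul hc hf.smooth, hf.supp.smul_left⟩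

theorem Bump.const_smul {f : V → E} (hf : Bump f) (c : ℝ) : Bump (fun p => c • f p) :=
  hf.smul' contDiff_const

theorem Bump.fderiv_apply {f : V → E} {v : V → V} (hf : Bump f) (hv : Smooth v) :
    Bump (fun p => fderiv ℝ f p (v p)) := by
  refine ⟨hf.smooth.fderiv_apply hv, (hf.supp.fderiv (𝕜 := ℝ)).mono fun p hp => ?_⟩
  simp only [Function.mem_support] at hp ⊢
  rintro h
  simp [h] at hp

theorem Bump.WD {f : H → E} (hf : Bump f) (b : Bool) : Bump (WD b f) := by
  have : Heisenberg.WD b f = fun p => fderiv ℝ f p (vf b p) := funext (WD_apply b f)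
  rw [this]
  exact hf.fderiv_apply (smooth_vf b)

/-- The left-invariant fields `∂/∂x` and `∂/∂y + x ∂/∂z`. -/
def lf : Bool → H → H
  | true => fun _ => (1, 0, 0)
  | false => fun p => (0, 1, p.1)

/-- Differentiation along the left-invariant fields. -/
def LD (b : Bool) (f : H → E) : H → E := fun p => fderiv ℝ f p (lf b p)

theorem smooth_lf (b : Bool) : Smooth (lf b) := by
  cases b <;> (unfold lf Smooth; simp only; fun_prop)

theorem Bump.LD {f : H → E} (hf : Bump f) (b : Bool) : Bump (LD b f) :=
  hf.fderiv_apply (smooth_lf b)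

theorem Bump.integrable {f : H → E} (hf : Bump f) : Integrable f :=
  hf.smooth.continuous.integrable_of_hasCompactSupport hf.supp

instance isAddHaarMeasure_volume : (volume : Measure H).IsAddHaarMeasure := by
  have h1 : (volume : Measure (ℝ × ℝ)).IsAddHaarMeasure :=
    Measure.prod.instIsAddHaarMeasure volume volume
  exact Measure.prod.instIsAddHaarMeasure volume volume

theorem integral_fderiv_eq_zero {f : H → E} (hf : Bump f) (v : H) :
    ∫ p, fderiv ℝ f p v = 0 := by
  have h := integral_smul_fderiv_eq_neg_fderiv_smul_of_integrable (μ := (volume : Measure H))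
    (f := fun _ : H => (1 : ℝ)) (g := f) (v := v) (by simp)
    (by simpa using (hf.fderiv_apply (v := fun _ => v) contDiff_const).integrable)
    (by simpa using hf.integrable) (fun _ _ => by fun_prop)
    (fun _ _ => hf.smooth.differentiable _)
  simpa using h

theorem fderiv_coord_smul {ℓ : H →L[ℝ] ℝ} {f : H → E} (hf : Smooth f) (p v : H) :
    fderiv ℝ (fun q => ℓ q • f q) p v = ℓ p • fderiv ℝ f p v + ℓ v • f p := by
  have := (ℓ.hasFDerivAt (x := p)).smul (hf.differentiable p).hasFDerivAt
  rw [HasFDerivAt.fderiv (f := fun q => ℓ q • f q) this]; simp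

/-- The coordinates `x` and `y` on `H`. -/
abbrev cx : H →L[ℝ] ℝ := ContinuousLinearMap.fst ℝ ℝ (ℝ × ℝ)

abbrev cy : H →L[ℝ] ℝ :=
  (ContinuousLinearMap.fst ℝ ℝ ℝ).comp (ContinuousLinearMap.snd ℝ ℝ (ℝ × ℝ))

theorem Bump.coord {f : H → E} (hf : Bump f) (ℓ : H →L[ℝ] ℝ) : Bump (fun q => ℓ q • f q) :=
  hf.smul' ℓ.contDiff

theorem WD_true_eq (f : H → E) (p : H) :
    WD true f p = fderiv ℝ f p (1, 0, 0) + p.2.1 • fderiv ℝ f p (0, 0, 1) := by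
  rw [WD_apply, ← map_smul, ← map_add]; simp [vf]

theorem LD_false_eq (f : H → E) (p : H) :
    LD false f p = fderiv ℝ f p (0, 1, 0) + p.1 • fderiv ℝ f p (0, 0, 1) := by
  rw [LD, ← map_smul, ← map_add]; simp [lf]

theorem integral_WD {f : H → E} (hf : Bump f) (b : Bool) : ∫ p, WD b f p = 0 := by
  cases b
  · exact integral_fderiv_eq_zero hf _
  · have h : ∀ p, WD true f p = fderiv ℝ f p (1, 0, 0)
        + fderiv ℝ (fun q => cy q • f q) p (0, 0, 1) := fun p => by
      rw [WD_true_eq, fderiv_coord_smul hf.smooth]; simp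
    simp_rw [h]
    rw [integral_add (hf.fderiv_apply contDiff_const).integrable
      ((hf.coord cy).fderiv_apply contDiff_const).integrable, integral_fderiv_eq_zero hf,
      integral_fderiv_eq_zero (hf.coord cy), add_zero]

theorem integral_LD {f : H → E} (hf : Bump f) (b : Bool) : ∫ p, LD b f p = 0 := by
  cases b
  · have h : ∀ p, LD false f p = fderiv ℝ f p (0, 1, 0)
        + fderiv ℝ (fun q => cx q • f q) p (0, 0, 1) := fun p => by
      rw [LD_false_eq, fderiv_coord_smul hf.smooth]; simp
    simp_rw [h]
    rw [integral_add (hf.fderiv_apply contDiff_const).integrable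
      ((hf.coord cx).fderiv_apply contDiff_const).integrable, integral_fderiv_eq_zero hf,
      integral_fderiv_eq_zero (hf.coord cx), add_zero]
  · exact integral_fderiv_eq_zero hf _

theorem fderiv_smul_apply {u : V → ℝ} {f : V → E} (hu : Smooth u) (hf : Smooth f) (p v : V) :
    fderiv ℝ (fun q => u q • f q) p v = u p • fderiv ℝ f p v + fderiv ℝ u p v • f p := by
  have := (hu.differentiable p).hasFDerivAt.smul (hf.differentiable p).hasFDerivAt
  rw [HasFDerivAt.fderiv (f := fun q => u q • f q) this]; simp

theorem integral_WD_smul {u : H → ℝ} {f : H → E} (hu : Bump u) (hf : Smooth f) (b : Bool) :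
    ∫ p, WD b u p • f p = - ∫ p, u p • WD b f p := by
  have h := integral_WD (hu.smul hf) b
  have h2 : ∀ p, WD b (fun p => u p • f p) p = u p • WD b f p + WD b u p • f p := fun p => by
    simp only [WD_apply, fderiv_smul_apply hu.smooth hf]
  simp_rw [h2] at h
  rw [integral_add (hu.smul (hf.WD b)).integrable ((hu.WD b).smul hf).integrable] at h
  exact eq_neg_of_add_eq_zero_right h

theorem integral_LD_smul {u : H → ℝ} {f : H → E} (hu : Bump u) (hf : Smooth f) (b : Bool) :
    ∫ p, LD b u p • f p = - ∫ p, u p • LD b f p := by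
  have h := integral_LD (hu.smul hf) b
  have h2 : ∀ p, LD b (fun p => u p • f p) p = u p • LD b f p + LD b u p • f p := fun p => by
    simp only [LD, fderiv_smul_apply hu.smooth hf]
  simp_rw [h2] at h
  have h3 : Integrable (fun p => u p • LD b f p) :=
    (hu.smul (hf.fderiv_apply (smooth_lf b))).integrable
  rw [integral_add h3 ((hu.LD b).smul hf).integrable] at h
  exact eq_neg_of_add_eq_zero_right h

end Bump

section Mollifier

open MeasureTheory

variable {E : Type*} [NormedAddCommGroup E] [NormedSpace ℝ E]

/-- The average of `f` against the kernel `u` at scale `r`. -/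
def Pr (u : H → ℝ) (r : ℝ) (f : H → E) (p : H) : E := ∫ g, u g • f (mul (dilate r g) p)

/-- The linear part of `g ↦ δ_r g · p`. -/
def mulDilateLin (r : ℝ) (p : H) : H →L[ℝ] H :=
  (r • cx).prod ((r • cy).prod ((r ^ 2) • ((ContinuousLinearMap.snd ℝ ℝ ℝ).comp
    (ContinuousLinearMap.snd ℝ ℝ (ℝ × ℝ))) + (r * p.2.1) • cx))

theorem mul_dilate_eq (r : ℝ) (g p : H) : mul (dilate r g) p = p + mulDilateLin r p g := by
  simp only [mul, dilate, mulDilateLin]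
  ext
  · simp
  · simp
  · simp; ring

/-- The linear part of `p ↦ g · p`. -/
def mulLeftLin (g : H) : H →L[ℝ] H :=
  cx.prod (cy.prod (((ContinuousLinearMap.snd ℝ ℝ ℝ).comp
    (ContinuousLinearMap.snd ℝ ℝ (ℝ × ℝ))) + g.1 • cy))

theorem mul_left_eq (g p : H) : mul g p = g + mulLeftLin g p := by
  simp only [mul, mulLeftLin]
  ext
  · simp; ring
  · simp; ring
  · simp; ring

theorem fderiv_mul_dilate {f : H → E} (hf : Smooth f) (r : ℝ) (g p v : H) :
    fderiv ℝ (fun g => f (mul (dilate r g) p)) g v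
      = fderiv ℝ f (mul (dilate r g) p) (mulDilateLin r p v) := by
  have h : HasFDerivAt (fun g => mul (dilate r g) p) (mulDilateLin r p) g := by
    simp_rw [mul_dilate_eq]
    exact (mulDilateLin r p).hasFDerivAt.const_add p
  have := (hf.differentiable (mul (dilate r g) p)).hasFDerivAt.comp g h
  rw [HasFDerivAt.fderiv (f := fun g => f (mul (dilate r g) p)) this]; rfl

theorem fderiv_mul_left {f : H → E} (hf : Smooth f) (g p v : H) :
    fderiv ℝ (fun p => f (mul g p)) p v = fderiv ℝ f (mul g p) (mulLeftLin g v) := by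
  have h : HasFDerivAt (fun p => mul g p) (mulLeftLin g) p := by
    simp_rw [mul_left_eq]
    exact (mulLeftLin g).hasFDerivAt.const_add g
  have := (hf.differentiable (mul g p)).hasFDerivAt.comp p h
  rw [HasFDerivAt.fderiv (f := fun p => f (mul g p)) this]; rfl

theorem smooth_mul_dilate {f : H → E} (hf : Smooth f) :
    Smooth (fun q : (ℝ × H) × H => f (mul (dilate q.1.1 q.2) q.1.2)) := by
  refine ContDiff.comp hf ?_
  unfold mul dilate
  fun_prop

theorem smooth_mul_dilate_left {f : H → E} (hf : Smooth f) (r : ℝ) (p : H) :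
    Smooth (fun g : H => f (mul (dilate r g) p)) :=
  ((smooth_mul_dilate hf).comp (by fun_prop :
    ContDiff ℝ (⊤ : ℕ∞) fun g : H => (((r, p), g) : (ℝ × H) × H)) :)

theorem WD_mul_dilate {f : H → E} (hf : Smooth f) (r : ℝ) (g p : H) (b : Bool) :
    WD b (fun g => f (mul (dilate r g) p)) g = r • WD b f (mul (dilate r g) p) := by
  rw [WD_apply, WD_apply, fderiv_mul_dilate hf, ← map_smul]
  congr 1
  cases b
  · ext <;> simp [mulDilateLin, vf]
  · ext <;> simp [mulDilateLin, vf, mul, dilate]; ring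

theorem LD_mul_dilate {f : H → E} (hf : Smooth f) (r : ℝ) (g p : H) (b : Bool) :
    LD b (fun g => f (mul (dilate r g) p)) g = r • WD b (fun p => f (mul (dilate r g) p)) p := by
  rw [WD_apply, LD, fderiv_mul_dilate hf, fderiv_mul_left hf, ← map_smul]
  congr 1
  cases b
  · ext <;> simp [mulDilateLin, mulLeftLin, vf, lf, dilate]; ring
  · ext <;> simp [mulDilateLin, mulLeftLin, vf, lf, dilate]

theorem Pr_eq_setIntegral (u : H → ℝ) (r : ℝ) (f : H → E) (p : H) :
    Pr u r f p = ∫ g in tsupport u, u g • f (mul (dilate r g) p) := by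
  rw [Pr, setIntegral_eq_integral_of_forall_compl_eq_zero]
  intro g hg
  rw [image_eq_zero_of_notMem_tsupport hg, zero_smul]

theorem smooth_Pr_joint {u : H → ℝ} {f : H → E} (hu : Bump u) (hf : Smooth f) :
    Smooth (fun q : ℝ × H => Pr u q.1 f q.2) := by
  simp_rw [Pr_eq_setIntegral]
  exact smooth_integral_compact (P := ℝ × H) (V := H)
    (Φ := fun q => u q.2 • f (mul (dilate q.1.1 q.2) q.1.2)) hu.supp
    (ContDiff.smul (ContDiff.comp hu.smooth contDiff_snd) (smooth_mul_dilate hf))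

theorem smooth_Pr {u : H → ℝ} {f : H → E} (hu : Bump u) (hf : Smooth f) (r : ℝ) :
    Smooth (Pr u r f) :=
  ((smooth_Pr_joint hu hf).comp (by fun_prop :
    ContDiff ℝ (⊤ : ℕ∞) fun p : H => ((r, p) : ℝ × H)) :)

/-- Derivatives of averages are averages of derivatives of translates. -/
theorem WD_Pr {u : H → ℝ} {f : H → E} (hu : Bump u) (hf : Smooth f) (r : ℝ) (p : H) (b : Bool) :
    WD b (Pr u r f) p = ∫ g, u g • WD b (fun p => f (mul (dilate r g) p)) p := by
  have h1 : Pr u r f = fun p => ∫ g in tsupport u, u g • f (mul (dilate r g) p) :=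
    funext (Pr_eq_setIntegral u r f)
  have hΦ : Smooth (fun q : H × H => u q.2 • f (mul (dilate r q.2) q.1)) :=
    ContDiff.smul (ContDiff.comp hu.smooth contDiff_snd)
      ((smooth_mul_dilate hf).comp (by fun_prop :
        ContDiff ℝ (⊤ : ℕ∞) fun q : H × H => (((r, q.1), q.2) : (ℝ × H) × H)) :)
  have h2 : ∀ g, fderiv ℝ (fun p => u g • f (mul (dilate r g) p)) p (vf b p)
      = u g • WD b (fun p => f (mul (dilate r g) p)) p := fun g => by
    have hs : Smooth (fun p => f (mul (dilate r g) p)) :=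
      ((smooth_mul_dilate hf).comp (by fun_prop :
        ContDiff ℝ (⊤ : ℕ∞) fun p : H => (((r, p), g) : (ℝ × H) × H)) :)
    rw [← WD_apply, WD_const_smul _ hs]
  rw [WD_apply, h1, fderiv_integral_compact (P := H) (V := H)
    (Φ := fun q => u q.2 • f (mul (dilate r q.2) q.1)) hu.supp hΦ]
  simp_rw [h2]
  rw [setIntegral_eq_integral_of_forall_compl_eq_zero]
  intro g hg
  rw [image_eq_zero_of_notMem_tsupport hg, zero_smul]

theorem WD_Pr_eq_neg_Pr_LD {u : H → ℝ} {f : H → E} (hu : Bump u) (hf : Smooth f) {r : ℝ}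
    (hr : r ≠ 0) (b : Bool) :
    WD b (Pr u r f) = fun p => -(r⁻¹ • Pr (LD b u) r f p) := by
  funext p
  rw [WD_Pr hu hf, Pr, integral_LD_smul hu (smooth_mul_dilate_left hf r p)]
  simp_rw [LD_mul_dilate hf, smul_comm (u _) r]
  rw [integral_smul, smul_neg, neg_neg, smul_smul, inv_mul_cancel₀ hr, one_smul]

theorem Pr_WD {u : H → ℝ} {f : H → E} (hu : Bump u) (hf : Smooth f) (r : ℝ) (b : Bool) (p : H) :
    Pr (WD b u) r f p = -(r • Pr u r (WD b f) p) := by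
  rw [Pr, integral_WD_smul hu (smooth_mul_dilate_left hf r p)]
  simp_rw [WD_mul_dilate hf, smul_comm (u _) r]
  rw [integral_smul, Pr]

theorem Pr_add {u v : H → ℝ} {f : H → E} (hu : Bump u) (hv : Bump v) (hf : Smooth f) (r : ℝ)
    (p : H) : Pr (fun g => u g + v g) r f p = Pr u r f p + Pr v r f p := by
  simp_rw [Pr, add_smul]
  exact integral_add (hu.smul (smooth_mul_dilate_left hf r p)).integrable
    (hv.smul (smooth_mul_dilate_left hf r p)).integrable

theorem Pr_sub {u v : H → ℝ} {f : H → E} (hu : Bump u) (hv : Bump v) (hf : Smooth f) (r : ℝ)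
    (p : H) : Pr (fun g => u g - v g) r f p = Pr u r f p - Pr v r f p := by
  simp_rw [Pr, sub_smul]
  exact integral_sub (hu.smul (smooth_mul_dilate_left hf r p)).integrable
    (hv.smul (smooth_mul_dilate_left hf r p)).integrable

theorem norm_Pr_le {u : H → ℝ} {f : H → E} (hu : Bump u) {G : ℝ} {r : ℝ} {p : H}
    (hG : ∀ q, ‖f q‖ ≤ G) : ‖Pr u r f p‖ ≤ (∫ g, |u g|) * G := by
  rw [← integral_mul_const]
  refine norm_integral_le_of_norm_le (hu.integrable.abs.mul_const G)
    (Filter.Eventually.of_forall fun g => ?_)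
  rw [norm_smul, Real.norm_eq_abs]
  gcongr
  exact hG _

end Mollifier

section Kernels

open MeasureTheory

variable {E : Type*} [NormedAddCommGroup E] [NormedSpace ℝ E]

theorem fderiv_lf (b : Bool) (p x : H) :
    fderiv ℝ (lf b) p x = if b then 0 else (0, 0, x.1) := by
  cases b
  · have h : HasFDerivAt (lf false) ((0 : H →L[ℝ] ℝ).prod ((0 : H →L[ℝ] ℝ).prod cx)) p :=
      (hasFDerivAt_const _ _).prodMk ((hasFDerivAt_const _ _).prodMk cx.hasFDerivAt)
    rw [h.fderiv]; rfl
  · have : lf true = fun _ => (1, 0, 0) := rfl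
    simp [this]

theorem LD_WD_comm {f : H → E} (hf : Smooth f) (b c : Bool) :
    LD c (WD b f) = WD b (LD c f) := by
  funext p
  have h1 : WD b f = fun q => fderiv ℝ f q (vf b q) := funext (WD_apply b f)
  have h2 : LD c f = fun q => fderiv ℝ f q (lf c q) := rfl
  rw [WD_apply, LD, h1, h2, fderiv_fderiv_apply hf (smooth_vf b),
    fderiv_fderiv_apply hf (smooth_lf c), fderiv_fderiv_symm hf, fderiv_vf, fderiv_lf]
  congr 2
  cases b <;> cases c <;> rfl

/-- Kernels which are `k`-fold horizontal divergences. -/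
def Ord : ℕ → (H → ℝ) → Prop
  | 0, u => Bump u
  | k + 1, u => ∃ a b, Ord k a ∧ Ord k b ∧ u = fun p => WD true a p + WD false b p

theorem Ord.bump {k : ℕ} {u : H → ℝ} (h : Ord k u) : Bump u := by
  induction k generalizing u with
  | zero => exact h
  | succ k ih =>
    obtain ⟨a, b, ha, hb, rfl⟩ := h
    exact ((ih ha).WD _).add ((ih hb).WD _)

theorem Ord.of_succ {k : ℕ} {u : H → ℝ} (h : Ord (k + 1) u) : Ord k u := by
  induction k generalizing u with
  | zero => exact h.bump
  | succ k ih =>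
    obtain ⟨a, b, ha, hb, rfl⟩ := h
    exact ⟨a, b, ih ha, ih hb, rfl⟩

theorem Ord.mono {k l : ℕ} {u : H → ℝ} (h : Ord l u) (hkl : k ≤ l) : Ord k u := by
  induction l, hkl using Nat.le_induction with
  | base => exact h
  | succ l _ ih => exact ih h.of_succ

theorem Ord.add {k : ℕ} {u v : H → ℝ} (hu : Ord k u) (hv : Ord k v) :
    Ord k (fun p => u p + v p) := by
  induction k generalizing u v with
  | zero => exact Bump.add hu hv
  | succ k ih =>
    obtain ⟨a, b, ha, hb, rfl⟩ := hu
    obtain ⟨a', b', ha', hb', rfl⟩ := hv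
    refine ⟨_, _, ih ha ha', ih hb hb', ?_⟩
    rw [WD_add ha.bump.smooth ha'.bump.smooth, WD_add hb.bump.smooth hb'.bump.smooth]
    funext p; ring

theorem Ord.const_smul {k : ℕ} {u : H → ℝ} (hu : Ord k u) (c : ℝ) :
    Ord k (fun p => c • u p) := by
  induction k generalizing u with
  | zero => exact Bump.const_smul hu c
  | succ k ih =>
    obtain ⟨a, b, ha, hb, rfl⟩ := hu
    refine ⟨_, _, ih ha, ih hb, ?_⟩
    rw [WD_const_smul _ ha.bump.smooth, WD_const_smul _ hb.bump.smooth]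
    funext p; simp only [smul_eq_mul]; ring

theorem Ord.neg {k : ℕ} {u : H → ℝ} (hu : Ord k u) : Ord k (fun p => - u p) := by
  simpa using hu.const_smul (-1)

theorem Ord.LD {k : ℕ} {u : H → ℝ} (hu : Ord k u) (c : Bool) : Ord k (LD c u) := by
  induction k generalizing u with
  | zero => exact Bump.LD hu c
  | succ k ih =>
    obtain ⟨a, b, ha, hb, rfl⟩ := hu
    refine ⟨_, _, ih ha, ih hb, ?_⟩
    rw [← LD_WD_comm ha.bump.smooth, ← LD_WD_comm hb.bump.smooth]
    funext p
    simp only [Heisenberg.LD]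
    rw [fderiv_fun_add ((ha.bump.smooth.WD _).differentiable p)
      ((hb.bump.smooth.WD _).differentiable p)]
    rfl

theorem Bump.ord_fderiv_x {U : H → ℝ} (hU : Bump U) :
    Ord 1 (fun p => fderiv ℝ U p (1, 0, 0)) := by
  have hy := hU.coord cy
  refine ⟨fun p => U p + Heisenberg.WD false (fun q => cy q • U q) p,
    fun p => - Heisenberg.WD true (fun q => cy q • U q) p, hU.add (hy.WD _), (hy.WD _).neg, ?_⟩
  funext p
  rw [WD_add hU.smooth (hy.WD _).smooth, WD_neg]
  have hZ := ZD_eq hy.smooth p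
  have h1 : YD (XD fun q => cy q • U q) p = Heisenberg.WD false (Heisenberg.WD true fun q => cy q • U q) p := rfl
  have h2 : XD (YD fun q => cy q • U q) p = Heisenberg.WD true (Heisenberg.WD false fun q => cy q • U q) p := rfl
  have h3 : ZD (fun q => cy q • U q) p = cy p • fderiv ℝ U p (0, 0, 1) := by
    rw [ZD, fderiv_coord_smul hU.smooth]; simp
  rw [h1, h2, h3] at hZ
  have h4 := WD_true_eq U p
  simp only [smul_eq_mul] at hZ h4 ⊢
  have h5 : cy p = p.2.1 := rfl
  rw [h5] at hZ
  linarith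

theorem Bump.ord_fderiv_y {U : H → ℝ} (hU : Bump U) :
    Ord 1 (fun p => fderiv ℝ U p (0, 1, 0)) := by
  refine ⟨fun p => 0 • U p, U, hU.const_smul 0, hU, ?_⟩
  funext p
  rw [WD_const_smul 0 hU.smooth]
  simp [WD_apply, vf]

theorem Bump.ord_fderiv_z {U : H → ℝ} (hU : Bump U) :
    Ord 1 (fun p => fderiv ℝ U p (0, 0, 1)) := by
  refine ⟨fun p => - Heisenberg.WD false U p, Heisenberg.WD true U, (hU.WD _).neg, hU.WD _, ?_⟩
  funext p
  rw [WD_neg]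
  have hZ := ZD_eq hU.smooth p
  rw [ZD] at hZ
  rw [hZ]
  change _ - _ = - _ + _
  rw [neg_add_eq_sub]; rfl

/-! ### Dilated kernels -/

theorem exists_fderiv_eq_stretch_sub [CompleteSpace E] {v : H → E} (hv : Bump v) (e : H) (ℓ : H →L[ℝ] ℝ)
    (hℓ : ℓ e = 1) (hn : ∀ s : ℝ, 1 ≤ s → ∀ p : H, ‖p‖ ≤ ‖p + ((s - 1) * ℓ p) • e‖)
    {lam : ℝ} (hlam : 1 ≤ lam) :
    ∃ U : H → E, Bump U ∧
      ∀ p, lam • v (p + ((lam - 1) * ℓ p) • e) - v p = fderiv ℝ U p e := by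
  have hL : Smooth (fun q : H × ℝ => q.1 + ((q.2 - 1) * ℓ q.1) • e) := by
    unfold Smooth; fun_prop
  have hΦ : Smooth (fun q : H × ℝ => v (q.1 + ((q.2 - 1) * ℓ q.1) • e)) := hv.smooth.comp hL
  have hI : Smooth (fun p => ∫ s in Set.Icc 1 lam, v (p + ((s - 1) * ℓ p) • e)) :=
    smooth_integral_compact (P := H) (V := ℝ) isCompact_Icc hΦ
  refine ⟨fun p => ℓ p • ∫ s in Set.Icc 1 lam, v (p + ((s - 1) * ℓ p) • e), ⟨?_, ?_⟩, ?_⟩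
  · exact ContDiff.smul ℓ.contDiff hI
  · obtain ⟨R, hR⟩ := hv.supp.isCompact.isBounded.subset_closedBall (0 : H)
    refine HasCompactSupport.intro (isCompact_closedBall (0 : H) R) fun p hp => ?_
    rw [setIntegral_eq_zero_of_forall_eq_zero, smul_zero]
    intro s hs
    refine image_eq_zero_of_notMem_tsupport fun h => hp ?_
    have := hR h
    rw [mem_closedBall_zero_iff] at this ⊢
    exact (hn s hs.1 p).trans this
  · intro p
    rw [fderiv_coord_smul hI, fderiv_integral_compact (P := H) (V := ℝ)
      (Φ := fun q => v (q.1 + ((q.2 - 1) * ℓ q.1) • e)) isCompact_Icc hΦ, hℓ, one_smul,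
      ← integral_smul]
    have hd : ∀ s : ℝ, fderiv ℝ (fun q => v (q + ((s - 1) * ℓ q) • e)) p e
        = s • fderiv ℝ v (p + ((s - 1) * ℓ p) • e) e := by
      intro s
      have h1 : HasFDerivAt (fun q : H => q + ((s - 1) * ℓ q) • e)
          (ContinuousLinearMap.id ℝ H + ((s - 1) • ℓ).smulRight e) p :=
        (hasFDerivAt_id p).add (((s - 1) • ℓ).hasFDerivAt.smul_const e)
      have h2 := HasFDerivAt.comp (g := v) p (hv.smooth.differentiable _).hasFDerivAt h1
      rw [HasFDerivAt.fderiv (f := fun q => v (q + ((s - 1) * ℓ q) • e)) h2]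
      simp [hℓ, sub_smul]
    simp_rw [hd]
    have hc : Continuous fun s : ℝ => v (p + ((s - 1) * ℓ p) • e) :=
      hv.smooth.continuous.comp (by fun_prop)
    have hc' : Continuous fun s : ℝ => fderiv ℝ v (p + ((s - 1) * ℓ p) • e) e :=
      (hv.fderiv_apply (v := fun _ => e) contDiff_const).smooth.continuous.comp (by fun_prop)
    rw [← integral_add (Continuous.integrableOn_Icc (f := fun s : ℝ =>
        ℓ p • s • fderiv ℝ v (p + ((s - 1) * ℓ p) • e) e)
        (continuous_const.smul (continuous_id.smul hc')))
      hc.integrableOn_Icc, integral_Icc_eq_integral_Ioc,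
      ← intervalIntegral.integral_of_le hlam,
      intervalIntegral.integral_eq_sub_of_hasDerivAt
        (f := fun s : ℝ => s • v (p + ((s - 1) * ℓ p) • e))]
    · simp
    · intro s _
      have h1 : HasDerivAt (fun s : ℝ => p + ((s - 1) * ℓ p) • e) (ℓ p • e) s := by
        have := ((((hasDerivAt_id s).sub_const 1).mul_const (ℓ p)).smul_const e).const_add p
        simpa using this
      have h2 := HasFDerivAt.comp_hasDerivAt (l := v) s (hv.smooth.differentiable _).hasFDerivAt h1
      have h3 := (hasDerivAt_id s).smul h2
      refine HasDerivAt.congr_deriv (f := fun s : ℝ => s • v (p + ((s - 1) * ℓ p) • e)) h3 ?_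
      simp [smul_comm s]
    · exact Continuous.intervalIntegrable
        ((continuous_const.smul (continuous_id.smul hc')).add hc) _ _

theorem Bump.of_eq_fderiv {f v U : H → E} {e : H} (hv : Bump v) (hU : Bump U)
    (h : ∀ p, f p - v p = fderiv ℝ U p e) : Bump f := by
  have : f = fun p => v p + fderiv ℝ U p e := by
    funext p; rw [← h]; abel
  rw [this]
  exact hv.add (hU.fderiv_apply contDiff_const)

/-- The mass-preserving dilation by two of a function on `H`. -/
def dil (u : H → E) : H → E := fun g => (16 : ℝ) • u (dilate 2 g)

theorem exists_dil_sub_eq [CompleteSpace E] {u : H → E} (hu : Bump u) : ∃ U₁ U₂ U₃ : H → E,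
    Bump U₁ ∧ Bump U₂ ∧ Bump U₃ ∧ ∀ p, dil u p - u p =
      fderiv ℝ U₁ p (1, 0, 0) + fderiv ℝ U₂ p (0, 1, 0) + fderiv ℝ U₃ p (0, 0, 1) := by
  have hstretch : ∀ s x : ℝ, 1 ≤ s → ‖x‖ ≤ ‖x + (s - 1) * x‖ := by
    intro s x hs
    have : x + (s - 1) * x = s * x := by ring
    rw [this, norm_mul, Real.norm_eq_abs s, abs_of_nonneg (by linarith)]
    nlinarith [norm_nonneg x]
  obtain ⟨U₃, h₃, e₃⟩ := exists_fderiv_eq_stretch_sub hu (0, 0, 1)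
    ((ContinuousLinearMap.snd ℝ ℝ ℝ).comp (ContinuousLinearMap.snd ℝ ℝ (ℝ × ℝ))) (by simp)
    (fun s hs p => by
      have := hstretch s p.2.2 hs
      simp only [Prod.norm_def]
      refine max_le_max ?_ (max_le_max ?_ ?_)
      · simp
      · simp
      · simpa using this) (lam := 4) (by norm_num)
  set u₁ : H → E := fun p => (4 : ℝ) • u (p + ((4 - 1) * ((ContinuousLinearMap.snd ℝ ℝ ℝ).comp
    (ContinuousLinearMap.snd ℝ ℝ (ℝ × ℝ))) p) • (0, 0, 1)) with hu₁
  have b₁ : Bump u₁ := hu.of_eq_fderiv h₃ e₃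
  obtain ⟨U₂, h₂, e₂⟩ := exists_fderiv_eq_stretch_sub b₁ (0, 1, 0) cy (by simp)
    (fun s hs p => by
      have := hstretch s p.2.1 hs
      simp only [Prod.norm_def]
      refine max_le_max ?_ (max_le_max ?_ ?_)
      · simp
      · simpa [cy] using this
      · simp) (lam := 2) (by norm_num)
  set u₂ : H → E := fun p => (2 : ℝ) • u₁ (p + ((2 - 1) * cy p) • (0, 1, 0)) with hu₂
  have b₂ : Bump u₂ := b₁.of_eq_fderiv h₂ e₂
  obtain ⟨U₁, h₁, e₁⟩ := exists_fderiv_eq_stretch_sub b₂ (1, 0, 0) cx (by simp)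
    (fun s hs p => by
      have := hstretch s p.1 hs
      simp only [Prod.norm_def]
      refine max_le_max ?_ (max_le_max ?_ ?_)
      · simpa [cx] using this
      · simp
      · simp) (lam := 2) (by norm_num)
  refine ⟨U₁, U₂, U₃, h₁, h₂, h₃, fun p => ?_⟩
  rw [← e₁, ← e₂, ← e₃]
  have : dil u p = (2 : ℝ) • u₂ (p + ((2 - 1) * cx p) • (1, 0, 0)) := by
    simp only [hu₂, hu₁, dil, smul_smul]
    norm_num
    congr 1
    ext
    · simp [dilate]; ring
    · simp [dilate]; ring
    · simp [dilate]; ring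
  rw [this]
  abel

theorem Bump.dil [CompleteSpace E] {u : H → E} (hu : Bump u) : Bump (dil u) := by
  obtain ⟨U₁, U₂, U₃, h₁, h₂, h₃, e⟩ := exists_dil_sub_eq hu
  have : Heisenberg.dil u = fun p => u p + (fderiv ℝ U₁ p (1, 0, 0) + fderiv ℝ U₂ p (0, 1, 0)
      + fderiv ℝ U₃ p (0, 0, 1)) := by
    funext p; rw [← e]; abel
  rw [this]
  exact hu.add (((h₁.fderiv_apply contDiff_const).add (h₂.fderiv_apply contDiff_const)).add
    (h₃.fderiv_apply contDiff_const))

theorem integral_dil [CompleteSpace E] {u : H → E} (hu : Bump u) : ∫ p, dil u p = ∫ p, u p := by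
  obtain ⟨U₁, U₂, U₃, h₁, h₂, h₃, e⟩ := exists_dil_sub_eq hu
  have h : ∫ p, (dil u p - u p) = 0 := by
    simp_rw [e]
    rw [integral_add, integral_add, integral_fderiv_eq_zero h₁, integral_fderiv_eq_zero h₂,
      integral_fderiv_eq_zero h₃, add_zero, add_zero]
    · exact (h₁.fderiv_apply contDiff_const).integrable
    · exact (h₂.fderiv_apply contDiff_const).integrable
    · exact ((h₁.fderiv_apply contDiff_const).add (h₂.fderiv_apply contDiff_const)).integrable
    · exact (h₃.fderiv_apply contDiff_const).integrable
  rw [integral_sub hu.dil.integrable hu.integrable] at h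
  exact sub_eq_zero.1 h

theorem WD_dil {u : H → ℝ} (hu : Smooth u) (b : Bool) :
    WD b (dil u) = fun p => (2 : ℝ) • dil (WD b u) p := by
  have h : Smooth (fun g => u (dilate 2 g)) := by
    refine hu.comp ?_
    unfold dilate Smooth; fun_prop
  have h0 : ∀ g : H, mul (dilate 2 g) 0 = dilate 2 g := fun g => mul_zero' _
  funext p
  have := WD_mul_dilate hu 2 p 0 b
  simp_rw [h0] at this
  unfold dil
  rw [WD_const_smul _ h]
  change (16 : ℝ) • WD b (fun q => u (dilate 2 q)) p = _
  rw [this, smul_comm]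

theorem Ord.dil_sub {j : ℕ} {v : H → ℝ} (hv : Ord j v) :
    Ord (j + 1) (fun p => (2 : ℝ) ^ j * dil v p - v p) := by
  induction j generalizing v with
  | zero =>
    obtain ⟨U₁, U₂, U₃, h₁, h₂, h₃, e⟩ := exists_dil_sub_eq (u := v) hv
    simp only [pow_zero, one_mul, e]
    exact (h₁.ord_fderiv_x.add h₂.ord_fderiv_y).add h₃.ord_fderiv_z
  | succ j ih =>
    obtain ⟨a, b, ha, hb, rfl⟩ := hv
    refine ⟨_, _, ih ha, ih hb, ?_⟩
    have h : ∀ {a : H → ℝ}, Ord j a → ∀ c, WD c (fun p => (2 : ℝ) ^ j * dil a p - a p)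
        = fun p => 2 ^ (j + 1) * dil (WD c a) p - WD c a p := by
      intro a ha c
      have h1 := WD_sub (ha.bump.dil.const_smul ((2 : ℝ) ^ j)).smooth ha.bump.smooth c
      have h2 := WD_const_smul ((2 : ℝ) ^ j) ha.bump.dil.smooth c
      simp only [smul_eq_mul] at h1 h2
      rw [h1, h2, WD_dil ha.bump.smooth]
      funext p; simp only [smul_eq_mul]; ring
    rw [h ha, h hb]
    funext p
    simp only [dil, smul_eq_mul]; ring

theorem exists_kernel (k : ℕ) : ∃ χ : H → ℝ, Bump χ ∧ ∫ p, χ p = 1 ∧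
    Ord (k + 1) (fun p => dil χ p - χ p) := by
  induction k with
  | zero =>
    let f : ContDiffBump (0 : H) := ⟨1, 2, one_pos, one_lt_two⟩
    have hf : Bump (f.normed volume) := ⟨f.contDiff_normed, f.hasCompactSupport_normed⟩
    refine ⟨f.normed volume, hf, f.integral_normed, ?_⟩
    have := Ord.dil_sub (j := 0) hf
    simpa using this
  | succ k ih =>
    obtain ⟨χ, hχ, h1, ho⟩ := ih
    have hc : (2 : ℝ) ^ (k + 1) - 1 ≠ 0 := by
      have : (1 : ℝ) < 2 ^ (k + 1) := one_lt_pow₀ (by norm_num) (by omega)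
      linarith
    refine ⟨fun p => ((2 : ℝ) ^ (k + 1) - 1)⁻¹ • ((2 : ℝ) ^ (k + 1) • dil χ p - χ p),
      ((hχ.dil.const_smul _).sub hχ).const_smul _, ?_, ?_⟩
    · rw [integral_smul, integral_sub (hχ.dil.const_smul _).integrable hχ.integrable,
        integral_smul, integral_dil hχ, h1]
      simp only [smul_eq_mul, mul_one]
      exact inv_mul_cancel₀ hc
    · have := (ho.dil_sub).const_smul ((2 : ℝ) ^ (k + 1) - 1)⁻¹
      convert this using 1
      funext p
      simp only [dil, smul_eq_mul]
      ring

end Kernels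

section Mollify

open MeasureTheory

variable {E : Type*} [NormedAddCommGroup E] [NormedSpace ℝ E]

theorem Ord.exists_DD_Pr {k : ℕ} {u : H → ℝ} (hu : Ord k u) (w : List Bool) :
    ∃ u', Ord k u' ∧ ∀ {f : H → E}, Smooth f → ∀ {r : ℝ}, r ≠ 0 → ∀ p,
      DD w (Pr u r f) p = (r⁻¹) ^ w.length • Pr u' r f p := by
  induction w with
  | nil => exact ⟨u, hu, fun _ _ _ p => by simp⟩
  | cons b w ih =>
    obtain ⟨u', hu', h⟩ := ih
    refine ⟨fun p => - Heisenberg.LD b u' p, (hu'.LD b).neg, fun {f} hf {r} hr p => ?_⟩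
    have h1 : DD w (Pr u r f) = fun p => (r⁻¹) ^ w.length • Pr u' r f p := funext fun p => h hf hr p
    rw [DD_cons, h1, WD_const_smul _ (smooth_Pr hu'.bump hf r), WD_Pr_eq_neg_Pr_LD hu'.bump hf hr]
    have h2 : Pr (fun p => - Heisenberg.LD b u' p) r f p = - Pr (Heisenberg.LD b u') r f p := by
      simp [Pr, integral_neg]
    rw [h2, List.length_cons, pow_succ, mul_smul]
    simp

theorem Ord.exists_norm_Pr_le {k : ℕ} {u : H → ℝ} (hu : Ord k u) : ∃ C : ℝ, 0 ≤ C ∧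
    ∀ {f : H → E}, Smooth f → ∀ {r G : ℝ}, 0 < r →
      (∀ w : List Bool, w.length = k → ∀ q, ‖DD w f q‖ ≤ G) → ∀ p, ‖Pr u r f p‖ ≤ C * r ^ k * G := by
  induction k generalizing u with
  | zero =>
    refine ⟨∫ g, |u g|, integral_nonneg fun _ => abs_nonneg _, fun {f} hf {r G} hr h p => ?_⟩
    simpa using norm_Pr_le (r := r) (p := p) hu (h [] rfl)
  | succ k ih =>
    obtain ⟨a, b, ha, hb, rfl⟩ := hu
    obtain ⟨C₁, h₁, H₁⟩ := ih ha
    obtain ⟨C₂, h₂, H₂⟩ := ih hb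
    refine ⟨C₁ + C₂, add_nonneg h₁ h₂, fun {f} hf {r G} hr h p => ?_⟩
    rw [Pr_add (ha.bump.WD _) (hb.bump.WD _) hf, Pr_WD ha.bump hf, Pr_WD hb.bump hf]
    have e₁ := H₁ (hf.WD true) hr (fun w hw q => by
      rw [← DD_concat]; exact h _ (by simp [hw]) q) p
    have e₂ := H₂ (hf.WD false) hr (fun w hw q => by
      rw [← DD_concat]; exact h _ (by simp [hw]) q) p
    refine (norm_add_le _ _).trans ?_
    rw [norm_neg, norm_neg, norm_smul, norm_smul, Real.norm_of_nonneg hr.le, pow_succ]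
    nlinarith [mul_le_mul_of_nonneg_left e₁ hr.le, mul_le_mul_of_nonneg_left e₂ hr.le]

theorem Bump.exists_norm_Pr_le_of_integral_eq_zero [CompleteSpace E] {u : H → ℝ} (hu : Bump u)
    (h0 : ∫ p, u p = 0) {α : ℝ} (hα : 0 < α) : ∃ C : ℝ, 0 ≤ C ∧
    ∀ {f : H → E}, Smooth f → ∀ {r G : ℝ}, 0 < r → 0 ≤ G →
      (∀ p q, ‖f p - f q‖ ≤ G * ccDist p q ^ α) → ∀ p, ‖Pr u r f p‖ ≤ C * r ^ α * G := by
  have hcont : Continuous fun g : H => |g.1| + |g.2.1| + 4 * √|g.2.2| := by fun_prop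
  obtain ⟨D, hD⟩ := (hu.supp.isCompact.image hcont).isBounded.subset_closedBall (0 : ℝ)
  have hInt : Integrable (fun g => |u g| * |D| ^ α) := (hu.integrable.abs).mul_const _
  refine ⟨∫ g, |u g| * |D| ^ α, integral_nonneg fun _ => by positivity,
    fun {f} hf {r G} hr hG h p => ?_⟩
  have h1 : Pr u r f p = ∫ g, u g • (f (mul (dilate r g) p) - f p) := by
    simp_rw [smul_sub]
    rw [integral_sub (hu.smul (smooth_mul_dilate_left hf r p)).integrable
      (hu.integrable.smul_const _), integral_smul_const, h0, zero_smul, sub_zero]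
    rfl
  rw [h1, ← integral_mul_const, ← integral_mul_const]
  refine norm_integral_le_of_norm_le ((hInt.mul_const _).mul_const _) (ae_of_all _ fun g => ?_)
  rw [norm_smul, Real.norm_eq_abs]
  by_cases hg : g ∈ tsupport u
  · have hgD : |g.1| + |g.2.1| + 4 * √|g.2.2| ≤ |D| := by
      have := hD ⟨g, hg, rfl⟩
      rw [mem_closedBall_zero_iff] at this
      exact (le_abs_self _).trans (this.trans (le_abs_self _))
    have h2 : ccDist p (mul (dilate r g) p) ≤ r * |D| :=
      (ccDist_dilate_mul_left_le hr.le g p).trans (by gcongr)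
    have h3 : ‖f (mul (dilate r g) p) - f p‖ ≤ G * (r * |D|) ^ α := by
      rw [norm_sub_rev]
      refine (h _ _).trans ?_
      gcongr
      exact ccDist_nonneg _ _
    rw [Real.mul_rpow hr.le (abs_nonneg _)] at h3
    calc |u g| * ‖f (mul (dilate r g) p) - f p‖ ≤ |u g| * (G * (r ^ α * |D| ^ α)) := by gcongr
      _ = _ := by ring
  · rw [image_eq_zero_of_notMem_tsupport hg]; simp

theorem Ord.exists_norm_Pr_le_holder [CompleteSpace E] {k : ℕ} {u : H → ℝ} (hu : Ord (k + 1) u)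
    {α : ℝ} (hα : 0 < α) : ∃ C : ℝ, 0 ≤ C ∧
    ∀ {f : H → E}, Smooth f → ∀ {r G : ℝ}, 0 < r → 0 ≤ G →
      (∀ w : List Bool, w.length = k → ∀ p q, ‖DD w f p - DD w f q‖ ≤ G * ccDist p q ^ α) →
      ∀ p, ‖Pr u r f p‖ ≤ C * r ^ k * r ^ α * G := by
  induction k generalizing u with
  | zero =>
    have h0 : ∫ p, u p = 0 := by
      obtain ⟨a, b, ha, hb, rfl⟩ := hu
      rw [integral_add (ha.bump.WD _).integrable (hb.bump.WD _).integrable, integral_WD ha.bump,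
        integral_WD hb.bump, add_zero]
    obtain ⟨C, hC, h⟩ := hu.bump.exists_norm_Pr_le_of_integral_eq_zero (E := E) h0 hα
    refine ⟨C, hC, fun {f} hf {r G} hr hG hh p => ?_⟩
    simpa using h hf hr hG (hh [] rfl) p
  | succ k ih =>
    obtain ⟨a, b, ha, hb, rfl⟩ := hu
    obtain ⟨C₁, h₁, H₁⟩ := ih ha
    obtain ⟨C₂, h₂, H₂⟩ := ih hb
    refine ⟨C₁ + C₂, add_nonneg h₁ h₂, fun {f} hf {r G} hr hG h p => ?_⟩
    rw [Pr_add (ha.bump.WD _) (hb.bump.WD _) hf, Pr_WD ha.bump hf, Pr_WD hb.bump hf]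
    have e₁ := H₁ (hf.WD true) hr hG (fun w hw q => by
      rw [← DD_concat]; exact h _ (by simp [hw]) q) p
    have e₂ := H₂ (hf.WD false) hr hG (fun w hw q => by
      rw [← DD_concat]; exact h _ (by simp [hw]) q) p
    refine (norm_add_le _ _).trans ?_
    rw [norm_neg, norm_neg, norm_smul, norm_smul, Real.norm_of_nonneg hr.le, pow_succ]
    nlinarith [mul_le_mul_of_nonneg_left e₁ hr.le, mul_le_mul_of_nonneg_left e₂ hr.le]

theorem LD_true_eq_of_bump {u : H → ℝ} (hu : Bump u) :
    LD true u = fun p => WD true (fun q => u q + WD false (fun q => cy q • u q) q) p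
      - WD false (WD true fun q => cy q • u q) p := by
  have hy := hu.coord cy
  funext p
  rw [WD_add hu.smooth (hy.WD _).smooth]
  have hZ := ZD_eq hy.smooth p
  have h1 : YD (XD fun q => cy q • u q) p = WD false (WD true fun q => cy q • u q) p := rfl
  have h2 : XD (YD fun q => cy q • u q) p = WD true (WD false fun q => cy q • u q) p := rfl
  have h3 : ZD (fun q => cy q • u q) p = cy p • fderiv ℝ u p (0, 0, 1) := by
    rw [ZD, fderiv_coord_smul hu.smooth]; simp
  rw [h1, h2, h3] at hZ
  have h4 := WD_true_eq u p
  have h6 : LD true u p = fderiv ℝ u p (1, 0, 0) := rfl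
  simp only [smul_eq_mul] at hZ h4 ⊢
  have h5 : cy p = p.2.1 := rfl
  rw [h5] at hZ
  rw [h6]
  linarith

theorem LD_false_eq_of_bump {u : H → ℝ} (hu : Bump u) :
    LD false u = fun p => WD false (fun q => u q + WD true (fun q => cx q • u q) q) p
      - WD true (WD false fun q => cx q • u q) p := by
  have hx := hu.coord cx
  funext p
  rw [WD_add hu.smooth (hx.WD _).smooth]
  have hZ := ZD_eq hx.smooth p
  have h1 : YD (XD fun q => cx q • u q) p = WD false (WD true fun q => cx q • u q) p := rfl
  have h2 : XD (YD fun q => cx q • u q) p = WD true (WD false fun q => cx q • u q) p := rfl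
  have h3 : ZD (fun q => cx q • u q) p = cx p • fderiv ℝ u p (0, 0, 1) := by
    rw [ZD, fderiv_coord_smul hu.smooth]; simp
  rw [h1, h2, h3] at hZ
  have h4 := LD_false_eq u p
  have h6 : WD false u p = fderiv ℝ u p (0, 1, 0) := rfl
  simp only [smul_eq_mul] at hZ h4 ⊢
  have h5 : cx p = p.1 := rfl
  rw [h5] at hZ
  rw [h4, h6]
  linarith

/-- Horizontal derivatives can be moved from the mollification to the function. -/
theorem Bump.exists_WD_Pr {u : H → ℝ} (hu : Bump u) (b : Bool) :
    ∃ a c : H → ℝ, Bump a ∧ Bump c ∧ ∀ {f : H → E}, Smooth f → ∀ {r : ℝ}, r ≠ 0 →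
      Heisenberg.WD b (Pr u r f) =
        fun p => Pr a r (Heisenberg.WD b f) p - Pr c r (Heisenberg.WD (!b) f) p := by
  cases b
  · have hx := hu.coord cx
    have ha := hu.add (hx.WD true)
    have hc := hx.WD false
    refine ⟨_, _, ha, hc, fun {f} hf {r} hr => ?_⟩
    rw [WD_Pr_eq_neg_Pr_LD hu hf hr, LD_false_eq_of_bump hu]
    funext p
    rw [Pr_sub (ha.WD _) (hc.WD _) hf, Pr_WD ha hf, Pr_WD hc hf, smul_sub, smul_neg, smul_neg,
      inv_smul_smul₀ hr, inv_smul_smul₀ hr]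
    simp only [Bool.not_false]
    abel
  · have hy := hu.coord cy
    have ha := hu.add (hy.WD false)
    have hc := hy.WD true
    refine ⟨_, _, ha, hc, fun {f} hf {r} hr => ?_⟩
    rw [WD_Pr_eq_neg_Pr_LD hu hf hr, LD_true_eq_of_bump hu]
    funext p
    rw [Pr_sub (ha.WD _) (hc.WD _) hf, Pr_WD ha hf, Pr_WD hc hf, smul_sub, smul_neg, smul_neg,
      inv_smul_smul₀ hr, inv_smul_smul₀ hr]
    simp only [Bool.not_true]
    abel

theorem Bump.exists_norm_DD_append_Pr_le {u : H → ℝ} (hu : Bump u) (v w : List Bool) :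
    ∃ C : ℝ, 0 ≤ C ∧ ∀ {f : H → E}, Smooth f → ∀ {r G : ℝ}, 0 < r →
      (∀ w' : List Bool, w'.length = w.length → ∀ q, ‖DD w' f q‖ ≤ G) →
      ∀ p, ‖DD (v ++ w) (Pr u r f) p‖ ≤ C * (r⁻¹) ^ v.length * G := by
  induction w using List.reverseRecOn generalizing u with
  | nil =>
    obtain ⟨u', hu', h⟩ := Ord.exists_DD_Pr (E := E) (k := 0) hu v
    refine ⟨∫ g, |u' g|, integral_nonneg fun _ => abs_nonneg _, fun {f} hf {r G} hr hG p => ?_⟩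
    rw [List.append_nil, h hf hr.ne', norm_smul, norm_pow, Real.norm_of_nonneg (by positivity)]
    have := norm_Pr_le (r := r) (p := p) hu' (hG [] rfl)
    simp only [DD_nil] at this
    calc _ ≤ (r⁻¹) ^ v.length * ((∫ g, |u' g|) * G) := by gcongr
      _ = _ := by ring
  | append_singleton w b ih =>
    obtain ⟨a, c, ha, hc, h⟩ := hu.exists_WD_Pr (E := E) b
    obtain ⟨C₁, h₁, H₁⟩ := ih ha
    obtain ⟨C₂, h₂, H₂⟩ := ih hc
    refine ⟨C₁ + C₂, add_nonneg h₁ h₂, fun {f} hf {r G} hr hG p => ?_⟩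
    rw [← List.append_assoc, DD_concat, h hf hr.ne',
      DD_sub (smooth_Pr ha (hf.WD _) r) (smooth_Pr hc (hf.WD _) r)]
    refine (norm_sub_le _ _).trans ?_
    have e₁ := H₁ (hf.WD b) (G := G) hr (fun w' hw' q => by
      rw [← DD_concat]; exact hG _ (by simp [hw']) q) p
    have e₂ := H₂ (hf.WD !b) (G := G) hr (fun w' hw' q => by
      rw [← DD_concat]; exact hG _ (by simp [hw']) q) p
    calc _ ≤ C₁ * r⁻¹ ^ v.length * G + C₂ * r⁻¹ ^ v.length * G := add_le_add e₁ e₂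
      _ = _ := by ring

/-- A uniform version over words of bounded length. -/
theorem exists_uniform_words (n : ℕ) {Q : List Bool → ℝ → Prop}
    (h : ∀ w, ∃ C : ℝ, 0 ≤ C ∧ Q w C) (hm : ∀ w C C', C ≤ C' → Q w C → Q w C') :
    ∃ C : ℝ, 0 ≤ C ∧ ∀ w : List Bool, w.length ≤ n → Q w C := by
  choose C hC hQ using h
  have hfin : {w : List Bool | w.length ≤ n}.Finite := List.finite_length_le Bool n
  refine ⟨∑ w ∈ hfin.toFinset, C w, Finset.sum_nonneg fun w _ => hC w, fun w hw => ?_⟩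
  refine hm w _ _ (Finset.single_le_sum (f := C) (fun w _ => hC w) ?_) (hQ w)
  simpa using hw

theorem Bump.exists_norm_DD_Pr_le {u : H → ℝ} (hu : Bump u) (n : ℕ) :
    ∃ C : ℝ, 0 ≤ C ∧ ∀ {f : H → E}, Smooth f → ∀ {r G : ℝ}, 0 < r → 0 ≤ G → ∀ {k j : ℕ},
      (∀ w' : List Bool, w'.length = k → ∀ q, ‖DD w' f q‖ ≤ G) →
      ∀ w : List Bool, w.length = k + j → w.length ≤ n →
      ∀ p, ‖DD w (Pr u r f) p‖ ≤ C * (r⁻¹) ^ j * G := by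
  obtain ⟨C, hC, h⟩ := exists_uniform_words n (Q := fun v C => ∀ w : List Bool, w.length ≤ n →
      ∀ {f : H → E}, Smooth f → ∀ {r G : ℝ}, 0 < r → 0 ≤ G →
      (∀ w' : List Bool, w'.length = w.length → ∀ q, ‖DD w' f q‖ ≤ G) →
      ∀ p, ‖DD (v ++ w) (Pr u r f) p‖ ≤ C * (r⁻¹) ^ v.length * G) (by
    intro v
    refine exists_uniform_words n ?_ ?_
    · intro w
      obtain ⟨C, hC, h⟩ := hu.exists_norm_DD_append_Pr_le (E := E) v w
      exact ⟨C, hC, fun {f} hf {r G} hr _ => h hf hr⟩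
    · intro w C C' hCC h f hf r G hr hG hh p
      refine (h hf hr hG hh p).trans ?_
      gcongr) (by
    intro v C C' hCC h w hw f hf r G hr hG hh p
    refine (h w hw hf hr hG hh p).trans ?_
    gcongr)
  refine ⟨C, hC, fun {f} hf {r G} hr hG {k j} hk w hw hn p => ?_⟩
  have := h (w.take j) (by simp; omega) (w.drop j) (by simp; omega) hf hr hG
    (by simpa [hw] using hk) p
  rw [List.take_append_drop] at this
  simpa [hw] using this

theorem Ord.exists_norm_DD_Pr_le {k : ℕ} {u : H → ℝ} (hu : Ord k u) (n : ℕ) : ∃ C : ℝ, 0 ≤ C ∧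
    ∀ {f : H → E}, Smooth f → ∀ {r G : ℝ}, 0 < r → 0 ≤ G → ∀ {l : ℕ}, l ≤ k →
      (∀ w : List Bool, w.length = l → ∀ q, ‖DD w f q‖ ≤ G) →
      ∀ w : List Bool, w.length ≤ n → ∀ p,
      ‖DD w (Pr u r f) p‖ ≤ C * ((r⁻¹) ^ w.length * r ^ l) * G := by
  obtain ⟨C, hC, h⟩ := exists_uniform_words n (Q := fun w C => ∀ l ∈ Finset.range (k + 1),
      ∀ {f : H → E}, Smooth f → ∀ {r G : ℝ}, 0 < r → 0 ≤ G →
      (∀ w : List Bool, w.length = l → ∀ q, ‖DD w f q‖ ≤ G) →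
      ∀ p, ‖DD w (Pr u r f) p‖ ≤ C * ((r⁻¹) ^ w.length * r ^ l) * G) (by
    intro w
    obtain ⟨u', hu', h⟩ := Ord.exists_DD_Pr (E := E) hu w
    have : ∀ l ∈ Finset.range (k + 1), ∃ C : ℝ, 0 ≤ C ∧ ∀ {f : H → E}, Smooth f →
        ∀ {r G : ℝ}, 0 < r →
        (∀ w : List Bool, w.length = l → ∀ q, ‖DD w f q‖ ≤ G) → ∀ p,
        ‖Pr u' r f p‖ ≤ C * r ^ l * G := fun l hl =>
      (hu'.mono (Nat.lt_succ_iff.1 (Finset.mem_range.1 hl))).exists_norm_Pr_le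
    choose! C hC hh using this
    refine ⟨∑ l ∈ Finset.range (k + 1), C l, Finset.sum_nonneg hC,
      fun l hl {f} hf {r G} hr hG hG' p => ?_⟩
    rw [h hf hr.ne', norm_smul, norm_pow, Real.norm_of_nonneg (by positivity)]
    have h1 := hh l hl hf hr hG' p
    have h2 : C l ≤ ∑ l ∈ Finset.range (k + 1), C l := Finset.single_le_sum hC hl
    calc _ ≤ (r⁻¹) ^ w.length * (C l * r ^ l * G) := by gcongr
      _ ≤ (r⁻¹) ^ w.length * ((∑ l ∈ Finset.range (k + 1), C l) * r ^ l * G) := by gcongr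
      _ = _ := by ring) (by
    intro w C C' hCC h l hl f hf r G hr hG hG' p
    refine (h l hl hf hr hG hG' p).trans ?_
    gcongr)
  exact ⟨C, hC, fun {f} hf {r G} hr hG {l} hl hl' w hw p =>
    h w hw l (Finset.mem_range.2 (Nat.lt_succ_of_le hl)) hf hr hG hl' p⟩

theorem Ord.exists_norm_DD_Pr_le_holder [CompleteSpace E] {k : ℕ} {u : H → ℝ}
    (hu : Ord (k + 1) u) {α : ℝ} (hα : 0 < α) (n : ℕ) : ∃ C : ℝ, 0 ≤ C ∧
    ∀ {f : H → E}, Smooth f → ∀ {r G : ℝ}, 0 < r → 0 ≤ G →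
      (∀ w : List Bool, w.length = k → ∀ p q, ‖DD w f p - DD w f q‖ ≤ G * ccDist p q ^ α) →
      ∀ w : List Bool, w.length ≤ n → ∀ p,
      ‖DD w (Pr u r f) p‖ ≤ C * ((r⁻¹) ^ w.length * r ^ k * r ^ α) * G := by
  obtain ⟨C, hC, h⟩ := exists_uniform_words n (Q := fun w C =>
      ∀ {f : H → E}, Smooth f → ∀ {r G : ℝ}, 0 < r → 0 ≤ G →
      (∀ w : List Bool, w.length = k → ∀ p q, ‖DD w f p - DD w f q‖ ≤ G * ccDist p q ^ α) →
      ∀ p, ‖DD w (Pr u r f) p‖ ≤ C * ((r⁻¹) ^ w.length * r ^ k * r ^ α) * G) (by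
    intro w
    obtain ⟨u', hu', h⟩ := Ord.exists_DD_Pr (E := E) hu w
    obtain ⟨C, hC, hh⟩ := hu'.exists_norm_Pr_le_holder (E := E) hα
    refine ⟨C, hC, fun {f} hf {r G} hr hG hG' p => ?_⟩
    rw [h hf hr.ne', norm_smul, norm_pow, Real.norm_of_nonneg (by positivity)]
    have h1 := hh hf hr hG hG' p
    calc _ ≤ (r⁻¹) ^ w.length * (C * r ^ k * r ^ α * G) := by gcongr
      _ = _ := by ring) (by
    intro w C C' hCC h f hf r G hr hG hG' p
    refine (h hf hr hG hG' p).trans ?_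
    gcongr)
  exact ⟨C, hC, fun {f} hf {r G} hr hG hl' w hw p => h w hw hf hr hG hl' p⟩

/-! ### Behaviour as the scale tends to zero -/

theorem smooth_DD_joint {F : ℝ × H → E} (hF : Smooth F) (w : List Bool) :
    Smooth (fun q : ℝ × H => DD w (fun p => F (q.1, p)) q.2) := by
  induction w with
  | nil => exact hF
  | cons b w ih =>
    have h : ∀ q : ℝ × H, DD (b :: w) (fun p => F (q.1, p)) q.2
        = fderiv ℝ (fun q : ℝ × H => DD w (fun p => F (q.1, p)) q.2) q (0, vf b q.2) := by
      intro q
      rw [DD_cons, WD_apply]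
      have h1 : HasFDerivAt (fun p : H => (q.1, p)) (ContinuousLinearMap.inr ℝ ℝ H) q.2 :=
        hasFDerivAt_prodMk_right q.1 q.2
      have h2 := HasFDerivAt.comp (g := fun q : ℝ × H => DD w (fun p => F (q.1, p)) q.2) q.2
        (ih.differentiable (q.1, q.2)).hasFDerivAt h1
      have h3 : DD w (fun p => F (q.1, p))
        = (fun q : ℝ × H => DD w (fun p => F (q.1, p)) q.2) ∘ fun p => (q.1, p) := rfl
      rw [h3, h2.fderiv]
      simp
    simp_rw [h]
    refine ih.fderiv_apply (v := fun q : ℝ × H => ((0 : ℝ), vf b q.2)) ?_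
    exact contDiff_const.prodMk ((smooth_vf b).comp contDiff_snd)

theorem Pr_zero {u : H → ℝ} [CompleteSpace E] {f : H → E} (p : H) (h1 : ∫ g, u g = 1) :
    Pr u 0 f p = f p := by
  have : ∀ g : H, mul (dilate 0 g) p = p := fun g => by simp [mul, dilate]
  simp only [Pr, this]
  rw [integral_smul_const, h1, one_smul]

theorem eventually_norm_DD_sub_Pr_le [CompleteSpace E] {u : H → ℝ} (hu : Bump u)
    (h1 : ∫ g, u g = 1) {f : H → E} (hf : Smooth f) (w : List Bool) {K : Set H}
    (hK : IsCompact K) {ε : ℝ} (hε : 0 < ε) :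
    ∀ᶠ r in nhds (0 : ℝ), ∀ p ∈ K, ‖DD w f p - DD w (Pr u r f) p‖ ≤ ε := by
  have hc := (smooth_DD_joint (smooth_Pr_joint hu hf) w).continuous
  have h0 : DD w f = DD w (Pr u 0 f) := by
    congr 1; funext p; rw [Pr_zero p h1]
  refine hK.eventually_forall_of_forall_eventually fun p _ => ?_
  have h2 : Continuous fun q : ℝ × H => ‖DD w f q.2 - DD w (Pr u q.1 f) q.2‖ :=
    (((hf.DD w).continuous.comp continuous_snd).sub hc).norm
  have h3 := h2.tendsto (0, p)
  simp only [h0, sub_self, norm_zero] at h3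
  have := h3.eventually (ge_mem_nhds hε)
  simpa only [h0] using this

theorem Pr_dil {u : H → ℝ} [CompleteSpace E] (hu : Bump u) {f : H → E} (hf : Smooth f) (r : ℝ)
    (p : H) : Pr (dil u) r f p = Pr u (r / 2) f p := by
  have h := integral_dil (hu.smul (smooth_mul_dilate_left hf (r / 2) p))
  rw [Pr, Pr, ← h]
  refine integral_congr_ae (ae_of_all _ fun g => ?_)
  have : dilate (r / 2) (dilate 2 g) = dilate r g := by
    simp only [dilate]
    ext <;> simp <;> ring
  simp only [dil, this, smul_smul, smul_eq_mul]

/-- A mollification kernel all of whose low order moments agree with those of the delta mass. -/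
structure IsKernel (k : ℕ) (χ : H → ℝ) : Prop where
  bump : Bump χ
  integral_eq : ∫ p, χ p = 1
  ord : Ord k (fun p => dil χ p - χ p)

theorem Pr_half_sub {k : ℕ} {χ : H → ℝ} [CompleteSpace E] (hχ : IsKernel k χ) {f : H → E}
    (hf : Smooth f) (r : ℝ) (p : H) :
    Pr χ (r / 2) f p - Pr χ r f p = Pr (fun p => dil χ p - χ p) r f p := by
  rw [Pr_sub hχ.bump.dil hχ.bump hf, Pr_dil hχ.bump hf]

theorem IsKernel.exists_norm_DD_sub_Pr_le [CompleteSpace E] {k : ℕ} {χ : H → ℝ}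
    (hχ : IsKernel k χ) : ∃ C : ℝ, 0 ≤ C ∧
    ∀ {f : H → E}, Smooth f → ∀ {r G : ℝ}, 0 < r → 0 ≤ G → ∀ {l : ℕ}, l ≤ k →
      (∀ w : List Bool, w.length = l → ∀ q, ‖DD w f q‖ ≤ G) →
      ∀ w : List Bool, w.length < l → ∀ p,
      ‖DD w (fun p => f p - Pr χ r f p) p‖ ≤ C * r ^ (l - w.length) * G := by
  obtain ⟨C, hC, h⟩ := hχ.ord.exists_norm_DD_Pr_le (E := E) k
  refine ⟨2 * C, by positivity, fun {f} hf {r G} hr hG {l} hl hl' w hw p => ?_⟩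
  have hS : ∀ ρ, Smooth (Pr χ ρ f) := smooth_Pr hχ.bump hf
  have key : ∀ n : ℕ, ‖DD w (Pr χ (r / 2 ^ n) f) p - DD w (Pr χ r f) p‖
      ≤ ∑ m ∈ Finset.range n, C * r ^ (l - w.length) * G * (1 / 2) ^ m := by
    intro n
    induction n with
    | zero => simp
    | succ n ih =>
      rw [Finset.sum_range_succ]
      have hρ : 0 < r / 2 ^ n := by positivity
      have h1 : DD w (Pr χ (r / 2 ^ (n + 1)) f) p - DD w (Pr χ (r / 2 ^ n) f) p
          = DD w (Pr (fun p => dil χ p - χ p) (r / 2 ^ n) f) p := by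
        have h2 : Pr (fun p => dil χ p - χ p) (r / 2 ^ n) f
            = fun p => Pr χ (r / 2 ^ (n + 1)) f p - Pr χ (r / 2 ^ n) f p := by
          funext p
          rw [← Pr_half_sub hχ hf, div_div, ← pow_succ]
        rw [h2, DD_sub (hS _) (hS _)]
      have h3 := h hf hρ hG hl hl' w (by omega) p
      rw [← h1] at h3
      have h4 : ((r / 2 ^ n)⁻¹) ^ w.length * (r / 2 ^ n) ^ l = (r / 2 ^ n) ^ (l - w.length) := by
        rw [inv_pow, inv_mul_eq_div, div_eq_iff (by positivity), ← pow_add]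
        congr 1; omega
      have h5 : (r / 2 ^ n) ^ (l - w.length) ≤ r ^ (l - w.length) * (1 / 2) ^ n := by
        rw [div_pow, div_eq_mul_inv]
        gcongr
        rw [one_div, inv_pow]
        gcongr
        exact le_self_pow₀ (one_le_pow₀ one_le_two) (by omega)
      rw [h4] at h3
      calc _ ≤ ‖DD w (Pr χ (r / 2 ^ (n + 1)) f) p - DD w (Pr χ (r / 2 ^ n) f) p‖
            + ‖DD w (Pr χ (r / 2 ^ n) f) p - DD w (Pr χ r f) p‖ := norm_sub_le_norm_sub_add_norm_sub _ _ _
        _ ≤ C * (r ^ (l - w.length) * (1 / 2) ^ n) * G + _ :=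
          add_le_add (h3.trans (by gcongr)) ih
        _ = _ := by ring
  have hb : ∀ n : ℕ, ‖DD w (Pr χ (r / 2 ^ n) f) p - DD w (Pr χ r f) p‖
      ≤ 2 * C * r ^ (l - w.length) * G := by
    intro n
    refine (key n).trans ?_
    rw [← Finset.mul_sum]
    have : ∑ m ∈ Finset.range n, (1 / 2 : ℝ) ^ m ≤ 2 := sum_geometric_two_le n
    calc _ ≤ C * r ^ (l - w.length) * G * 2 := by gcongr
      _ = _ := by ring
  rw [DD_sub hf (hS _)]
  have hlim : Filter.Tendsto (fun n : ℕ => r / 2 ^ n) Filter.atTop (nhds 0) := by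
    have := (tendsto_pow_atTop_nhds_zero_of_lt_one (r := (1 / 2 : ℝ)) (by norm_num)
      (by norm_num)).const_mul r
    simpa [div_eq_mul_inv] using this
  refine le_of_forall_pos_le_add fun ε hε => ?_
  obtain ⟨n, hn⟩ := (hlim.eventually (eventually_norm_DD_sub_Pr_le hχ.bump hχ.integral_eq hf w
    (isCompact_singleton (x := p)) hε)).exists
  have := hn p rfl
  calc _ ≤ ‖DD w f p - DD w (Pr χ (r / 2 ^ n) f) p‖
        + ‖DD w (Pr χ (r / 2 ^ n) f) p - DD w (Pr χ r f) p‖ := norm_sub_le_norm_sub_add_norm_sub _ _ _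
    _ ≤ ε + _ := add_le_add this (hb n)
    _ = _ := add_comm _ _

end Mollify

section LocallyFiniteSums

variable {ι : Type*} {E : Type*} [NormedAddCommGroup E] [NormedSpace ℝ E]

/-- Families of functions on `H` that vanish locally for all but finitely many indices. -/
def LF (f : ι → H → E) : Prop :=
  ∀ p, ∃ s : Finset ι, ∀ᶠ q in nhds p, ∀ i ∉ s, f i q = 0

/-- The sum of a locally finite family. -/
def lsum (f : ι → H → E) (p : H) : E := ∑ᶠ i, f i p

theorem lsum_eq_sum {f : ι → H → E} {s : Finset ι} {p : H} (h : ∀ i ∉ s, f i p = 0) :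
    lsum f p = ∑ i ∈ s, f i p :=
  finsum_eq_sum_of_support_subset _ fun i hi => by
    by_contra hs
    exact hi (h i hs)

theorem LF.smooth {f : ι → H → E} (hf : LF f) (hs : ∀ i, Smooth (f i)) : Smooth (lsum f) := by
  refine contDiff_iff_contDiffAt.2 fun p => ?_
  obtain ⟨s, h⟩ := hf p
  have h1 : ContDiffAt ℝ (⊤ : ℕ∞) (fun q => ∑ i ∈ s, f i q) p :=
    (Smooth.finset_sum s fun i _ => hs i).contDiffAt
  exact h1.congr_of_eventuallyEq (h.mono fun q hq => lsum_eq_sum hq)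

theorem LF.DD_lsum {f : ι → H → E} (hf : LF f) (hs : ∀ i, Smooth (f i)) (w : List Bool) :
    Heisenberg.DD w (lsum f) = lsum fun i => Heisenberg.DD w (f i) := by
  funext p
  obtain ⟨s, h⟩ := hf p
  have h1 : lsum f =ᶠ[nhds p] fun q => ∑ i ∈ s, f i q := h.mono fun q hq => lsum_eq_sum hq
  rw [(DD_congr_of_eventuallyEq h1 w).self_of_nhds, DD_sum s fun i _ => hs i]
  refine (lsum_eq_sum fun i hi => ?_).symm
  have h2 : f i =ᶠ[nhds p] fun _ => 0 := h.mono fun x hx => hx i hi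
  rw [(DD_congr_of_eventuallyEq h2 w).self_of_nhds, DD_zero]

theorem norm_lsum_le {f : ι → H → E} {p : H} {s : Finset ι} (h : ∀ i ∉ s, f i p = 0) {a : ι → ℝ}
    (ha : ∀ i ∈ s, ‖f i p‖ ≤ a i) : ‖lsum f p‖ ≤ ∑ i ∈ s, a i := by
  rw [lsum_eq_sum h]
  exact norm_sum_le_of_le s ha

theorem lsum_nat_eq_sum_range {f : ℕ → H → E} {n : ℕ} {p : H} (h : ∀ i, n ≤ i → f i p = 0) :
    lsum f p = ∑ i ∈ Finset.range n, f i p :=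
  lsum_eq_sum fun i hi => h i (by simpa using hi)

theorem LF.exists_nat {f : ℕ → H → E} (hf : LF f) (p : H) :
    ∃ n, ∀ᶠ q in nhds p, ∀ i, n ≤ i → f i q = 0 := by
  obtain ⟨s, h⟩ := hf p
  refine ⟨s.sup id + 1, h.mono fun q hq i hi => hq i fun his => ?_⟩
  have : i ≤ s.sup id := Finset.le_sup (f := id) his
  omega

end LocallyFiniteSums

section Lattice

/-- The integer lattice. -/
abbrev Lat : Type := ℤ × ℤ × ℤ

def lat (γ : Lat) : H := ((γ.1 : ℝ), (γ.2.1 : ℝ), (γ.2.2 : ℝ))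

def lmul (a b : Lat) : Lat := (b.1 + a.1, b.2.1 + a.2.1, b.2.2 + a.2.2 + a.1 * b.2.1)

def linv (a : Lat) : Lat := (-a.1, -a.2.1, -a.2.2 + a.1 * a.2.1)

/-- Right translation by the inverse of a lattice element. -/
def tr (γ : Lat) (p : H) : H := mul p (inv (lat γ))

theorem tr_eq (γ : Lat) (p : H) :
    tr γ p = (p.1 - γ.1, p.2.1 - γ.2.1, p.2.2 - γ.2.2 - (p.1 - γ.1) * γ.2.1) := by
  simp only [tr, mul, inv, lat]
  ext <;> simp <;> ring

theorem smooth_tr (γ : Lat) : Smooth (tr γ) := smooth_mul_right _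

theorem mul_tr (γ : Lat) (p : H) : mul (tr γ p) (lat γ) = p := mul_inv_cancel_right' _ _

theorem tr_lmul_mul (γ δ : Lat) (p : H) : tr (lmul γ δ) (mul p (lat δ)) = tr γ p := by
  simp only [tr_eq, lmul, mul, lat]
  ext <;> simp <;> ring

theorem tr_tr (γ δ : Lat) (p : H) : tr (lmul γ δ) p = tr γ (tr δ p) := by
  rw [← tr_lmul_mul γ δ (tr δ p), mul_tr]

def lmulRightEquiv (δ : Lat) : Lat ≃ Lat where
  toFun γ := lmul γ δ
  invFun γ := lmul γ (linv δ)
  left_inv γ := by simp only [lmul, linv]; ext <;> simp; ring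
  right_inv γ := by simp only [lmul, linv]; ext <;> simp; ring

theorem finite_lat_of_isCompact {K L : Set H} (hK : IsCompact K) (hL : IsCompact L) :
    {γ : Lat | ∃ p ∈ K, tr γ p ∈ L}.Finite := by
  have hc : Continuous fun q : H × H => mul (inv q.2) q.1 := by
    unfold mul inv; fun_prop
  obtain ⟨R, hR⟩ := ((hK.prod hL).image hc).isBounded.subset_closedBall (0 : H)
  obtain ⟨N, hN⟩ := exists_nat_ge R
  have hfin : (Set.Icc (-N : ℤ) N ×ˢ (Set.Icc (-N : ℤ) N ×ˢ Set.Icc (-N : ℤ) N)).Finite :=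
    (Set.finite_Icc _ _).prod ((Set.finite_Icc _ _).prod (Set.finite_Icc _ _))
  refine hfin.subset fun γ ⟨p, hp, hq⟩ => ?_
  have h1 : lat γ = mul (inv (tr γ p)) p := by
    rw [tr]
    simp only [mul, inv, lat]
    ext <;> simp; ring
  have h2 : ‖lat γ‖ ≤ N := by
    have := hR ⟨(p, tr γ p), ⟨hp, hq⟩, rfl⟩
    rw [mem_closedBall_zero_iff] at this
    rw [h1]
    exact this.trans hN
  simp only [Prod.norm_def, lat, Real.norm_eq_abs, sup_le_iff, abs_le] at h2
  obtain ⟨⟨a, b⟩, ⟨c, d⟩, e, f⟩ := h2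
  refine ⟨⟨?_, ?_⟩, ⟨?_, ?_⟩, ?_, ?_⟩
  · exact_mod_cast a
  · exact_mod_cast b
  · exact_mod_cast c
  · exact_mod_cast d
  · exact_mod_cast e
  · exact_mod_cast f

/-- The closed unit cube. -/
def Cube : Set H := Set.Icc 0 1 ×ˢ (Set.Icc 0 1 ×ˢ Set.Icc 0 1)

theorem isCompact_Cube : IsCompact Cube := isCompact_Icc.prod (isCompact_Icc.prod isCompact_Icc)

theorem exists_tr_mem_Cube (p : H) : ∃ γ : Lat, tr γ p ∈ Cube := by
  refine ⟨(⌊p.1⌋, ⌊p.2.1⌋, ⌊p.2.2 - (p.1 - ⌊p.1⌋) * ⌊p.2.1⌋⌋), ?_⟩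
  rw [tr_eq]
  have h : p.2.2 - ((⌊p.2.2 - (p.1 - ⌊p.1⌋) * ⌊p.2.1⌋⌋ : ℤ) : ℝ) - (p.1 - ⌊p.1⌋) * ⌊p.2.1⌋
      = Int.fract (p.2.2 - (p.1 - ⌊p.1⌋) * ⌊p.2.1⌋) := by
    rw [← Int.self_sub_floor]; ring
  refine ⟨⟨?_, ?_⟩, ⟨?_, ?_⟩, ?_, ?_⟩ <;> dsimp only
  · exact Int.fract_nonneg p.1
  · exact (Int.fract_lt_one p.1).le
  · exact Int.fract_nonneg p.2.1
  · exact (Int.fract_lt_one p.2.1).le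
  · rw [h]; exact Int.fract_nonneg _
  · rw [h]; exact (Int.fract_lt_one _).le

/-- Uniform bound for the overlap of the translates of a compact set. -/
theorem exists_overlap {L : Set H} (hL : IsCompact L) : ∃ N : ℕ, ∀ p : H,
    ∃ s : Finset Lat, s.card ≤ N ∧ ∀ γ, γ ∈ s ↔ tr γ p ∈ L := by
  have hfin := finite_lat_of_isCompact isCompact_Cube hL
  refine ⟨hfin.toFinset.card, fun p => ?_⟩
  obtain ⟨δ, hδ⟩ := exists_tr_mem_Cube p
  have h1 : {γ | tr γ p ∈ L} ⊆ (fun γ => lmul γ δ) '' {γ : Lat | ∃ p ∈ Cube, tr γ p ∈ L} := by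
    intro γ hγ
    obtain ⟨γ', rfl⟩ := (lmulRightEquiv δ).surjective γ
    refine ⟨γ', ⟨tr δ p, hδ, ?_⟩, rfl⟩
    rw [← tr_tr]; exact hγ
  have h2 : {γ | tr γ p ∈ L}.Finite := (hfin.image _).subset h1
  refine ⟨h2.toFinset, ?_, by simp⟩
  classical
  have h3 : h2.toFinset ⊆ hfin.toFinset.image (fun γ => lmul γ δ) := by
    intro γ hγ
    rw [Set.Finite.mem_toFinset] at hγ
    obtain ⟨γ', h, rfl⟩ := h1 hγ
    exact Finset.mem_image_of_mem _ (hfin.mem_toFinset.2 h)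
  exact (Finset.card_le_card h3).trans Finset.card_image_le

variable {E : Type*} [NormedAddCommGroup E] [NormedSpace ℝ E]

theorem LF_of_tsupport {f : Lat → H → E} {L : Set H} (hL : IsCompact L)
    (h : ∀ γ p, tr γ p ∉ L → f γ p = 0) : LF f := by
  intro p
  have hfin := finite_lat_of_isCompact (isCompact_closedBall p 1) hL
  refine ⟨hfin.toFinset, Filter.eventually_of_mem (Metric.closedBall_mem_nhds p one_pos)
    fun q hq γ hγ => h γ q fun hq' => hγ ?_⟩
  rw [Set.Finite.mem_toFinset]
  exact ⟨q, hq, hq'⟩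

theorem exists_norm_DD_lsum_tr_le {F : Type*} [NormedAddCommGroup F] [NormedSpace ℝ F]
    {h : H → F} (hh : Bump h) (n : ℕ) : ∃ C : ℝ, 0 ≤ C ∧
    ∀ {c : Lat → F →L[ℝ] E}, (∀ γ, ‖c γ‖ ≤ 1) → ∀ w : List Bool, w.length ≤ n → ∀ p,
      ‖DD w (lsum fun γ p => c γ (h (tr γ p))) p‖ ≤ C := by
  obtain ⟨N, hN⟩ := exists_overlap hh.supp.isCompact
  obtain ⟨C, hC, hb⟩ := exists_uniform_words n (Q := fun w C => ∀ p, ‖DD w h p‖ ≤ C) (by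
    intro w
    have h1 : HasCompactSupport (DD w h) := by
      induction w with
      | nil => exact hh.supp
      | cons b w ih => exact (Bump.WD ⟨hh.smooth.DD w, ih⟩ b).supp
    obtain ⟨C, hC⟩ := h1.exists_bound_of_continuous (hh.smooth.DD w).continuous
    exact ⟨C, (norm_nonneg _).trans (hC 0), hC⟩) (fun w C C' hCC h p => (h p).trans hCC)
  refine ⟨N * C, by positivity, fun {c} hc w hw p => ?_⟩
  have hlf : LF fun γ p => c γ (h (tr γ p)) := LF_of_tsupport hh.supp.isCompact fun γ p hp => by
    rw [image_eq_zero_of_notMem_tsupport hp, map_zero]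
  have hs : ∀ γ, Smooth fun p => c γ (h (tr γ p)) := fun γ =>
    (c γ).contDiff.comp (hh.smooth.comp (smooth_tr γ))
  have hD : ∀ γ, DD w (fun p => c γ (h (tr γ p))) = fun p => c γ (DD w h (tr γ p)) := fun γ => by
    rw [DD_clm (c γ) (hh.smooth.comp (smooth_tr γ))]
    simp only [tr, DD_mul_right hh.smooth]
  rw [hlf.DD_lsum hs]
  obtain ⟨s, hcard, hs'⟩ := hN p
  have htriv : ∀ γ ∉ s, DD w (fun p => c γ (h (tr γ p))) p = 0 := fun γ hγ => by
    rw [hs'] at hγ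
    have : tsupport (DD w h) ⊆ tsupport h := by
      clear hb hD
      induction w with
      | nil => exact subset_rfl
      | cons b w ih =>
        refine (closure_minimal ?_ (isClosed_tsupport _)).trans (ih (by simp at hw; omega))
        intro x hx
        by_contra hx'
        apply hx
        rw [DD_cons, WD_apply, fderiv_of_notMem_tsupport ℝ hx']
        rfl
    rw [hD]
    change c γ (DD w h (tr γ p)) = 0
    rw [image_eq_zero_of_notMem_tsupport fun h' => hγ (this h'), map_zero]
  refine (norm_lsum_le htriv (a := fun _ => C) fun γ _ => ?_).trans ?_
  · rw [hD]
    refine ((c γ).le_opNorm _).trans ?_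
    calc ‖c γ‖ * _ ≤ 1 * C := mul_le_mul (hc γ) (hb w hw _) (norm_nonneg _) zero_le_one
      _ = C := one_mul C
  · rw [Finset.sum_const, nsmul_eq_mul]
    gcongr

/-! ### A partition of unity -/

/-- The one-dimensional profile of the partition of unity. -/
def prof (t : ℝ) : ℝ := Real.smoothTransition (t + 1) - Real.smoothTransition t

theorem smooth_prof : Smooth prof :=
  (Real.smoothTransition.contDiff.comp (contDiff_id.add contDiff_const)).sub
    Real.smoothTransition.contDiff

theorem prof_eq_zero {t : ℝ} (h : 1 ≤ |t|) : prof t = 0 := by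
  rcases le_abs.1 h with h | h
  · rw [prof, Real.smoothTransition.one_of_one_le (by linarith),
      Real.smoothTransition.one_of_one_le h, sub_self]
  · rw [prof, Real.smoothTransition.zero_of_nonpos (by linarith),
      Real.smoothTransition.zero_of_nonpos (by linarith), sub_self]

theorem sum_prof (t : ℝ) {n : ℕ} (hn : |t| ≤ n) :
    ∑ a ∈ Finset.Icc (-n : ℤ) n, prof (t - a) = 1 := by
  have key : ∀ m : ℕ, ∑ a ∈ Finset.Icc (-m : ℤ) m, prof (t - a)
      = Real.smoothTransition (t + m + 1) - Real.smoothTransition (t - m) := by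
    intro m
    induction m with
    | zero => simp [prof]
    | succ m ih =>
      have h1 : Finset.Icc (-((m + 1 : ℕ) : ℤ)) ((m + 1 : ℕ) : ℤ)
          = insert (-((m : ℤ) + 1)) (insert ((m : ℤ) + 1) (Finset.Icc (-m : ℤ) m)) := by
        ext a; simp only [Finset.mem_Icc, Finset.mem_insert]; push_cast; omega
      rw [h1, Finset.sum_insert, Finset.sum_insert, ih]
      · simp only [prof]
        push_cast
        ring_nf
      · simp
      · simp only [Finset.mem_insert, Finset.mem_Icc]; omega
  rw [abs_le] at hn
  rw [key, Real.smoothTransition.one_of_one_le (by linarith),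
    Real.smoothTransition.zero_of_nonpos (by linarith), sub_zero]

/-- A bump function whose lattice translates sum to one. -/
def pou (p : H) : ℝ := prof p.1 * (prof p.2.1 * prof p.2.2)

theorem pou_eq_zero {p : H} (h : p ∉ Metric.closedBall (0 : H) 1) : pou p = 0 := by
  rw [mem_closedBall_zero_iff, Prod.norm_def, Prod.norm_def, sup_le_iff, sup_le_iff] at h
  simp only [Real.norm_eq_abs] at h
  rw [pou]
  by_cases h1 : 1 ≤ |p.1|
  · rw [prof_eq_zero h1, zero_mul]
  by_cases h2 : 1 ≤ |p.2.1|
  · rw [prof_eq_zero h2, zero_mul, mul_zero]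
  by_cases h3 : 1 ≤ |p.2.2|
  · rw [prof_eq_zero h3, mul_zero, mul_zero]
  exact absurd ⟨by linarith, by linarith, by linarith⟩ h

theorem bump_pou : Bump pou := by
  refine ⟨?_, HasCompactSupport.intro (isCompact_closedBall (0 : H) 1) fun p hp => pou_eq_zero hp⟩
  unfold pou
  exact (smooth_prof.comp contDiff_fst).mul ((smooth_prof.comp contDiff_snd.fst).mul
    (smooth_prof.comp contDiff_snd.snd))

theorem lsum_pou (p : H) : lsum (fun γ p => pou (tr γ p)) p = 1 := by
  obtain ⟨n, hn⟩ := exists_nat_ge (|p.1| + |p.2.1| + 1)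
  obtain ⟨m, hm⟩ := exists_nat_ge (|p.2.2| + (|p.1| + n) * n + 1)
  have hx := abs_nonneg p.1
  have hy := abs_nonneg p.2.1
  have hz := abs_nonneg p.2.2
  have habs : ∀ a ∈ Finset.Icc (-n : ℤ) n, |(a : ℝ)| ≤ n := fun a ha => by
    rw [Finset.mem_Icc] at ha
    rw [abs_le]; exact_mod_cast ha
  have hzb : ∀ a ∈ Finset.Icc (-n : ℤ) n, ∀ b ∈ Finset.Icc (-n : ℤ) n,
      |p.2.2 - (p.1 - a) * b| + 1 ≤ m := fun a ha b hb => by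
    have h1 : |p.2.2 - (p.1 - a) * b| ≤ |p.2.2| + (|p.1| + n) * n := by
      refine (abs_sub _ _).trans ?_
      rw [abs_mul]
      gcongr
      · exact (abs_sub _ _).trans (by gcongr; exact habs a ha)
      · exact habs b hb
    linarith
  rw [lsum_eq_sum (s := Finset.Icc (-n : ℤ) n ×ˢ (Finset.Icc (-n : ℤ) n ×ˢ Finset.Icc (-m : ℤ) m))]
  · rw [Finset.sum_product]
    simp_rw [Finset.sum_product, tr_eq, pou, ← Finset.mul_sum]
    have h1 : ∀ a ∈ Finset.Icc (-n : ℤ) n, prof (p.1 - a) * (∑ b ∈ Finset.Icc (-n : ℤ) n,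
        prof (p.2.1 - b) * ∑ c ∈ Finset.Icc (-m : ℤ) m, prof (p.2.2 - c - (p.1 - a) * b))
        = prof (p.1 - a) := fun a ha => by
      have h2 : ∀ b ∈ Finset.Icc (-n : ℤ) n, prof (p.2.1 - b) * ∑ c ∈ Finset.Icc (-m : ℤ) m,
          prof (p.2.2 - c - (p.1 - a) * b) = prof (p.2.1 - b) := fun b hb => by
        have h3 := sum_prof (p.2.2 - (p.1 - a) * b) (n := m) (by linarith [hzb a ha b hb])
        simp_rw [sub_right_comm _ ((p.1 - (a : ℝ)) * b)] at h3
        rw [h3, mul_one]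
      rw [Finset.sum_congr rfl h2, sum_prof _ (by linarith), mul_one]
    rw [Finset.sum_congr rfl h1, sum_prof _ (by linarith)]
  · rintro ⟨a, b, c⟩ hγ
    rw [tr_eq, pou]
    dsimp only
    have hInt : ∀ (k : ℕ) (d : ℤ), d ∉ Finset.Icc (-k : ℤ) k → (k : ℝ) ≤ |(d : ℝ)| := by
      intro k d hd
      rw [Finset.mem_Icc, ← abs_le] at hd
      have : (k : ℤ) ≤ |d| := (not_le.1 hd).le
      exact_mod_cast this
    by_cases ha : a ∈ Finset.Icc (-n : ℤ) n
    · by_cases hb : b ∈ Finset.Icc (-n : ℤ) n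
      · have hc : c ∉ Finset.Icc (-m : ℤ) m := fun hc => hγ
          (Finset.mem_product.2 ⟨ha, Finset.mem_product.2 ⟨hb, hc⟩⟩)
        rw [prof_eq_zero (t := p.2.2 - c - (p.1 - a) * b), mul_zero, mul_zero]
        have h1 := hInt m c hc
        have h2 := hzb a ha b hb
        have h3 : |(c : ℝ)| ≤ |p.2.2 - (p.1 - a) * b| + |p.2.2 - c - (p.1 - a) * b| := by
          have := abs_sub (p.2.2 - (p.1 - a) * b) (p.2.2 - c - (p.1 - a) * b)
          rwa [show p.2.2 - (p.1 - a) * b - (p.2.2 - c - (p.1 - a) * b) = (c : ℝ) by ring] at this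
        linarith
      · rw [prof_eq_zero (t := p.2.1 - b), zero_mul, mul_zero]
        have h1 := hInt n b hb
        have h3 := abs_sub_abs_le_abs_sub (b : ℝ) p.2.1
        rw [abs_sub_comm] at h3
        linarith
    · rw [prof_eq_zero (t := p.1 - a), zero_mul]
      have h1 := hInt n a ha
      have h3 := abs_sub_abs_le_abs_sub (a : ℝ) p.1
      rw [abs_sub_comm] at h3
      linarith

end Lattice

section LittlewoodPaley

variable {E : Type*} [NormedAddCommGroup E] [NormedSpace ℝ E]

/-- The dyadic scale `2^{-m}`. -/
abbrev rr (m : ℕ) : ℝ := (1 / 2) ^ m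

theorem rr_pos (m : ℕ) : 0 < rr m := by positivity

theorem rr_le_one (m : ℕ) : rr m ≤ 1 := pow_le_one₀ (by norm_num) (by norm_num)

theorem exists_holder_sum {α : ℝ} (h0 : 0 < α) (h1 : α < 1) : ∃ C : ℝ, 0 ≤ C ∧
    ∀ {k : ℕ} {s : ℝ}, 0 ≤ s → ∀ {g : ℕ → H → E}, (∀ m, Smooth (g m)) →
      (∀ m (w : List Bool), w.length ≤ k + 1 → ∀ p,
        ‖DD w (g m) p‖ ≤ s * ((rr m)⁻¹ ^ w.length * rr m ^ k * rr m ^ α)) →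
      ∀ n : ℕ, (∀ w : List Bool, w.length ≤ k → ∀ p,
          ∑ m ∈ Finset.range n, ‖DD w (g m) p‖ ≤ C * s) ∧
        (∀ w : List Bool, w.length = k → ∀ p q,
          ∑ m ∈ Finset.range n, ‖DD w (g m) p - DD w (g m) q‖ ≤ C * s * ccDist p q ^ α) := by
  set β : ℝ := (1 / 2 : ℝ) ^ α with hβ
  have hβ0 : 0 < β := by positivity
  have hβ1 : β < 1 := Real.rpow_lt_one (by norm_num) (by norm_num) h0
  have hβ2 : 1 < 2 * β := by
    have : (1 / 2 : ℝ) < β := by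
      conv_lhs => rw [← Real.rpow_one (1 / 2 : ℝ)]
      exact Real.rpow_lt_rpow_of_exponent_gt (by norm_num) (by norm_num) h1
    linarith
  have hpow : ∀ m : ℕ, rr m ^ α = β ^ m := fun m => by
    rw [hβ, rr, ← Real.rpow_natCast, ← Real.rpow_natCast, ← Real.rpow_mul (by norm_num),
      ← Real.rpow_mul (by norm_num), mul_comm]
  have hgeom : ∀ n m : ℕ, ∑ i ∈ Finset.Ico n m, β ^ i ≤ β ^ n * (1 - β)⁻¹ := fun n m => by
    rcases le_total n m with h | h
    · rw [geom_sum_Ico hβ1.ne h, ← neg_div_neg_eq, div_eq_mul_inv]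
      have := pow_pos hβ0 m
      rw [neg_sub, neg_sub]
      exact mul_le_mul_of_nonneg_right (by linarith) (inv_nonneg.2 (by linarith))
    · rw [Finset.Ico_eq_empty_of_le h, Finset.sum_empty]
      have : 0 < 1 - β := by linarith
      positivity
  have hb0 : 0 < (1 - β)⁻¹ := inv_pos.2 (by linarith)
  have hb1 : 0 < (2 * β - 1)⁻¹ := inv_pos.2 (by linarith)
  refine ⟨2 * (1 - β)⁻¹ + 2 * (2 * β - 1)⁻¹, by positivity,
    fun {k s} hs {g} hg hb n => ?_⟩
  have hb' : ∀ m (w : List Bool), w.length ≤ k → ∀ p, ‖DD w (g m) p‖ ≤ s * β ^ m := by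
    intro m w hw p
    refine (hb m w (by omega) p).trans ?_
    rw [hpow]
    have : (rr m)⁻¹ ^ w.length * rr m ^ k ≤ 1 := by
      rw [inv_pow, inv_mul_le_one₀ (by positivity)]
      exact pow_le_pow_of_le_one (by positivity) (rr_le_one m) hw
    calc s * ((rr m)⁻¹ ^ w.length * rr m ^ k * β ^ m) ≤ s * (1 * β ^ m) := by gcongr
      _ = _ := by ring
  constructor
  · intro w hw p
    calc ∑ m ∈ Finset.range n, ‖DD w (g m) p‖ ≤ ∑ m ∈ Finset.range n, s * β ^ m :=
          Finset.sum_le_sum fun m _ => hb' m w hw p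
      _ = s * ∑ m ∈ Finset.Ico 0 n, β ^ m := by rw [Finset.mul_sum, Finset.range_eq_Ico]
      _ ≤ s * (β ^ 0 * (1 - β)⁻¹) := by gcongr; exact hgeom 0 n
      _ ≤ _ := by rw [pow_zero]; nlinarith [mul_nonneg hb0.le hs, mul_nonneg hb1.le hs]
  · intro w hw p q
    have hd := ccDist_nonneg p q
    set d := ccDist p q
    have hlip : ∀ m, ‖DD w (g m) p - DD w (g m) q‖ ≤ s * (2 * β) ^ m * d := by
      intro m
      refine norm_sub_le_ccDist ((hg m).DD w) (fun b x => ?_) p q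
      have := hb m (b :: w) (by simp [hw]) x
      rw [DD_cons, hpow, List.length_cons, hw, pow_succ] at this
      refine this.trans (le_of_eq ?_)
      rw [mul_pow, show (rr m)⁻¹ = 2 ^ m by simp [rr]]
      have : ((2 : ℝ) ^ m) ^ k * rr m ^ k = 1 := by
        rw [← mul_pow, rr, ← mul_pow]; norm_num
      linear_combination s * 2 ^ m * β ^ m * this
    have htriv : ∀ m, ‖DD w (g m) p - DD w (g m) q‖ ≤ 2 * s * β ^ m := fun m =>
      (norm_sub_le _ _).trans (by linarith [hb' m w hw.le p, hb' m w hw.le q])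
    rcases hd.eq_or_lt with h | hd0
    · rw [Finset.sum_eq_zero]
      · rw [← h, Real.zero_rpow h0.ne', mul_zero]
      · intro m _
        have := hlip m
        rw [← h, mul_zero] at this
        exact le_antisymm this (norm_nonneg _)
    · have hex : ∃ N : ℕ, 1 ≤ 2 ^ N * d := by
        obtain ⟨N, hN⟩ := pow_unbounded_of_one_lt d⁻¹ (one_lt_two (α := ℝ))
        refine ⟨N, ?_⟩
        have := mul_le_mul_of_nonneg_right hN.le hd
        rwa [inv_mul_cancel₀ hd0.ne'] at this
      classical
      set N := Nat.find hex with hN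
      have hN1 : 1 ≤ 2 ^ N * d := Nat.find_spec hex
      have hβN : β ^ N ≤ d ^ α := by
        rw [← hpow]
        refine Real.rpow_le_rpow (by positivity) ?_ h0.le
        rw [rr, one_div, inv_pow, inv_le_iff_one_le_mul₀ (by positivity), mul_comm]
        exact hN1
      have hNd : (2 * β) ^ N * d ≤ 2 * β ^ N ∨ N = 0 := by
        rcases Nat.eq_zero_or_pos N with h | h
        · exact Or.inr h
        · left
          have h2 := Nat.find_min hex (m := N - 1) (by omega)
          rw [not_le] at h2
          have h3 : (2 : ℝ) ^ N = 2 * 2 ^ (N - 1) := by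
            rw [← pow_succ']; congr 1; omega
          rw [mul_pow, h3]
          nlinarith [pow_pos hβ0 N]
      calc ∑ m ∈ Finset.range n, ‖DD w (g m) p - DD w (g m) q‖
          ≤ ∑ m ∈ Finset.range (max n N), ‖DD w (g m) p - DD w (g m) q‖ :=
            Finset.sum_le_sum_of_subset_of_nonneg
              (Finset.range_subset_range.2 (le_max_left _ _)) fun _ _ _ => norm_nonneg _
        _ = ∑ m ∈ Finset.range N, ‖DD w (g m) p - DD w (g m) q‖
            + ∑ m ∈ Finset.Ico N (max n N), ‖DD w (g m) p - DD w (g m) q‖ :=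
            (Finset.sum_range_add_sum_Ico _ (le_max_right _ _)).symm
        _ ≤ 2 * (2 * β - 1)⁻¹ * s * d ^ α + 2 * (1 - β)⁻¹ * s * d ^ α := by
            gcongr
            · rcases hNd with h | h
              · have h' : (2 * β) ^ N * d ≤ 2 * d ^ α :=
                  h.trans (mul_le_mul_of_nonneg_left hβN (by norm_num))
                calc _ ≤ ∑ m ∈ Finset.range N, s * (2 * β) ^ m * d :=
                      Finset.sum_le_sum fun m _ => hlip m
                  _ = s * d * ∑ m ∈ Finset.range N, (2 * β) ^ m := by
                      rw [Finset.mul_sum]; exact Finset.sum_congr rfl fun _ _ => by ring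
                  _ ≤ s * d * ((2 * β) ^ N * (2 * β - 1)⁻¹) := by
                      rw [geom_sum_eq hβ2.ne', div_eq_mul_inv]
                      gcongr
                      linarith
                  _ = s * (2 * β - 1)⁻¹ * ((2 * β) ^ N * d) := by ring
                  _ ≤ s * (2 * β - 1)⁻¹ * (2 * d ^ α) := by
                      gcongr
                  _ = _ := by ring
              · rw [h]; simp; positivity
            · calc _ ≤ ∑ m ∈ Finset.Ico N (max n N), 2 * s * β ^ m :=
                      Finset.sum_le_sum fun m _ => htriv m
                _ = 2 * s * ∑ m ∈ Finset.Ico N (max n N), β ^ m := by rw [Finset.mul_sum]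
                _ ≤ 2 * s * (β ^ N * (1 - β)⁻¹) := by gcongr; exact hgeom _ _
                _ ≤ 2 * s * (d ^ α * (1 - β)⁻¹) := by gcongr
                _ = _ := by ring
        _ = _ := by ring

end LittlewoodPaley

section LinearAlgebra

abbrev Vec : Type := EuclideanSpace ℝ (Fin 29)

abbrev K4 : Type := EuclideanSpace ℝ (Fin 4)

/-- The inner product as a continuous bilinear map. -/
def dotL : Vec →L[ℝ] Vec →L[ℝ] ℝ :=
  LinearMap.mkContinuous₂ (innerₗ Vec) 1 fun x y => by
    simpa using norm_inner_le_norm (𝕜 := ℝ) x y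

@[simp] theorem dotL_apply (x y : Vec) : dotL x y = ⟪x, y⟫ := rfl

theorem norm_dotL_le : ‖dotL‖ ≤ 1 := LinearMap.mkContinuous₂_norm_le _ zero_le_one _

/-- The synthesis operator of a family of four vectors. -/
def syn : (Fin 4 → Vec) →L[ℝ] (K4 →L[ℝ] Vec) :=
  ∑ i, (ContinuousLinearMap.smulRightL ℝ K4 Vec (EuclideanSpace.proj i)).comp
    (ContinuousLinearMap.proj i)

/-- The analysis operator of a family of four vectors. -/
def ana : (Fin 4 → Vec) →L[ℝ] (Vec →L[ℝ] K4) :=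
  ∑ i, (((ContinuousLinearMap.smulRightL ℝ Vec K4).flip (EuclideanSpace.single i 1)).comp
    dotL).comp (ContinuousLinearMap.proj i)

theorem syn_apply (v : Fin 4 → Vec) (l : K4) : syn v l = ∑ i, l i • v i := by
  simp [syn]

theorem ana_apply (v : Fin 4 → Vec) (e : Vec) (i : Fin 4) : ana v e i = ⟪v i, e⟫ := by
  simp [ana, Pi.single_apply]

theorem inner_syn (v : Fin 4 → Vec) (l : K4) (e : Vec) : ⟪syn v l, e⟫ = ⟪l, ana v e⟫ := by
  rw [syn_apply, sum_inner, PiLp.inner_apply]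
  refine Finset.sum_congr rfl fun i _ => ?_
  rw [inner_smul_left, ana_apply]
  simp [mul_comm]

/-- Coercivity of the synthesis operator. -/
def Coer (c : ℝ) (v : Fin 4 → Vec) : Prop := ∀ l : K4, c * ‖l‖ ≤ ‖syn v l‖

def gram (v : Fin 4 → Vec) : K4 →L[ℝ] K4 := (ana v).comp (syn v)

/-- The canonical right inverse of the analysis operator. -/
def rinv (v : Fin 4 → Vec) : K4 →L[ℝ] Vec := (syn v).comp (Ring.inverse (gram v))

/-- The orthogonal projection to the orthogonal complement of a family of vectors. -/
def prj (v : Fin 4 → Vec) : Vec →L[ℝ] Vec := ContinuousLinearMap.id ℝ Vec - (rinv v).comp (ana v)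

theorem Coer.gram_le {c : ℝ} (hc : 0 < c) {v : Fin 4 → Vec} (h : Coer c v) (l : K4) :
    c ^ 2 * ‖l‖ ≤ ‖gram v l‖ := by
  have h1 : ⟪l, gram v l⟫ = ‖syn v l‖ ^ 2 := by
    rw [gram, ContinuousLinearMap.comp_apply, ← inner_syn, real_inner_self_eq_norm_sq]
  have h2 := real_inner_le_norm l (gram v l)
  have h3 := h l
  rcases (norm_nonneg l).eq_or_lt with h0 | h0
  · rw [← h0, mul_zero]; positivity
  · have h4 : (c * ‖l‖) ^ 2 ≤ ‖syn v l‖ ^ 2 := by gcongr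
    nlinarith

theorem Coer.isUnit_gram {c : ℝ} (hc : 0 < c) {v : Fin 4 → Vec} (h : Coer c v) :
    IsUnit (gram v) := by
  have hinj : Function.Injective (gram v) := by
    rw [injective_iff_map_eq_zero]
    intro l hl
    have := h.gram_le hc l
    rw [hl, norm_zero] at this
    have h0 : ‖l‖ ≤ 0 := by
      by_contra h'
      have : 0 < c ^ 2 * ‖l‖ := mul_pos (by positivity) (not_le.1 h')
      linarith
    simpa using h0
  rw [ContinuousLinearMap.isUnit_iff_bijective]
  exact ⟨hinj, (LinearMap.injective_iff_surjective (f := (gram v).toLinearMap)).1 hinj⟩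

theorem Coer.gram_inverse {c : ℝ} (hc : 0 < c) {v : Fin 4 → Vec} (h : Coer c v) (l : K4) :
    gram v (Ring.inverse (gram v) l) = l := by
  have := Ring.mul_inverse_cancel _ (h.isUnit_gram hc)
  exact congrArg (fun T : K4 →L[ℝ] K4 => T l) this

theorem Coer.norm_inverse_gram_le {c : ℝ} (hc : 0 < c) {v : Fin 4 → Vec} (h : Coer c v) :
    ‖Ring.inverse (gram v)‖ ≤ (c ^ 2)⁻¹ := by
  refine ContinuousLinearMap.opNorm_le_bound _ (by positivity) fun l => ?_
  have := h.gram_le hc (Ring.inverse (gram v) l)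
  rw [h.gram_inverse hc] at this
  rwa [← div_eq_inv_mul, le_div_iff₀' (by positivity)]

theorem Coer.ana_rinv {c : ℝ} (hc : 0 < c) {v : Fin 4 → Vec} (h : Coer c v) (l : K4) :
    ana v (rinv v l) = l := h.gram_inverse hc l

theorem Coer.inner_rinv {c : ℝ} (hc : 0 < c) {v : Fin 4 → Vec} (h : Coer c v) (l : K4)
    (i : Fin 4) : ⟪v i, rinv v l⟫ = l i := by
  rw [← ana_apply, h.ana_rinv hc]

theorem prj_apply (v : Fin 4 → Vec) (e : Vec) : prj v e = e - rinv v (ana v e) := rfl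

theorem Coer.inner_prj {c : ℝ} (hc : 0 < c) {v : Fin 4 → Vec} (h : Coer c v) (e : Vec)
    (i : Fin 4) : ⟪v i, prj v e⟫ = 0 := by
  rw [prj_apply, inner_sub_right, h.inner_rinv hc, ana_apply, sub_self]

theorem prj_eq_sub_sum (v : Fin 4 → Vec) (e : Vec) :
    ∃ l : K4, prj v e = e - ∑ i, l i • v i :=
  ⟨Ring.inverse (gram v) (ana v e), by rw [← syn_apply]; rfl⟩

theorem Coer.norm_prj_le {c : ℝ} (hc : 0 < c) {v : Fin 4 → Vec} (h : Coer c v) :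
    ‖prj v‖ ≤ 1 := by
  refine ContinuousLinearMap.opNorm_le_bound _ zero_le_one fun e => ?_
  rw [one_mul]
  obtain ⟨l, hl⟩ := prj_eq_sub_sum v e
  have h1 : ⟪e - prj v e, prj v e⟫ = 0 := by
    rw [show e - prj v e = ∑ i, l i • v i by rw [hl]; abel, sum_inner]
    refine Finset.sum_eq_zero fun i _ => ?_
    rw [inner_smul_left, h.inner_prj hc, mul_zero]
  rw [inner_sub_left, real_inner_self_eq_norm_sq, sub_eq_zero] at h1
  have h2 := real_inner_le_norm e (prj v e)
  rw [h1] at h2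
  rcases (norm_nonneg (prj v e)).eq_or_lt with h0 | h0
  · rw [← h0]; positivity
  · nlinarith

theorem norm_le_pi_norm_mul_syn (v : Fin 4 → Vec) (l : K4) : ‖syn v l‖ ≤ ‖syn‖ * ‖v‖ * ‖l‖ :=
  syn.le_opNorm₂ v l

theorem Coer.of_norm_sub_le {c : ℝ} {v v' : Fin 4 → Vec} (h : Coer c v)
    (h' : ‖syn‖ * ‖v' - v‖ ≤ c / 2) : Coer (c / 2) v' := by
  intro l
  have h1 : syn v' l = syn v l + syn (v' - v) l := by
    rw [map_sub, _root_.sub_apply]; abel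
  have h2 := norm_le_pi_norm_mul_syn (v' - v) l
  have h3 : ‖syn v l‖ ≤ ‖syn v' l‖ + ‖syn (v' - v) l‖ := by
    rw [h1]
    have := norm_sub_le (syn v l + syn (v' - v) l) (syn (v' - v) l)
    rwa [add_sub_cancel_right] at this
  have h4 := h l
  have h5 : ‖syn‖ * ‖v' - v‖ * ‖l‖ ≤ c / 2 * ‖l‖ := by gcongr
  linarith

theorem Smooth.syn {v : H → Fin 4 → Vec} (hv : Smooth v) : Smooth fun p => syn (v p) :=
  Heisenberg.syn.contDiff.comp hv

theorem Smooth.ana {v : H → Fin 4 → Vec} (hv : Smooth v) : Smooth fun p => ana (v p) :=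
  Heisenberg.ana.contDiff.comp hv

theorem Smooth.gram {v : H → Fin 4 → Vec} (hv : Smooth v) : Smooth fun p => gram (v p) :=
  hv.ana.clm_comp hv.syn

theorem Smooth.rinv {v : H → Fin 4 → Vec} (hv : Smooth v) {c : ℝ} (hc : 0 < c)
    (h : ∀ p, Coer c (v p)) : Smooth fun p => rinv (v p) :=
  hv.syn.clm_comp (hv.gram.ringInverse fun p => (h p).isUnit_gram hc)

theorem Smooth.prj {v : H → Fin 4 → Vec} (hv : Smooth v) {c : ℝ} (hc : 0 < c)
    (h : ∀ p, Coer c (v p)) : Smooth fun p => prj (v p) :=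
  contDiff_const.sub ((hv.rinv hc h).clm_comp hv.ana)

theorem SB.clm_comp {F G K : Type*} [NormedAddCommGroup F] [NormedSpace ℝ F]
    [NormedAddCommGroup G] [NormedSpace ℝ G] [NormedAddCommGroup K] [NormedSpace ℝ K]
    {S : H → F →L[ℝ] G} {T : H → K →L[ℝ] F} (hS : Smooth S) (hT : Smooth T) {p : H}
    {a b N : ℝ} {J : ℕ} (hN : 0 ≤ N) (h : SB S p a N J) (h' : SB T p b N J) :
    SB (fun p => (S p).comp (T p)) p (2 ^ J * a * b) N J := by
  refine (SB.bilin (ContinuousLinearMap.compL ℝ K F G) hS hT hN h h').mono ?_ hN le_rfl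
  have ha := h.nonneg
  have hb := h'.nonneg
  have := ContinuousLinearMap.norm_compL_le ℝ K F G
  gcongr
  nlinarith [pow_pos (two_pos : (0 : ℝ) < 2) J]

theorem exists_SB_rinv (J : ℕ) (a : ℝ) {c : ℝ} (hc : 0 < c) : ∃ K : ℝ, 0 ≤ K ∧
    ∀ {v : H → Fin 4 → Vec}, Smooth v → (∀ p, Coer c (v p)) → ∀ {p : H} {N : ℝ}, 0 ≤ N →
      SB v p a N J → SB (fun p => rinv (v p)) p K N J := by
  obtain ⟨K, hK, h⟩ := exists_SB_ringInverse J (2 ^ J * (‖ana‖ * a) * (‖syn‖ * a)) (c ^ 2)⁻¹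
  refine ⟨|2 ^ J * (‖syn‖ * a) * K|, abs_nonneg _, fun {v} hv hco {p N} hN hb => ?_⟩
  have h1 := SB.clm syn hv hb
  have h2 := SB.clm ana hv hb
  have h3 := SB.clm_comp hv.ana hv.syn hN h2 h1
  have h4 := h hv.gram (fun p => (hco p).isUnit_gram hc) hN h3 ((hco p).norm_inverse_gram_le hc)
  have h5 := SB.clm_comp hv.syn (hv.gram.ringInverse fun p => (hco p).isUnit_gram hc) hN h1 h4
  exact h5.mono (le_abs_self _) hN le_rfl

/-- Evaluation as a bilinear map. -/
theorem SB.apply {F G : Type*} [NormedAddCommGroup F] [NormedSpace ℝ F] [NormedAddCommGroup G]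
    [NormedSpace ℝ G] {T : H → F →L[ℝ] G} {f : H → F} (hT : Smooth T) (hf : Smooth f) {p : H}
    {a b N : ℝ} {J : ℕ} (hN : 0 ≤ N) (h : SB T p a N J) (h' : SB f p b N J) :
    SB (fun p => T p (f p)) p (2 ^ J * a * b) N J := by
  refine (SB.bilin (ContinuousLinearMap.id ℝ (F →L[ℝ] G)) hT hf hN h h').mono ?_ hN le_rfl
  have ha := h.nonneg
  have hb := h'.nonneg
  have : ‖ContinuousLinearMap.id ℝ (F →L[ℝ] G)‖ ≤ 1 := ContinuousLinearMap.norm_id_le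
  gcongr
  nlinarith [pow_pos (two_pos : (0 : ℝ) < 2) J]

theorem SB.inner {f g : H → Vec} (hf : Smooth f) (hg : Smooth g) {p : H}
    {a b N : ℝ} {J : ℕ} (hN : 0 ≤ N) (h : SB f p a N J) (h' : SB g p b N J) :
    SB (fun p => ⟪f p, g p⟫) p (2 ^ J * a * b) N J := by
  refine (SB.bilin dotL hf hg hN h h').mono ?_ hN le_rfl
  have ha := h.nonneg
  have hb := h'.nonneg
  have := norm_dotL_le
  gcongr
  nlinarith [pow_pos (two_pos : (0 : ℝ) < 2) J]

theorem Smooth.inner {f g : H → Vec} (hf : Smooth f) (hg : Smooth g) :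
    Smooth fun p => ⟪f p, g p⟫ := ContDiff.inner ℝ hf hg

theorem WD_inner {f g : H → Vec} (hf : Smooth f) (hg : Smooth g) (b : Bool) :
    WD b (fun p => ⟪f p, g p⟫) = fun p => ⟪WD b f p, g p⟫ + ⟪f p, WD b g p⟫ := by
  have := WD_bilin dotL hf hg b
  simpa using this

theorem DD_pi {E : Type*} [NormedAddCommGroup E] [NormedSpace ℝ E] {v : Fin 4 → H → E}
    (h : ∀ i, Smooth (v i)) (w : List Bool) (p : H) :
    DD w (fun p i => v i p) p = fun i => DD w (v i) p := by
  funext i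
  have := DD_clm (ContinuousLinearMap.proj (R := ℝ) (φ := fun _ : Fin 4 => E) i)
    (contDiff_pi.2 h) w
  exact (congrFun this p).symm

theorem SB.pi {E : Type*} [NormedAddCommGroup E] [NormedSpace ℝ E] {v : Fin 4 → H → E}
    (h : ∀ i, Smooth (v i)) {p : H} {a N : ℝ} {J : ℕ} (hb : ∀ i, SB (v i) p a N J) :
    SB (fun p i => v i p) p a N J := by
  intro w hw
  rw [DD_pi h]
  exact (pi_norm_le_iff_of_nonneg ((norm_nonneg _).trans (hb 0 w hw))).2 fun i => hb i w hw

/-- The identification of `Fin 4 → ℝ` with `K4`. -/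
def toK4 : (Fin 4 → ℝ) →L[ℝ] K4 := (EuclideanSpace.equiv (Fin 4) ℝ).symm.toContinuousLinearMap

@[simp] theorem toK4_apply (x : Fin 4 → ℝ) (i : Fin 4) : toK4 x i = x i := rfl

theorem continuous_wedgeNorm (n : ℕ) :
    Continuous fun u : Fin n → Vec => wedgeNorm u := by
  unfold wedgeNorm
  refine Real.continuous_sqrt.comp (Continuous.matrix_det ?_)
  refine continuous_matrix fun i j => ?_
  simp only [Matrix.of_apply]
  fun_prop

theorem sum_smul_ne_zero_of_wedgeNorm {n : ℕ} {u : Fin n → Vec} (h : 0 < wedgeNorm u)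
    {l : EuclideanSpace ℝ (Fin n)} (hl : l ≠ 0) : ∑ i, l i • u i ≠ 0 := by
  intro h0
  have hdet : Matrix.det (Matrix.of fun i j => ⟪u i, u j⟫) ≠ 0 := by
    intro h'
    rw [wedgeNorm, h', Real.sqrt_zero] at h
    exact lt_irrefl _ h
  have := Matrix.eq_zero_of_mulVec_eq_zero hdet (v := fun i => l i) (by
    funext i
    have h1 : ⟪u i, ∑ j, l j • u j⟫ = 0 := by rw [h0, inner_zero_right]
    rw [inner_sum] at h1
    rw [Pi.zero_apply, ← h1]
    simp only [Matrix.mulVec, dotProduct, Matrix.of_apply, inner_smul_right]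
    exact Finset.sum_congr rfl fun _ _ => mul_comm _ _)
  apply hl
  ext i
  exact congrFun this i

theorem exists_coercive_of_wedgeNorm (n : ℕ) (b : ℝ) {d : ℝ} (hd : 0 < d) : ∃ c : ℝ, 0 < c ∧
    ∀ u : Fin n → Vec, (∀ i, ‖u i‖ ≤ b) → d ≤ wedgeNorm u →
      ∀ l : EuclideanSpace ℝ (Fin n), c * ‖l‖ ≤ ‖∑ i, l i • u i‖ := by
  set S : Set ((Fin n → Vec) × EuclideanSpace ℝ (Fin n)) :=
    (Metric.closedBall 0 |b| ∩ {u | d ≤ wedgeNorm u}) ×ˢ Metric.sphere 0 1 with hS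
  have hcomp : IsCompact S := (((isCompact_closedBall _ _).inter_right
    (isClosed_le continuous_const (continuous_wedgeNorm n)))).prod (isCompact_sphere _ _)
  have hcont : Continuous fun x : (Fin n → Vec) × EuclideanSpace ℝ (Fin n) =>
      ‖∑ i, x.2 i • x.1 i‖ := by fun_prop
  have key : ∃ c : ℝ, 0 < c ∧ ∀ x ∈ S, c ≤ ‖∑ i, x.2 i • x.1 i‖ := by
    rcases S.eq_empty_or_nonempty with h | h
    · exact ⟨1, one_pos, by simp [h]⟩
    · obtain ⟨x, hx, hmin⟩ := hcomp.exists_isMinOn h hcont.continuousOn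
      refine ⟨_, norm_pos_iff.2 (sum_smul_ne_zero_of_wedgeNorm (hd.trans_le hx.1.2) ?_),
        fun y hy => hmin hy⟩
      have := hx.2
      rw [mem_sphere_zero_iff_norm] at this
      intro h0
      rw [h0, norm_zero] at this
      exact zero_ne_one this
  obtain ⟨c, hc, h⟩ := key
  refine ⟨c, hc, fun u hu hw l => ?_⟩
  rcases eq_or_ne l 0 with rfl | hl
  · simp
  have hl' : 0 < ‖l‖ := norm_pos_iff.2 hl
  have := h (u, ‖l‖⁻¹ • l) ⟨⟨?_, hw⟩, ?_⟩
  · simp only [PiLp.smul_apply, smul_eq_mul, mul_smul, ← Finset.smul_sum, norm_smul, norm_inv,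
      norm_norm] at this
    rwa [← div_eq_inv_mul, le_div_iff₀ hl'] at this
  · rw [mem_closedBall_zero_iff]
    exact (pi_norm_le_iff_of_nonneg (abs_nonneg b)).2 fun i => (hu i).trans (le_abs_self b)
  · rw [mem_sphere_zero_iff_norm, norm_smul, norm_inv, norm_norm, inv_mul_cancel₀ hl'.ne']

theorem wedgeNorm_smul {n : ℕ} (s : Fin n → ℝ) (u : Fin n → Vec) :
    wedgeNorm (fun i => s i • u i) = |∏ i, s i| * wedgeNorm u := by
  have h : Matrix.det (Matrix.of fun i j => ⟪s i • u i, s j • u j⟫)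
      = (∏ i, s i) ^ 2 * Matrix.det (Matrix.of fun i j => ⟪u i, u j⟫) := by
    have h1 := Matrix.det_mul_column s (Matrix.of fun i j => s j * ⟪u i, u j⟫)
    have h2 := Matrix.det_mul_row s (Matrix.of fun i j => ⟪u i, u j⟫)
    simp only [Matrix.of_apply] at h1 h2
    rw [h2, ← mul_assoc, ← sq] at h1
    rw [← h1]
    congr 1
    ext i j
    simp only [Matrix.of_apply, inner_smul_left, inner_smul_right]
    simp [mul_left_comm]
  rw [wedgeNorm, wedgeNorm, h, Real.sqrt_mul (sq_nonneg _), Real.sqrt_sq_eq_abs]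

end LinearAlgebra

section Step

/-- The components of the rescaled frame of first and second derivatives of a map. -/
def frameC (M A : ℝ) (ψ : H → Vec) : Fin 4 → H → Vec :=
  ![fun p => M⁻¹ • WD true ψ p, fun p => M⁻¹ • WD false ψ p,
    fun p => A • WD true (WD true ψ) p, fun p => A • WD false (WD false ψ) p]

def frame (M A : ℝ) (ψ : H → Vec) : H → Fin 4 → Vec := fun p i => frameC M A ψ i p

theorem Smooth.frameC {M A : ℝ} {ψ : H → Vec} (h : Smooth ψ) (i : Fin 4) :
    Smooth (Heisenberg.frameC M A ψ i) := by
  fin_cases i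
  · exact ContDiff.const_smul M⁻¹ (h.WD true)
  · exact ContDiff.const_smul M⁻¹ (h.WD false)
  · exact ContDiff.const_smul A ((h.WD true).WD true)
  · exact ContDiff.const_smul A ((h.WD false).WD false)

theorem Smooth.frame {M A : ℝ} {ψ : H → Vec} (h : Smooth ψ) : Smooth (Heisenberg.frame M A ψ) :=
  contDiff_pi.2 fun i => h.frameC i

theorem SB.frame {M A a N : ℝ} {ψ : H → Vec} (h : Smooth ψ) {p : H} {J : ℕ}
    (h1 : ∀ c, SB (Heisenberg.WD c ψ) p (|M⁻¹|⁻¹ * a) N J)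
    (h2 : ∀ c, SB (Heisenberg.WD c (Heisenberg.WD c ψ)) p (|A|⁻¹ * a) N J)
    (hM : M ≠ 0) (hA : A ≠ 0) :
    SB (Heisenberg.frame M A ψ) p a N J := by
  have e1 : |M⁻¹| * (|M⁻¹|⁻¹ * a) = a := by
    rw [mul_inv_cancel_left₀ (abs_ne_zero.2 (inv_ne_zero hM))]
  have e2 : |A| * (|A|⁻¹ * a) = a := by rw [mul_inv_cancel_left₀ (abs_ne_zero.2 hA)]
  refine SB.pi (fun i => h.frameC i) fun i => ?_
  fin_cases i
  · exact e1 ▸ (h1 true).const_smul M⁻¹ (h.WD true)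
  · exact e1 ▸ (h1 false).const_smul M⁻¹ (h.WD false)
  · exact e2 ▸ (h2 true).const_smul A ((h.WD true).WD true)
  · exact e2 ▸ (h2 false).const_smul A ((h.WD false).WD false)

/-- The map with prescribed products with the first and second derivatives of `ψ`. -/
def corr (M A : ℝ) (ψ : H → Vec) (a b : Bool → H → ℝ) : H → Vec := fun p =>
  rinv (frame M A ψ p) (toK4 ![M⁻¹ * a true p, M⁻¹ * a false p, A * b true p, A * b false p])

section

variable {M A : ℝ} {ψ : H → Vec} {a b : Bool → H → ℝ}

theorem inner_corr_fst (hM : M ≠ 0) {c : ℝ} (hc : 0 < c) {p : H} (h : Coer c (frame M A ψ p))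
    (i : Bool) : ⟪WD i ψ p, corr M A ψ a b p⟫ = a i p := by
  have hM' := inv_ne_zero hM
  cases i
  · have := h.inner_rinv hc
      (toK4 ![M⁻¹ * a true p, M⁻¹ * a false p, A * b true p, A * b false p]) 1
    simp only [frame, frameC, Matrix.cons_val_one, Matrix.cons_val_zero, toK4_apply,
      real_inner_smul_left] at this
    exact mul_left_cancel₀ hM' this
  · have := h.inner_rinv hc
      (toK4 ![M⁻¹ * a true p, M⁻¹ * a false p, A * b true p, A * b false p]) 0
    simp only [frame, frameC, Matrix.cons_val_zero, toK4_apply,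
      real_inner_smul_left] at this
    exact mul_left_cancel₀ hM' this

theorem inner_corr_snd (hA : A ≠ 0) {c : ℝ} (hc : 0 < c) {p : H} (h : Coer c (frame M A ψ p))
    (i : Bool) : ⟪WD i (WD i ψ) p, corr M A ψ a b p⟫ = b i p := by
  cases i
  · have := h.inner_rinv hc
      (toK4 ![M⁻¹ * a true p, M⁻¹ * a false p, A * b true p, A * b false p]) 3
    simp only [frame, frameC, Matrix.cons_val, toK4_apply, real_inner_smul_left] at this
    exact mul_left_cancel₀ hA this
  · have := h.inner_rinv hc
      (toK4 ![M⁻¹ * a true p, M⁻¹ * a false p, A * b true p, A * b false p]) 2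
    simp only [frame, frameC, Matrix.cons_val, toK4_apply, real_inner_smul_left] at this
    exact mul_left_cancel₀ hA this

theorem smooth_corr_coef (ha : ∀ c, Smooth (a c)) (hb : ∀ c, Smooth (b c)) (i : Fin 4) :
    Smooth (![fun p => M⁻¹ * a true p, fun p => M⁻¹ * a false p, fun p => A * b true p,
      fun p => A * b false p] i) := by
  fin_cases i
  · exact contDiff_const.mul (ha true)
  · exact contDiff_const.mul (ha false)
  · exact contDiff_const.mul (hb true)
  · exact contDiff_const.mul (hb false)

theorem corr_eq : corr M A ψ a b = fun p => rinv (frame M A ψ p)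
    (toK4 fun i => ![fun p => M⁻¹ * a true p, fun p => M⁻¹ * a false p, fun p => A * b true p,
      fun p => A * b false p] i p) := by
  funext p
  rw [corr]
  congr 2
  funext i
  fin_cases i <;> rfl

theorem Smooth.corr (hψ : Smooth ψ) {c : ℝ} (hc : 0 < c) (h : ∀ p, Coer c (Heisenberg.frame M A ψ p))
    (ha : ∀ c, Smooth (a c)) (hb : ∀ c, Smooth (b c)) : Smooth (Heisenberg.corr M A ψ a b) := by
  rw [corr_eq]
  have h1 : Smooth fun p => Heisenberg.rinv (Heisenberg.frame M A ψ p) := hψ.frame.rinv hc h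
  have h2 : Smooth fun p => toK4 fun i => ![fun p => M⁻¹ * a true p, fun p => M⁻¹ * a false p,
      fun p => A * b true p, fun p => A * b false p] i p :=
    toK4.contDiff.comp (contDiff_pi.2 (smooth_corr_coef ha hb))
  exact ContDiff.clm_apply h1 h2

theorem SB.corr (hψ : Smooth ψ) {c : ℝ} (hc : 0 < c) (h : ∀ p, Coer c (Heisenberg.frame M A ψ p))
    (ha : ∀ c, Smooth (a c)) (hb : ∀ c, Smooth (b c)) {p : H} {K s N A' : ℝ} {J : ℕ} (hN : 0 ≤ N)
    (hR : SB (fun p => rinv (Heisenberg.frame M A ψ p)) p K N J) (hA : |A| ≤ A') (hM : |M⁻¹| ≤ A')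
    (ha' : ∀ c, SB (a c) p s N J) (hb' : ∀ c, SB (b c) p s N J) :
    SB (Heisenberg.corr M A ψ a b) p (2 ^ J * K * (‖toK4‖ * (A' * s))) N J := by
  rw [corr_eq]
  have hs := (ha' true).nonneg
  refine SB.apply (hψ.frame.rinv hc h)
    (toK4.contDiff.comp (contDiff_pi.2 (smooth_corr_coef ha hb))) hN hR
    (SB.clm toK4 (contDiff_pi.2 (smooth_corr_coef ha hb))
      (SB.pi (smooth_corr_coef ha hb) fun i => ?_))
  fin_cases i
  · exact ((ha' true).const_smul M⁻¹ (ha true)).mono (by gcongr) hN le_rfl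
  · exact ((ha' false).const_smul M⁻¹ (ha false)).mono (by gcongr) hN le_rfl
  · exact ((hb' true).const_smul A (hb true)).mono (by gcongr) hN le_rfl
  · exact ((hb' false).const_smul A (hb false)).mono (by gcongr) hN le_rfl

end

theorem SB.of_scale_two {E : Type*} [NormedAddCommGroup E] [NormedSpace ℝ E] {f : H → E} {p : H}
    {a N : ℝ} {J : ℕ} (h : SB f p a (2 * N) J) (hN : 0 ≤ N) : SB f p (2 ^ J * a) N J := by
  intro w hw
  refine (h w hw).trans ?_
  have ha := h.nonneg
  rw [mul_pow, mul_comm (2 ^ J) a, mul_assoc]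
  gcongr
  · norm_num

/-- First order coefficients of the correction. -/
def stepA (χ : H → ℝ) (r : ℝ) (φ δ : H → Vec) (c : Bool) : H → ℝ := fun p =>
  ⟪WD c (Pr χ r φ) p, δ p⟫ + ⟪φ p - Pr χ r φ p, WD c δ p⟫

/-- Second order coefficients of the correction. -/
def stepB (χ : H → ℝ) (r : ℝ) (φ δ : H → Vec) (c : Bool) : H → ℝ := fun p =>
  ⟪WD c (WD c (Pr χ r φ)) p, δ p⟫ + ⟪φ p - Pr χ r φ p, WD c (WD c δ) p⟫

section

variable {χ : H → ℝ} {r : ℝ} {φ δ ψ : H → Vec}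

theorem Bump.smooth_stepA (hχ : Bump χ) (hφ : Smooth φ) (hδ : Smooth δ) (c : Bool) :
    Smooth (stepA χ r φ δ c) :=
  (((smooth_Pr hχ hφ r).WD c).inner hδ).add
    (Smooth.inner (hφ.sub (smooth_Pr hχ hφ r)) (hδ.WD c))

theorem Bump.smooth_stepB (hχ : Bump χ) (hφ : Smooth φ) (hδ : Smooth δ) (c : Bool) :
    Smooth (stepB χ r φ δ c) :=
  ((((smooth_Pr hχ hφ r).WD c).WD c).inner hδ).add
    (Smooth.inner (hφ.sub (smooth_Pr hχ hφ r)) ((hδ.WD c).WD c))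

theorem Bump.WD_stepA_sub_stepB (hχ : Bump χ) (hφ : Smooth φ) (hδ : Smooth δ) (c : Bool) (p : H) :
    Heisenberg.WD c (stepA χ r φ δ c) p - stepB χ r φ δ c p
      = ⟪Heisenberg.WD c φ p, Heisenberg.WD c δ p⟫ := by
  have hS := smooth_Pr hχ hφ r
  have h1 : stepA χ r φ δ c = fun p => ⟪Heisenberg.WD c (Pr χ r φ) p, δ p⟫
    + ⟪φ p - Pr χ r φ p, Heisenberg.WD c δ p⟫ := rfl
  rw [h1, WD_add ((hS.WD c).inner hδ) (Smooth.inner (hφ.sub hS) (hδ.WD c)), WD_inner (hS.WD c) hδ,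
    WD_inner (hφ.sub hS) (hδ.WD c), WD_sub hφ hS]
  simp only [stepB, inner_sub_left]
  ring

/-- Leibniz rule in the form used to check orthogonality. -/
theorem inner_WD_WD (hφ : Smooth φ) (hψ : Smooth ψ) (c : Bool) (p : H) :
    ⟪WD c φ p, WD c ψ p⟫ = WD c (fun p => ⟪φ p, WD c ψ p⟫) p - ⟪φ p, WD c (WD c ψ) p⟫ := by
  rw [WD_inner hφ (hψ.WD c)]
  ring

theorem inner_WD_sub_corr {M A c : ℝ} (hM : M ≠ 0) (hA : A ≠ 0) (hc : 0 < c) (hχ : Bump χ)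
    (hφ : Smooth φ) (hδ : Smooth δ) (hψ : Smooth ψ)
    (hco : ∀ p, Coer c (frame M A (fun p => ψ p + δ p) p)) (i : Bool) (p : H)
    (h : ⟪WD i φ p, WD i ψ p⟫ = 0) :
    ⟪WD i (fun p => φ p - corr M A (fun p => ψ p + δ p) (stepA χ r φ δ) (stepB χ r φ δ) p) p,
      WD i (fun p => ψ p + δ p) p⟫ = 0 := by
  have hψ' : Smooth fun p => ψ p + δ p := hψ.add hδ
  have hη : Smooth (corr M A (fun p => ψ p + δ p) (stepA χ r φ δ) (stepB χ r φ δ)) :=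
    hψ'.corr hc hco (hχ.smooth_stepA hφ hδ) (hχ.smooth_stepB hφ hδ)
  have h1 := inner_WD_WD hη hψ' i p
  have e1 : (fun p => ⟪corr M A (fun p => ψ p + δ p) (stepA χ r φ δ) (stepB χ r φ δ) p,
      WD i (fun p => ψ p + δ p) p⟫) = stepA χ r φ δ i := by
    funext q
    rw [real_inner_comm, inner_corr_fst hM hc (hco q)]
  rw [e1, real_inner_comm _ (corr M A _ _ _ p), inner_corr_snd hA hc (hco p),
    hχ.WD_stepA_sub_stepB hφ hδ] at h1
  rw [WD_sub hφ hη, inner_sub_left, h1, WD_add hψ hδ, inner_add_right, h]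
  ring

end

theorem IsKernel.exists_SB_pieces {χ : H → ℝ} (hχ : IsKernel 21 χ) : ∃ C : ℝ, 0 ≤ C ∧
    ∀ {φ : H → Vec}, Smooth φ → ∀ {r G : ℝ}, 0 < r → r ≤ 1 → 0 ≤ G →
      (∀ w : List Bool, w.length ≤ 21 → ∀ q, ‖DD w φ q‖ ≤ G * r⁻¹ ^ (w.length - 2)) → ∀ p,
      (∀ c, SB (WD c (Pr χ r φ)) p (C * G) r⁻¹ 21) ∧
      (∀ c, SB (WD c (WD c (Pr χ r φ))) p (C * G) r⁻¹ 21) ∧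
      SB (fun p => φ p - Pr χ r φ p) p (C * G * r ^ 2) r⁻¹ 21 := by
  obtain ⟨C₁, hC₁, h1⟩ := hχ.bump.exists_norm_DD_Pr_le (E := Vec) 23
  obtain ⟨C₂, hC₂, h2⟩ := hχ.exists_norm_DD_sub_Pr_le (E := Vec)
  refine ⟨1 + C₁ + C₂, by positivity, fun {φ} hφ {r G} hr hr1 hG hb p => ?_⟩
  have hr' : 1 ≤ r⁻¹ := (one_le_inv₀ hr).2 hr1
  have hS := smooth_Pr hχ.bump hφ r
  have key : ∀ w : List Bool, w.length ≤ 23 → ∀ p,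
      ‖DD w (Pr χ r φ) p‖ ≤ C₁ * G * r⁻¹ ^ (w.length - 2) := by
    intro w hw p
    rcases le_or_gt w.length 2 with h | h
    · have := h1 hφ hr hG (k := w.length) (j := 0)
        (fun w' hw' q => (hb w' (by omega) q).trans (by simp [hw', h])) w rfl hw p
      simpa [Nat.sub_eq_zero_of_le h] using this
    · have := h1 hφ hr hG (k := 2) (j := w.length - 2)
        (fun w' hw' q => (hb w' (by omega) q).trans (by simp [hw'])) w (by omega) hw p
      linarith
  refine ⟨fun c w hw => ?_, fun c w hw => ?_, fun w hw => ?_⟩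
  · rw [← DD_concat]
    refine (key _ (by simp; omega) p).trans ?_
    have : r⁻¹ ^ ((w ++ [c]).length - 2) ≤ r⁻¹ ^ w.length := by
      gcongr
      simp
    gcongr
    linarith
  · rw [← DD_concat, ← DD_concat]
    refine (key _ (by simp; omega) p).trans ?_
    have : r⁻¹ ^ (((w ++ [c]) ++ [c]).length - 2) ≤ r⁻¹ ^ w.length := by
      gcongr
      simp
    gcongr
    linarith
  · rcases hw.lt_or_eq with h | h
    · have := h2 hφ hr (G := G * r⁻¹ ^ 19) (by positivity) (l := 21) le_rfl
        (fun w' hw' q => (hb w' (by omega) q).trans (by rw [hw'])) w h p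
      refine this.trans ?_
      have e : r ^ (21 - w.length) * r⁻¹ ^ 19 = r ^ 2 * r⁻¹ ^ w.length := by
        rw [inv_pow, inv_pow]
        field_simp
        rw [← pow_add]
        congr 1
        omega
      calc C₂ * r ^ (21 - w.length) * (G * r⁻¹ ^ 19)
          = C₂ * G * (r ^ (21 - w.length) * r⁻¹ ^ 19) := by ring
        _ = C₂ * G * r ^ 2 * r⁻¹ ^ w.length := by rw [e]; ring
        _ ≤ _ := by gcongr; linarith
    · rw [DD_sub hφ hS]
      refine (norm_sub_le _ _).trans ?_
      have e : r⁻¹ ^ (w.length - 2) = r ^ 2 * r⁻¹ ^ w.length := by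
        rw [h, inv_pow, inv_pow]
        field_simp
      have t1 := hb w hw p
      have t2 := key w (by omega) p
      rw [e] at t1 t2
      have : 0 ≤ C₂ * (G * (r ^ 2 * r⁻¹ ^ w.length)) := by positivity
      linarith

theorem IsKernel.exists_SB_step {χ : H → ℝ} (hχ : IsKernel 21 χ) {G K : ℝ} (hG : 0 ≤ G) :
    ∃ C : ℝ, 0 ≤ C ∧ ∀ {A M r σ c : ℝ}, 1 ≤ A → 0 < M → M⁻¹ ≤ A → 0 < r → r ≤ 1 → 0 ≤ σ → 0 < c →
      ∀ {φ δ ψ : H → Vec}, Smooth φ → Smooth δ → Smooth ψ →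
      (∀ w : List Bool, w.length ≤ 21 → ∀ q, ‖DD w φ q‖ ≤ G * r⁻¹ ^ (w.length - 2)) →
      (∀ p, SB δ p σ r⁻¹ 23) → (∀ p, Coer c (frame M A ψ p)) →
      (∀ p, SB (fun p => rinv (frame M A ψ p)) p K r⁻¹ 21) → ∀ p,
      SB (corr M A ψ (stepA χ r φ δ) (stepB χ r φ δ)) p (C * A * σ) r⁻¹ 21 ∧
      ∀ i, SB (fun p => ⟪φ p, WD i δ p⟫ - stepA χ r φ δ i p) p (C * σ * r⁻¹) r⁻¹ 21 := by
  obtain ⟨C, hC, h⟩ := hχ.exists_SB_pieces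
  set D : ℝ := 2 ^ 22 * (C * G) with hD
  have hD0 : 0 ≤ D := by positivity
  refine ⟨2 ^ 21 * |K| * (‖toK4‖ * D) + 2 ^ 21 * G + D, by positivity,
    fun {A M r σ c} hA hM hMA hr hr1 hσ hc {φ δ ψ} hφ hδ hψ hb hδ' hco hR p => ?_⟩
  have hr' : 1 ≤ r⁻¹ := (one_le_inv₀ hr).2 hr1
  have hr0 : (0 : ℝ) ≤ r⁻¹ := by positivity
  have hS := smooth_Pr hχ.bump hφ r
  obtain ⟨p1, p2, p3⟩ := h hφ hr hr1 hG hb p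
  have d1 : ∀ i, SB (WD i δ) p (σ * r⁻¹) r⁻¹ 22 := fun i => (hδ' p).WD i
  have d2 : ∀ i, SB (WD i (WD i δ)) p (σ * r⁻¹ * r⁻¹) r⁻¹ 21 := fun i => (d1 i).WD i
  have d0 : SB δ p σ r⁻¹ 21 := (hδ' p).mono le_rfl hr0 (by norm_num)
  have hrr : r * r⁻¹ = 1 := mul_inv_cancel₀ hr.ne'
  have sA : ∀ i, SB (stepA χ r φ δ i) p (D * σ) r⁻¹ 21 := fun i => by
    refine ((SB.inner (hS.WD i) hδ hr0 (p1 i) d0).add ((hS.WD i).inner hδ)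
      (Smooth.inner (hφ.sub hS) (hδ.WD i)) (SB.inner (hφ.sub hS) (hδ.WD i) hr0 p3
        ((d1 i).mono le_rfl hr0 (by norm_num)))).mono ?_ hr0 le_rfl
    have e : r ^ 2 * r⁻¹ = r := by rw [sq, mul_assoc, hrr, mul_one]
    calc 2 ^ 21 * (C * G) * σ + 2 ^ 21 * (C * G * r ^ 2) * (σ * r⁻¹)
        = 2 ^ 21 * (C * G) * σ + 2 ^ 21 * (C * G) * σ * (r ^ 2 * r⁻¹) := by ring
      _ ≤ 2 ^ 21 * (C * G) * σ + 2 ^ 21 * (C * G) * σ * 1 := by rw [e]; gcongr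
      _ = D * σ := by rw [hD]; ring
  have sB : ∀ i, SB (stepB χ r φ δ i) p (D * σ) r⁻¹ 21 := fun i => by
    refine ((SB.inner ((hS.WD i).WD i) hδ hr0 (p2 i) d0).add (((hS.WD i).WD i).inner hδ)
      (Smooth.inner (hφ.sub hS) ((hδ.WD i).WD i)) (SB.inner (hφ.sub hS) ((hδ.WD i).WD i) hr0 p3
        (d2 i))).mono (le_of_eq ?_) hr0 le_rfl
    have e : r ^ 2 * r⁻¹ * r⁻¹ = 1 := by field_simp
    rw [hD]
    linear_combination 2 ^ 21 * (C * G) * σ * e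
  have sφ : SB φ p G r⁻¹ 21 := fun w hw => (hb w hw p).trans (by
    gcongr
    omega)
  refine ⟨?_, fun i => ?_⟩
  · refine (SB.corr hψ hc hco (hχ.bump.smooth_stepA hφ hδ) (hχ.bump.smooth_stepB hφ hδ) hr0
      (hR p) (A' := A) (by rw [abs_of_nonneg (by linarith)])
      (by rwa [abs_of_pos (inv_pos.2 hM)]) sA sB).mono ?_ hr0 le_rfl
    have : K ≤ |K| := le_abs_self K
    calc 2 ^ 21 * K * (‖toK4‖ * (A * (D * σ))) ≤ 2 ^ 21 * |K| * (‖toK4‖ * (A * (D * σ))) := by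
          gcongr
      _ = 2 ^ 21 * |K| * (‖toK4‖ * D) * A * σ := by ring
      _ ≤ _ := by
        gcongr
        have : 0 ≤ 2 ^ 21 * G := by positivity
        linarith
  · refine ((SB.inner hφ (hδ.WD i) hr0 sφ ((d1 i).mono le_rfl hr0 (by norm_num))).sub
      (hφ.inner (hδ.WD i)) (hχ.bump.smooth_stepA hφ hδ i)
      (sA i)).mono ?_ hr0 le_rfl
    have h1 : D * σ ≤ D * σ * r⁻¹ := le_mul_of_one_le_right (by positivity) hr'
    have h2 : 0 ≤ 2 ^ 21 * |K| * (‖toK4‖ * D) * σ * r⁻¹ := by positivity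
    linarith

end Step

section Approximants

theorem SB.smul {E : Type*} [NormedAddCommGroup E] [NormedSpace ℝ E] {f : H → ℝ} {g : H → E}
    (hf : Smooth f) (hg : Smooth g) {p : H} {a b N : ℝ} {J : ℕ} (hN : 0 ≤ N) (h : SB f p a N J)
    (h' : SB g p b N J) : SB (fun p => f p • g p) p (2 ^ J * a * b) N J := by
  have ha := h.nonneg
  have hb := h'.nonneg
  refine (SB.bilin (ContinuousLinearMap.lsmul ℝ ℝ) hf hg hN h h').mono ?_ hN le_rfl
  have h1 : ‖(ContinuousLinearMap.lsmul ℝ ℝ : ℝ →L[ℝ] E →L[ℝ] E)‖ ≤ 1 :=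
    ContinuousLinearMap.opNorm_lsmul_le
  calc 2 ^ J * ‖(ContinuousLinearMap.lsmul ℝ ℝ : ℝ →L[ℝ] E →L[ℝ] E)‖ * a * b
      ≤ 2 ^ J * 1 * a * b := by gcongr
    _ = 2 ^ J * a * b := by ring

theorem Bump.exists_norm_DD_le {E : Type*} [NormedAddCommGroup E] [NormedSpace ℝ E] {h : H → E}
    (hh : Bump h) (n : ℕ) : ∃ C : ℝ, 0 ≤ C ∧ ∀ w : List Bool, w.length ≤ n →
      ∀ p, ‖Heisenberg.DD w h p‖ ≤ C := by
  refine exists_uniform_words n (Q := fun w C => ∀ p, ‖Heisenberg.DD w h p‖ ≤ C) (fun w => ?_)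
    fun w C C' hC hQ p => (hQ p).trans hC
  have hb : Bump (Heisenberg.DD w h) := by
    induction w with
    | nil => exact hh
    | cons b w ih => exact ih.WD b
  obtain ⟨C, hC⟩ := hb.smooth.continuous.bounded_above_of_compact_support hb.supp
  exact ⟨max C 0, le_max_right _ _, fun p => (hC p).trans (le_max_left _ _)⟩

/-- The sum of the lattice translates of the partition of unity for which `m < n γ`. -/
def cut (n : Lat → ℕ) (m : ℕ) : H → ℝ := lsum fun γ p =>
  (if m < n γ then ContinuousLinearMap.id ℝ ℝ else 0) (pou (tr γ p))

theorem cut_summand_eq (n : Lat → ℕ) (m : ℕ) (γ : Lat) (p : H) :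
    (if m < n γ then ContinuousLinearMap.id ℝ ℝ else 0) (pou (tr γ p))
      = (if m < n γ then 1 else 0) * pou (tr γ p) := by
  split_ifs <;> simp

theorem smooth_pou_tr (γ : Lat) : Smooth fun p => pou (tr γ p) := bump_pou.smooth.comp (smooth_tr γ)

theorem smooth_cut (n : Lat → ℕ) (m : ℕ) : Smooth (cut n m) := by
  refine LF.smooth (LF_of_tsupport (isCompact_closedBall 0 1) fun γ p hp => ?_) fun γ => ?_
  · rw [pou_eq_zero hp, map_zero]
  · exact ContDiff.comp (ContinuousLinearMap.contDiff _) (smooth_pou_tr γ)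

theorem exists_SB_cut (J : ℕ) : ∃ C : ℝ, 0 ≤ C ∧ ∀ (n : Lat → ℕ) (m : ℕ) (p : H) {N : ℝ}, 1 ≤ N →
    SB (cut n m) p C N J := by
  obtain ⟨C, hC, h⟩ := exists_norm_DD_lsum_tr_le (E := ℝ) bump_pou J
  refine ⟨C, hC, fun n m p {N} hN w hw => ?_⟩
  refine (h (c := fun γ => if m < n γ then ContinuousLinearMap.id ℝ ℝ else 0) (fun γ => ?_) w hw
    p).trans (le_mul_of_one_le_right hC (one_le_pow₀ hN))
  split_ifs
  · exact ContinuousLinearMap.norm_id_le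
  · simp

variable {χ : H → ℝ} {ψ : H → Vec} {n : Lat → ℕ}

def piece (χ : H → ℝ) (n : Lat → ℕ) (ψ : H → Vec) (m : ℕ) : H → Vec := fun p =>
  cut n m p • Pr (fun p => dil χ p - χ p) (rr m) ψ p

/-- Localised approximations of `ψ`. -/
def appr (χ : H → ℝ) (n : Lat → ℕ) (ψ : H → Vec) (N : ℕ) : H → Vec := fun p =>
  Pr χ 1 ψ p + ∑ m ∈ Finset.range N, piece χ n ψ m p

def rest (χ : H → ℝ) (n : Lat → ℕ) (ψ : H → Vec) : H → Vec := lsum fun γ p =>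
  pou (tr γ p) • (ψ p - Pr χ (rr (n γ)) ψ p)

theorem appr_succ (N : ℕ) :
    appr χ n ψ (N + 1) = fun p => appr χ n ψ N p + piece χ n ψ N p := by
  funext p
  simp only [appr, Finset.sum_range_succ, add_assoc]

theorem Bump.smooth_piece (hχ : Bump χ) (hψ : Smooth ψ) (m : ℕ) : Smooth (piece χ n ψ m) :=
  ContDiff.smul (smooth_cut n m) (smooth_Pr (hχ.dil.sub hχ) hψ _)

theorem Bump.smooth_appr (hχ : Bump χ) (hψ : Smooth ψ) (N : ℕ) : Smooth (appr χ n ψ N) :=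
  (smooth_Pr hχ hψ 1).add (Smooth.finset_sum _ fun m _ => hχ.smooth_piece hψ m)

theorem exists_cut_eq_zero (n : Lat → ℕ) (p : H) :
    ∃ s : Finset Lat, ∀ᶠ q in nhds p, (∀ γ ∉ s, pou (tr γ q) = 0) ∧
      ∀ m, s.sup n ≤ m → cut n m q = 0 := by
  obtain ⟨s, hs⟩ := (LF_of_tsupport (isCompact_closedBall 0 1)
    (f := fun γ p => pou (tr γ p)) fun γ p hp => pou_eq_zero hp) p
  refine ⟨s, hs.mono fun q hq => ⟨hq, fun m hm => ?_⟩⟩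
  rw [cut, lsum_eq_sum (s := s) fun γ hγ => ?_]
  · refine Finset.sum_eq_zero fun γ hγ => ?_
    rw [if_neg (not_lt.2 ((Finset.le_sup hγ).trans hm)), _root_.zero_apply]
  · have h0 : pou (tr γ q) = 0 := hq γ hγ
    change (if m < n γ then ContinuousLinearMap.id ℝ ℝ else 0) (pou (tr γ q)) = 0
    rw [h0, map_zero]

theorem LF_piece : LF (piece χ n ψ) := by
  intro p
  obtain ⟨s, hs⟩ := exists_cut_eq_zero n p
  refine ⟨Finset.range (s.sup n), hs.mono fun q hq m hm => ?_⟩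
  rw [piece, hq.2 m (by simpa using hm), zero_smul]

theorem LF_rest : LF fun γ p => pou (tr γ p) • (ψ p - Pr χ (rr (n γ)) ψ p) :=
  LF_of_tsupport (isCompact_closedBall 0 1) fun γ p hp => by rw [pou_eq_zero hp, zero_smul]

theorem Bump.smooth_rest_summand (hχ : Bump χ) (hψ : Smooth ψ) (γ : Lat) :
    Smooth fun p => pou (tr γ p) • (ψ p - Pr χ (rr (n γ)) ψ p) :=
  ContDiff.smul (smooth_pou_tr γ) (hψ.sub (smooth_Pr hχ hψ _))

theorem Bump.smooth_rest (hχ : Bump χ) (hψ : Smooth ψ) : Smooth (rest χ n ψ) :=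
  LF.smooth LF_rest (hχ.smooth_rest_summand hψ)

theorem sub_lsum_piece {k : ℕ} (hχ : IsKernel k χ) (hψ : Smooth ψ) (p : H) :
    ψ p - (Pr χ 1 ψ p + lsum (piece χ n ψ) p) = rest χ n ψ p := by
  obtain ⟨s, hs⟩ := exists_cut_eq_zero n p
  obtain ⟨h0, h1⟩ := hs.self_of_nhds
  set S : ℕ → Vec := fun m => Pr χ (rr m) ψ p with hS
  have hstep : ∀ m, Pr (fun p => dil χ p - χ p) (rr m) ψ p = S (m + 1) - S m := fun m => by
    rw [← Pr_half_sub hχ hψ]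
    simp only [hS, rr, pow_succ, div_eq_mul_inv, one_mul]
  have hpou : ∑ γ ∈ s, pou (tr γ p) = 1 := by rw [← lsum_pou p, lsum_eq_sum h0]
  have hcut : ∀ m, cut n m p = ∑ γ ∈ s, (if m < n γ then 1 else 0) * pou (tr γ p) := fun m => by
    rw [cut, lsum_eq_sum (s := s) fun γ hγ => by
      change (if m < n γ then ContinuousLinearMap.id ℝ ℝ else 0) (pou (tr γ p)) = 0
      rw [h0 γ hγ, map_zero]]
    exact Finset.sum_congr rfl fun γ _ => cut_summand_eq n m γ p
  have hl : lsum (piece χ n ψ) p = ∑ γ ∈ s, pou (tr γ p) • (S (n γ) - S 0) := by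
    rw [lsum_nat_eq_sum_range (n := s.sup n) fun m hm => by rw [piece, h1 m hm, zero_smul]]
    have : ∀ m, piece χ n ψ m p
        = ∑ γ ∈ s, pou (tr γ p) • (if m < n γ then S (m + 1) - S m else 0) := fun m => by
      rw [piece, hcut, hstep, Finset.sum_smul]
      refine Finset.sum_congr rfl fun γ _ => ?_
      split_ifs <;> simp
    simp only [this]
    rw [Finset.sum_comm]
    refine Finset.sum_congr rfl fun γ hγ => ?_
    rw [← Finset.smul_sum, ← Finset.sum_filter]
    congr 1
    have : (Finset.range (s.sup n)).filter (fun m => m < n γ) = Finset.range (n γ) := by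
      ext m
      have := Finset.le_sup (f := n) hγ
      simp only [Finset.mem_filter, Finset.mem_range]
      omega
    rw [this, Finset.sum_range_sub]
  rw [hl, rest, lsum_eq_sum (s := s) fun γ hγ => by
    rw [h0 γ hγ, zero_smul]]
  have h2 : ∑ γ ∈ s, pou (tr γ p) • ψ p = ψ p := by rw [← Finset.sum_smul, hpou, one_smul]
  have h3 : ∑ γ ∈ s, pou (tr γ p) • S 0 = Pr χ 1 ψ p := by
    rw [← Finset.sum_smul, hpou, one_smul]; simp [hS]
  simp only [smul_sub, Finset.sum_sub_distrib]
  rw [h2, h3]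
  abel

theorem exists_SB_rest (hχ : Bump χ) (h1 : ∫ g, χ g = 1) (hψ : Smooth ψ) (J : ℕ) {L : H → ℝ}
    (hL : Continuous L) (hL0 : ∀ p, 0 < L p) : ∃ n : Lat → ℕ, ∀ p, SB (rest χ n ψ) p (L p) 1 J := by
  have hK : IsCompact (Metric.closedBall (0 : H) 1) := isCompact_closedBall 0 1
  obtain ⟨C, hC, hpou⟩ := bump_pou.exists_norm_DD_le J
  obtain ⟨No, hNo⟩ := exists_overlap hK
  set D : ℝ := (No + 1) * (2 ^ J * (C + 1)) with hD
  have hD0 : 0 < D := by positivity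
  have hcpt : ∀ γ : Lat, IsCompact {p | tr γ p ∈ Metric.closedBall (0 : H) 1} := fun γ => by
    have : {p | tr γ p ∈ Metric.closedBall (0 : H) 1}
        = (fun p => mul p (lat γ)) '' Metric.closedBall (0 : H) 1 := by
      ext p
      constructor
      · exact fun hp => ⟨tr γ p, hp, mul_tr γ p⟩
      · rintro ⟨q, hq, rfl⟩
        simpa [tr, mul_inv_cancel_right''] using hq
    rw [this]
    exact hK.image (smooth_mul_right _).continuous
  have hn : ∀ γ : Lat, ∃ n : ℕ, ∀ p, tr γ p ∈ Metric.closedBall (0 : H) 1 →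
      SB (fun p => ψ p - Pr χ (rr n) ψ p) p (L p / D) 1 J := fun γ => by
    obtain ⟨ε, hε, hεL⟩ := (hcpt γ).exists_forall_le' hL.continuousOn (a := 0) fun p _ => hL0 p
    have hfin : {w : List Bool | w.length ≤ J}.Finite := List.finite_length_le Bool J
    have hev : ∀ᶠ r in nhds (0 : ℝ), ∀ w ∈ {w : List Bool | w.length ≤ J},
        ∀ p ∈ {p | tr γ p ∈ Metric.closedBall (0 : H) 1},
          ‖DD w ψ p - DD w (Pr χ r ψ) p‖ ≤ ε / D :=
      (Set.Finite.eventually_all hfin).2 fun w _ =>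
        eventually_norm_DD_sub_Pr_le hχ h1 hψ w (hcpt γ) (by positivity)
    have ht : Filter.Tendsto rr Filter.atTop (nhds 0) :=
      tendsto_pow_atTop_nhds_zero_of_lt_one (by norm_num) (by norm_num)
    obtain ⟨n, hn⟩ := (ht.eventually hev).exists
    refine ⟨n, fun p hp w hw => ?_⟩
    rw [DD_sub hψ (smooth_Pr hχ hψ _), one_pow, mul_one]
    exact (hn w hw p hp).trans (by gcongr; exact hεL p hp)
  choose n hn using hn
  refine ⟨n, fun p w hw => ?_⟩
  obtain ⟨s, hs, hsm⟩ := hNo p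
  rw [rest, LF.DD_lsum LF_rest (hχ.smooth_rest_summand hψ), one_pow, mul_one]
  refine (norm_lsum_le (s := s) (a := fun _ => L p / (No + 1)) (fun γ hγ => ?_)
    fun γ hγ => ?_).trans ?_
  · have hγ' : tr γ p ∉ Metric.closedBall (0 : H) 1 := fun h => hγ ((hsm γ).2 h)
    have : (fun p => pou (tr γ p) • (ψ p - Pr χ (rr (n γ)) ψ p)) =ᶠ[nhds p] fun _ => 0 := by
      have := (smooth_tr γ).continuous.continuousAt.eventually
        (hK.isClosed.isOpen_compl.mem_nhds hγ')
      filter_upwards [this] with q hq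
      rw [pou_eq_zero hq, zero_smul]
    have h2 := (DD_congr_of_eventuallyEq this w).self_of_nhds
    rw [h2, DD_zero]
  · have hp1 : SB (fun p => pou (tr γ p)) p C 1 J := fun w hw => by
      have : DD w (fun p => pou (tr γ p)) p = DD w pou (tr γ p) :=
        congrFun (DD_mul_right bump_pou.smooth (inv (lat γ)) w) p
      rw [this, one_pow, mul_one]
      exact hpou w hw _
    have h3 := SB.smul (smooth_pou_tr γ) (hψ.sub (smooth_Pr hχ hψ _)) zero_le_one hp1
      (hn γ p ((hsm γ).1 hγ)) w hw
    rw [one_pow, mul_one] at h3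
    refine h3.trans ?_
    have hLp := hL0 p
    calc 2 ^ J * C * (L p / D) ≤ 2 ^ J * (C + 1) * (L p / D) := by gcongr; linarith
      _ = L p / (No + 1) := by rw [hD]; field_simp
  · rw [Finset.sum_const, nsmul_eq_mul]
    have hLp := hL0 p
    have : (s.card : ℝ) ≤ No + 1 := by
      have : (s.card : ℝ) ≤ No := by exact_mod_cast hs
      linarith
    calc (s.card : ℝ) * (L p / (No + 1)) ≤ (No + 1) * (L p / (No + 1)) := by gcongr
      _ = L p := by field_simp

end Approximants

section Estimates

theorem one_le_inv_rr (m : ℕ) : 1 ≤ (rr m)⁻¹ := (one_le_inv₀ (rr_pos m)).2 (rr_le_one m)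

theorem inv_rr_mono {m n : ℕ} (h : m ≤ n) : (rr m)⁻¹ ≤ (rr n)⁻¹ :=
  inv_anti₀ (rr_pos n) (pow_le_pow_of_le_one (by norm_num) (by norm_num) h)

theorem inv_rr_succ (m : ℕ) : (rr (m + 1))⁻¹ = 2 * (rr m)⁻¹ := by
  simp only [rr, pow_succ, mul_inv]
  norm_num [mul_comm]

theorem rr_rpow_le_one (m : ℕ) {α : ℝ} (hα : 0 < α) : rr m ^ α ≤ 1 :=
  Real.rpow_le_one (rr_pos m).le (rr_le_one m) hα.le

theorem sum_rr_le (n : ℕ) : ∑ m ∈ Finset.range n, rr m ≤ 2 := by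
  have h : ∑ m ∈ Finset.range n, rr m = 2 - 2 * rr n := by
    induction n with
    | zero => simp
    | succ n ih =>
      rw [Finset.sum_range_succ, ih]
      simp only [rr, pow_succ]
      ring
  have := rr_pos n
  linarith

theorem sum_norm_DD_le {E : Type*} [NormedAddCommGroup E] [NormedSpace ℝ E] {f : ℕ → H → E}
    {p : H} {s : ℝ} (hs : 0 ≤ s) {J n k : ℕ} (hk : 19 ≤ k)
    (h : ∀ m < n, SB (f m) p (s * rr m ^ k) (rr m)⁻¹ J)
    (w : List Bool) (hw : w.length ≤ J) :
    ∑ m ∈ Finset.range n, ‖DD w (f m) p‖ ≤ 2 * s * (rr n)⁻¹ ^ (w.length - 2) := by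
  have key : ∀ m ∈ Finset.range n, ‖DD w (f m) p‖ ≤ rr m * (s * (rr n)⁻¹ ^ (w.length - 2)) := by
    intro m hm
    have hmn : m < n := by simpa using hm
    refine (h m hmn w hw).trans ?_
    have h0 := rr_pos m
    have h1 := one_le_inv_rr m
    have e1 : (rr m)⁻¹ ^ w.length ≤ (rr m)⁻¹ ^ (w.length - 2) * (rr m)⁻¹ ^ 2 := by
      rw [← pow_add]
      exact pow_le_pow_right₀ h1 (by omega)
    have e2 : rr m ^ k ≤ rr m ^ 3 := pow_le_pow_of_le_one h0.le (rr_le_one m) (by omega)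
    have e3 : (rr m)⁻¹ ^ (w.length - 2) ≤ (rr n)⁻¹ ^ (w.length - 2) := by
      have := inv_rr_mono hmn.le
      gcongr
    calc s * rr m ^ k * (rr m)⁻¹ ^ w.length
        ≤ s * rr m ^ 3 * ((rr m)⁻¹ ^ (w.length - 2) * (rr m)⁻¹ ^ 2) := by gcongr
      _ = s * (rr m)⁻¹ ^ (w.length - 2) * (rr m ^ 3 * (rr m)⁻¹ ^ 2) := by ring
      _ = s * (rr m)⁻¹ ^ (w.length - 2) * rr m := by
        congr 1
        field_simp
      _ ≤ s * (rr n)⁻¹ ^ (w.length - 2) * rr m := by gcongr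
      _ = _ := by ring
  refine (Finset.sum_le_sum key).trans ?_
  rw [← Finset.sum_mul]
  have h0 : 0 ≤ s * (rr n)⁻¹ ^ (w.length - 2) := by
    have := (rr_pos n).le
    positivity
  calc _ ≤ 2 * (s * (rr n)⁻¹ ^ (w.length - 2)) := by gcongr; exact sum_rr_le n
    _ = _ := by ring

/-- The quantitative hypotheses on the base map. -/
structure Adm (α D c A M : ℝ) (ψ : H → Vec) : Prop where
  smooth : Smooth ψ
  one_le : 1 ≤ A
  pos : 0 < M
  inv_le : M⁻¹ ≤ D
  fst : ∀ b p, ‖WD b ψ p‖ ≤ D * M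
  snd : ∀ w : List Bool, w.length = 2 → ∀ p, ‖DD w ψ p‖ ≤ D * A⁻¹
  trd : ∀ w : List Bool, w.length = 3 → ∀ p, ‖DD w ψ p‖ ≤ D * A⁻¹ ^ 2
  hol : ∀ w : List Bool, w.length = 20 → ∀ p q,
    ‖DD w ψ p - DD w ψ q‖ ≤ D * A⁻¹ ^ 2 * ccDist p q ^ α
  coer : ∀ p, Coer c (frame M A ψ p)

theorem IsKernel.exists_SB_piece {χ : H → ℝ} (hχ : IsKernel 21 χ) {α : ℝ} (hα : 0 < α) {D : ℝ}
    (hD : 0 ≤ D) : ∃ C : ℝ, 0 ≤ C ∧ ∀ {c A M : ℝ} {ψ : H → Vec}, Adm α D c A M ψ →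
      ∀ (n : Lat → ℕ) (m : ℕ) (p : H),
        SB (piece χ n ψ m) p (C * A⁻¹ ^ 2 * rr m ^ α * rr m ^ 20) (rr m)⁻¹ 23 := by
  obtain ⟨C₁, hC₁, h1⟩ := hχ.ord.exists_norm_DD_Pr_le_holder (E := Vec) hα 23
  obtain ⟨C₂, hC₂, h2⟩ := exists_SB_cut 23
  refine ⟨2 ^ 23 * C₂ * (C₁ * D), by positivity, fun {c A M ψ} h n m p => ?_⟩
  have hA := h.one_le
  have hr := rr_pos m
  have hδ : SB (Pr (fun p => dil χ p - χ p) (rr m) ψ) p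
      (C₁ * D * A⁻¹ ^ 2 * rr m ^ α * rr m ^ 20) (rr m)⁻¹ 23 := fun w hw =>
    (h1 h.smooth hr (by positivity) h.hol w hw p).trans (le_of_eq (by ring))
  refine (SB.smul (smooth_cut n m) (smooth_Pr (hχ.bump.dil.sub hχ.bump) h.smooth _)
    (by positivity) (h2 n m p (one_le_inv_rr m)) hδ).mono (le_of_eq (by ring))
    (by positivity) le_rfl

theorem IsKernel.exists_norm_DD_appr_le {χ : H → ℝ} (hχ : IsKernel 21 χ) {α : ℝ} (hα : 0 < α)
    {D : ℝ} (hD : 0 ≤ D) : ∃ C : ℝ, 0 ≤ C ∧ ∀ {c A M : ℝ} {ψ : H → Vec}, Adm α D c A M ψ →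
      ∀ (n : Lat → ℕ),
        (∀ m p, SB (piece χ n ψ m) p (C * A⁻¹ ^ 2 * rr m ^ α * rr m ^ 20) (rr m)⁻¹ 23) ∧
        (∀ N p, ∀ w : List Bool, w.length ≤ 2 → ‖DD w (appr χ n ψ N) p - DD w ψ p‖ ≤ C * A⁻¹ ^ 2) ∧
        (∀ N p, ∀ w : List Bool, 2 ≤ w.length → w.length ≤ 23 →
          ‖DD w (appr χ n ψ N) p‖ ≤ C * A⁻¹ * (rr N)⁻¹ ^ (w.length - 2)) ∧
        (∀ p, ∀ w : List Bool, 3 ≤ w.length → w.length ≤ 23 →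
          ‖DD w (appr χ n ψ 0) p‖ ≤ C * A⁻¹ ^ 2) := by
  obtain ⟨C₁, hC₁, h1⟩ := hχ.exists_SB_piece hα hD
  obtain ⟨C₂, hC₂, h2⟩ := hχ.exists_norm_DD_sub_Pr_le (E := Vec)
  obtain ⟨C₃, hC₃, h3⟩ := hχ.bump.exists_norm_DD_Pr_le (E := Vec) 23
  refine ⟨2 * C₁ + C₂ * D + C₃ * D, by positivity, fun {c A M ψ} h n => ?_⟩
  have hA := h.one_le
  have hA0 : 0 ≤ A⁻¹ := by positivity
  have hA1 : A⁻¹ ^ 2 ≤ A⁻¹ := by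
    have : A⁻¹ ≤ 1 := inv_le_one_of_one_le₀ hA
    nlinarith
  have hs : ∀ N p, ∀ w : List Bool, w.length ≤ 23 →
      ∑ m ∈ Finset.range N, ‖DD w (piece χ n ψ m) p‖
        ≤ 2 * (C₁ * A⁻¹ ^ 2) * (rr N)⁻¹ ^ (w.length - 2) := fun N p w hw => by
    refine sum_norm_DD_le (by positivity) (k := 20) (by norm_num) (fun m _ => ?_) w hw
    have hr := rr_pos m
    refine (h1 h n m p).mono ?_ (by positivity) le_rfl
    have := rr_rpow_le_one m hα
    exact mul_le_mul_of_nonneg_right (mul_le_of_le_one_right (by positivity) this) (by positivity)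
  have happ : ∀ N (w : List Bool), DD w (appr χ n ψ N) = fun p => DD w (Pr χ 1 ψ) p
      + ∑ m ∈ Finset.range N, DD w (piece χ n ψ m) p := fun N w => by
    have := DD_add (smooth_Pr hχ.bump h.smooth 1)
      (Smooth.finset_sum (Finset.range N) fun m _ => hχ.bump.smooth_piece (n := n) h.smooth m) w
    rw [DD_sum _ fun m _ => hχ.bump.smooth_piece (n := n) h.smooth m] at this
    exact this
  have t1 : 0 ≤ C₁ * A⁻¹ ^ 2 := by positivity
  have t2 : 0 ≤ C₂ * D * A⁻¹ ^ 2 := by positivity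
  have t3 : 0 ≤ C₃ * D * A⁻¹ ^ 2 := by positivity
  refine ⟨fun m p => (h1 h n m p).mono ?_ (by have := rr_pos m; positivity) le_rfl,
    fun N p w hw => ?_, fun N p w hw hw' => ?_, fun p w hw hw' => ?_⟩
  · have := rr_pos m
    gcongr
    have : 0 ≤ C₂ * D := by positivity
    have : 0 ≤ C₃ * D := by positivity
    linarith
  · have e1 := h2 h.smooth zero_lt_one (G := D * A⁻¹ ^ 2) (by positivity) (l := 3) (by norm_num)
      h.trd w (by omega) p
    rw [DD_sub h.smooth (smooth_Pr hχ.bump h.smooth 1), one_pow, mul_one] at e1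
    have e2 := (norm_sum_le _ _).trans (hs N p w (by omega))
    rw [Nat.sub_eq_zero_of_le hw, pow_zero, mul_one] at e2
    rw [happ]
    have : DD w (Pr χ 1 ψ) p + ∑ m ∈ Finset.range N, DD w (piece χ n ψ m) p - DD w ψ p
        = ∑ m ∈ Finset.range N, DD w (piece χ n ψ m) p - (DD w ψ p - DD w (Pr χ 1 ψ) p) := by abel
    rw [this]
    refine (norm_sub_le _ _).trans ((add_le_add e2 e1).trans ?_)
    linarith
  · have e1 := h3 h.smooth zero_lt_one (G := D * A⁻¹) (by positivity) (k := 2) (j := w.length - 2)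
      h.snd w (by omega) hw' p
    rw [inv_one, one_pow, mul_one] at e1
    have e2 := (norm_sum_le _ _).trans (hs N p w (by omega))
    rw [happ]
    have h4 : 1 ≤ (rr N)⁻¹ ^ (w.length - 2) := one_le_pow₀ (one_le_inv_rr N)
    refine (norm_add_le _ _).trans ((add_le_add e1 e2).trans ?_)
    calc C₃ * (D * A⁻¹) + 2 * (C₁ * A⁻¹ ^ 2) * (rr N)⁻¹ ^ (w.length - 2)
        ≤ C₃ * (D * A⁻¹) * (rr N)⁻¹ ^ (w.length - 2)
          + 2 * (C₁ * A⁻¹) * (rr N)⁻¹ ^ (w.length - 2) := by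
          exact add_le_add (le_mul_of_one_le_right (by positivity) h4) (by gcongr)
      _ = (2 * C₁ + C₃ * D) * A⁻¹ * (rr N)⁻¹ ^ (w.length - 2) := by ring
      _ ≤ _ := by
        gcongr
        have : 0 ≤ C₂ * D := by positivity
        linarith
  · have e1 := h3 h.smooth zero_lt_one (G := D * A⁻¹ ^ 2) (by positivity) (k := 3)
      (j := w.length - 3) h.trd w (by omega) hw' p
    rw [inv_one, one_pow, mul_one] at e1
    rw [happ]
    beta_reduce
    rw [Finset.sum_range_zero, add_zero]
    refine e1.trans ?_
    linarith

theorem norm_frame_sub_le {M A s : ℝ} {ψ ψ' : H → Vec} {p : H} (hs : 0 ≤ s)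
    (h1 : ∀ c, ‖M⁻¹ • (WD c ψ' p - WD c ψ p)‖ ≤ s)
    (h2 : ∀ c, ‖A • (WD c (WD c ψ') p - WD c (WD c ψ) p)‖ ≤ s) :
    ‖frame M A ψ' p - frame M A ψ p‖ ≤ s := by
  refine (pi_norm_le_iff_of_nonneg hs).2 fun i => ?_
  fin_cases i
  · simpa [frame, frameC, smul_sub] using h1 true
  · simpa [frame, frameC, smul_sub] using h1 false
  · simpa [frame, frameC, smul_sub] using h2 true
  · simpa [frame, frameC, smul_sub] using h2 false

theorem IsKernel.exists_frame_appr {χ : H → ℝ} (hχ : IsKernel 21 χ) {α : ℝ} (hα : 0 < α)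
    {D : ℝ} (hD : 1 ≤ D) {c : ℝ} (hc : 0 < c) : ∃ A₁ C : ℝ, 1 ≤ A₁ ∧ 0 ≤ C ∧
      ∀ {A M : ℝ} {ψ : H → Vec}, A₁ ≤ A → Adm α D c A M ψ → ∀ (n : Lat → ℕ) (N : ℕ) (p : H),
        Coer (c / 2) (frame M A (appr χ n ψ N) p) ∧
        SB (frame M A (appr χ n ψ N)) p C (rr N)⁻¹ 21 := by
  obtain ⟨C, hC, h⟩ := hχ.exists_norm_DD_appr_le hα (zero_le_one.trans hD)
  refine ⟨1 + ‖syn‖ * (C * D) * (2 / c), D + C * D, by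
    have : 0 ≤ ‖syn‖ * (C * D) * (2 / c) := by positivity
    linarith, by positivity, fun {A M ψ} hA had n N p => ?_⟩
  obtain ⟨-, ha, hb, -⟩ := h had n
  have hA1 := had.one_le
  have hM := had.pos
  have hMD := had.inv_le
  have hAi : A⁻¹ ≤ 1 := inv_le_one_of_one_le₀ hA1
  have hA0 : 0 < A := by linarith
  have hr := one_le_inv_rr N
  constructor
  · refine (had.coer p).of_norm_sub_le ?_
    have hd : ‖frame M A (appr χ n ψ N) p - frame M A ψ p‖ ≤ C * D * A⁻¹ := by
      refine norm_frame_sub_le (by positivity) (fun b => ?_) fun b => ?_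
      · rw [norm_smul, Real.norm_of_nonneg (by positivity)]
        have := ha N p [b] (by simp)
        calc M⁻¹ * ‖WD b (appr χ n ψ N) p - WD b ψ p‖ ≤ D * (C * A⁻¹ ^ 2) := by gcongr; exact this
          _ = C * D * A⁻¹ * A⁻¹ := by ring
          _ ≤ C * D * A⁻¹ := mul_le_of_le_one_right (by positivity) hAi
      · rw [norm_smul, Real.norm_of_nonneg (by positivity)]
        have := ha N p [b, b] (by simp)
        calc A * ‖WD b (WD b (appr χ n ψ N)) p - WD b (WD b ψ) p‖ ≤ A * (C * A⁻¹ ^ 2) := by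
              gcongr; exact this
          _ = C * A⁻¹ := by field_simp
          _ ≤ C * A⁻¹ * D := le_mul_of_one_le_right (by positivity) hD
          _ = C * D * A⁻¹ := by ring
    have h2 : ‖syn‖ * (C * D) ≤ c / 2 * A := by
      have : ‖syn‖ * (C * D) * (2 / c) ≤ A := by linarith
      calc ‖syn‖ * (C * D) = c / 2 * (‖syn‖ * (C * D) * (2 / c)) := by field_simp
        _ ≤ _ := by gcongr
    calc ‖syn‖ * ‖frame M A (appr χ n ψ N) p - frame M A ψ p‖ ≤ ‖syn‖ * (C * D * A⁻¹) := by gcongr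
      _ = ‖syn‖ * (C * D) * A⁻¹ := by ring
      _ ≤ c / 2 * A * A⁻¹ := by gcongr
      _ = c / 2 := by field_simp
  · have hMM : 1 ≤ D * M := by
      have : M⁻¹ * M ≤ D * M := by gcongr
      rwa [inv_mul_cancel₀ hM.ne'] at this
    refine SB.frame (hχ.bump.smooth_appr had.smooth N) (fun b w hw => ?_) (fun b w hw => ?_)
      hM.ne' hA0.ne'
    · rw [abs_of_pos (by positivity), inv_inv, ← DD_concat]
      rcases Nat.eq_zero_or_pos w.length with h0 | h0
      · rw [List.length_eq_zero_iff.1 h0, List.nil_append, List.length_nil, pow_zero, mul_one]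
        have e1 := ha N p [b] (by simp)
        have e2 := had.fst b p
        have e3 : DD [b] ψ p = WD b ψ p := rfl
        rw [e3] at e1
        have e4 : ‖DD [b] (appr χ n ψ N) p‖ ≤ ‖WD b ψ p‖ + C * A⁻¹ ^ 2 := by
          have := norm_sub_norm_le (DD [b] (appr χ n ψ N) p) (WD b ψ p)
          linarith
        have e5 : C * A⁻¹ ^ 2 ≤ C * (D * M) := by
          gcongr
          exact (pow_le_one₀ (by positivity) hAi).trans hMM
        linarith
      · refine (hb N p _ (by simp; omega) (by simp; omega)).trans ?_
        have e1 : (rr N)⁻¹ ^ ((w ++ [b]).length - 2) ≤ (rr N)⁻¹ ^ w.length := by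
          gcongr
          simp
        have e2 : C * A⁻¹ ≤ M * (D + C * D) := by
          have : C * A⁻¹ ≤ C * (D * M) := by gcongr; exact hAi.trans hMM
          have : 0 ≤ M * D := by positivity
          linarith
        have := rr_pos N
        gcongr
    · rw [abs_of_pos hA0, ← DD_concat, ← DD_concat]
      refine (hb N p _ (by simp) (by simp; omega)).trans ?_
      have e : ((w ++ [b]) ++ [b]).length - 2 = w.length := by simp
      rw [e]
      have := rr_pos N
      have : C ≤ D + C * D := by
        have := le_mul_of_one_le_right hC hD
        linarith
      calc C * A⁻¹ * (rr N)⁻¹ ^ w.length ≤ (D + C * D) * A⁻¹ * (rr N)⁻¹ ^ w.length := by gcongr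
        _ = _ := by ring

end Estimates

section Scheme

/-- One correction step of the iteration. -/
def incr (χ : H → ℝ) (n : Lat → ℕ) (M A : ℝ) (ψ φ : H → Vec) (m : ℕ) : H → Vec :=
  corr M A (appr χ n ψ (m + 1)) (stepA χ (rr m) φ (piece χ n ψ m))
    (stepB χ (rr m) φ (piece χ n ψ m))

/-- The corrected maps, orthogonal to the successive approximations of `ψ`. -/
def iter (χ : H → ℝ) (n : Lat → ℕ) (M A : ℝ) (ψ φ : H → Vec) : ℕ → H → Vec
  | 0 => φ
  | m + 1 => fun p => iter χ n M A ψ φ m p - incr χ n M A ψ (iter χ n M A ψ φ m) m p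

variable {χ : H → ℝ} {n : Lat → ℕ} {M A : ℝ} {ψ φ : H → Vec}

theorem iter_eq_sub_sum (m : ℕ) (p : H) : iter χ n M A ψ φ m p
    = φ p - ∑ j ∈ Finset.range m, incr χ n M A ψ (iter χ n M A ψ φ j) j p := by
  induction m with
  | zero => simp [iter]
  | succ m ih =>
    rw [iter]
    beta_reduce
    rw [ih, Finset.sum_range_succ]
    abel

/-- The defect in the exact transport of `φ · W ψ` under one step. -/
def defect (χ : H → ℝ) (n : Lat → ℕ) (ψ φ : H → Vec) (m : ℕ) (i : Bool) : H → ℝ := fun p =>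
  ⟪φ p, WD i (piece χ n ψ m) p⟫ - stepA χ (rr m) φ (piece χ n ψ m) i p

theorem inner_iter_succ {c : ℝ} (hc : 0 < c) (hM : M ≠ 0) (hχ : Bump χ) (hψ : Smooth ψ) (m : ℕ)
    (h : ∀ p, Coer c (frame M A (appr χ n ψ (m + 1)) p)) (i : Bool) (p : H) :
    ⟪iter χ n M A ψ φ (m + 1) p, WD i (appr χ n ψ (m + 1)) p⟫
      = ⟪iter χ n M A ψ φ m p, WD i (appr χ n ψ m) p⟫
        + defect χ n ψ (iter χ n M A ψ φ m) m i p := by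
  have h1 := inner_corr_fst (a := stepA χ (rr m) (iter χ n M A ψ φ m) (piece χ n ψ m))
    (b := stepB χ (rr m) (iter χ n M A ψ φ m) (piece χ n ψ m)) hM hc (h p) i
  rw [real_inner_comm] at h1
  rw [iter, inner_sub_left, incr, h1, appr_succ,
    congrFun (WD_add (hχ.smooth_appr hψ m) (hχ.smooth_piece hψ m) i) p, inner_add_right, defect]
  ring

theorem IsKernel.exists_iter_bounds (hχ : IsKernel 21 χ) {α : ℝ} (hα : 0 < α) {D : ℝ}
    (hD : 1 ≤ D) {c : ℝ} (hc : 0 < c) {B : ℝ} (hB : 0 ≤ B) :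
    ∃ A₁ C : ℝ, 1 ≤ A₁ ∧ 0 ≤ C ∧ ∀ {A M : ℝ} {ψ : H → Vec}, A₁ ≤ A → Adm α D c A M ψ →
      ∀ (n : Lat → ℕ) {φ : H → Vec}, Smooth φ →
      (∀ w : List Bool, w.length ≤ 21 → ∀ q, ‖DD w φ q‖ ≤ B) →
      (∀ i p, ⟪WD i φ p, WD i (appr χ n ψ 0) p⟫ = 0) → ∀ m,
      Smooth (iter χ n M A ψ φ m) ∧
      (∀ i p, ⟪WD i (iter χ n M A ψ φ m) p, WD i (appr χ n ψ m) p⟫ = 0) ∧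
      Smooth (incr χ n M A ψ (iter χ n M A ψ φ m) m) ∧
      (∀ p, SB (incr χ n M A ψ (iter χ n M A ψ φ m) m) p (C * A⁻¹ * rr m ^ α * rr m ^ 20)
        (rr m)⁻¹ 21) ∧
      (∀ i p, SB (defect χ n ψ (iter χ n M A ψ φ m) m i) p (C * A⁻¹ ^ 2 * rr m ^ 19)
        (rr m)⁻¹ 21) := by
  obtain ⟨Ca, hCa, ha⟩ := hχ.exists_norm_DD_appr_le hα (zero_le_one.trans hD)
  obtain ⟨A₁, Cf, hA₁, hCf, hf⟩ := hχ.exists_frame_appr hα hD hc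
  obtain ⟨K, hK, hr⟩ := exists_SB_rinv 21 Cf (half_pos hc)
  obtain ⟨Cs, hCs, hs⟩ := hχ.exists_SB_step (G := B + 1) (K := 2 ^ 21 * K) (by positivity)
  refine ⟨A₁ + D + 2 * (Cs * Ca), Cs * Ca, by
    have : 0 ≤ Cs * Ca := by positivity
    linarith, by positivity, fun {A M ψ} hA had n φ hφ hφB h0 => ?_⟩
  have hCC : 0 ≤ Cs * Ca := by positivity
  have hA1 := had.one_le
  have hApos : 0 < A := by linarith
  have hψ := had.smooth
  obtain ⟨hp, -⟩ := ha had n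
  have hco : ∀ N p, Coer (c / 2) (frame M A (appr χ n ψ N) p) := fun N p =>
    (hf (by linarith) had n N p).1
  have hrinv : ∀ m p, SB (fun p => rinv (frame M A (appr χ n ψ (m + 1)) p)) p (2 ^ 21 * K)
      (rr m)⁻¹ 21 := fun m p => by
    have hN := rr_pos m
    have e := hr (Smooth.frame (M := M) (A := A) (hχ.bump.smooth_appr (n := n) hψ (m + 1)))
      (hco (m + 1)) (p := p) (by have := rr_pos (m + 1); positivity) (hf (by linarith) had n (m + 1) p).2
    rw [inv_rr_succ] at e
    exact e.of_scale_two (by positivity)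
  have main : ∀ m, Smooth (iter χ n M A ψ φ m) →
      (∀ w : List Bool, w.length ≤ 21 → ∀ q, ‖DD w (iter χ n M A ψ φ m) q‖
        ≤ (B + 1) * (rr m)⁻¹ ^ (w.length - 2)) →
      Smooth (incr χ n M A ψ (iter χ n M A ψ φ m) m) ∧
      (∀ p, SB (incr χ n M A ψ (iter χ n M A ψ φ m) m) p (Cs * Ca * A⁻¹ * rr m ^ α * rr m ^ 20)
        (rr m)⁻¹ 21) ∧
      (∀ i p, SB (defect χ n ψ (iter χ n M A ψ φ m) m i) p (Cs * Ca * A⁻¹ ^ 2 * rr m ^ 19)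
        (rr m)⁻¹ 21) := fun m hm hb => by
    have hrm := rr_pos m
    have e := hs hA1 had.pos (by have := had.inv_le; linarith) hrm (rr_le_one m)
      (σ := Ca * A⁻¹ ^ 2 * rr m ^ α * rr m ^ 20) (by positivity) (half_pos hc) hm
      (hχ.bump.smooth_piece (n := n) hψ m) (hχ.bump.smooth_appr (n := n) hψ (m + 1)) hb
      (hp m) (hco (m + 1)) (hrinv m)
    refine ⟨Smooth.corr (hχ.bump.smooth_appr hψ _) (half_pos hc) (hco (m + 1))
      (hχ.bump.smooth_stepA hm (hχ.bump.smooth_piece hψ m))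
      (hχ.bump.smooth_stepB hm (hχ.bump.smooth_piece hψ m)), fun p => (e p).1.mono ?_
      (by positivity) le_rfl, fun i p => ((e p).2 i).mono ?_ (by positivity) le_rfl⟩
    · exact le_of_eq (by field_simp)
    · have : rr m ^ α ≤ 1 := rr_rpow_le_one m hα
      calc Cs * (Ca * A⁻¹ ^ 2 * rr m ^ α * rr m ^ 20) * (rr m)⁻¹
          = Cs * Ca * A⁻¹ ^ 2 * rr m ^ 19 * rr m ^ α := by field_simp
        _ ≤ Cs * Ca * A⁻¹ ^ 2 * rr m ^ 19 := mul_le_of_le_one_right (by positivity) this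
  have hbound : ∀ m, (∀ j < m, Smooth (incr χ n M A ψ (iter χ n M A ψ φ j) j) ∧
      (∀ p, SB (incr χ n M A ψ (iter χ n M A ψ φ j) j) p (Cs * Ca * A⁻¹ * rr j ^ α * rr j ^ 20)
        (rr j)⁻¹ 21)) → Smooth (iter χ n M A ψ φ m) ∧
      (∀ w : List Bool, w.length ≤ 21 → ∀ q, ‖DD w (iter χ n M A ψ φ m) q‖
        ≤ (B + 1) * (rr m)⁻¹ ^ (w.length - 2)) := fun m hj => by
    have heq : iter χ n M A ψ φ m = fun p => φ p - ∑ j ∈ Finset.range m,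
      incr χ n M A ψ (iter χ n M A ψ φ j) j p := funext (iter_eq_sub_sum m)
    have hsm : ∀ j ∈ Finset.range m, Smooth (incr χ n M A ψ (iter χ n M A ψ φ j) j) :=
      fun j hjm => (hj j (Finset.mem_range.1 hjm)).1
    have hsum : Smooth fun p => ∑ j ∈ Finset.range m, incr χ n M A ψ (iter χ n M A ψ φ j) j p :=
      Smooth.finset_sum _ hsm
    refine ⟨by rw [heq]; exact hφ.sub hsum, fun w hw q => ?_⟩
    rw [heq, DD_sub hφ hsum, DD_sum _ hsm]
    have h4 : 1 ≤ (rr m)⁻¹ ^ (w.length - 2) := one_le_pow₀ (one_le_inv_rr m)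
    have h5 : ∑ j ∈ Finset.range m, ‖DD w (incr χ n M A ψ (iter χ n M A ψ φ j) j) q‖
        ≤ 2 * (Cs * Ca * A⁻¹) * (rr m)⁻¹ ^ (w.length - 2) := by
      refine sum_norm_DD_le (by positivity) (k := 20) (by norm_num) (fun j hjm => ?_) w hw
      have hrj := rr_pos j
      refine ((hj j hjm).2 q).mono ?_ (by positivity) le_rfl
      have := rr_rpow_le_one j hα
      exact mul_le_mul_of_nonneg_right (mul_le_of_le_one_right (by positivity) this) (by positivity)
    have h6 : 2 * (Cs * Ca * A⁻¹) ≤ 1 := by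
      rw [show 2 * (Cs * Ca * A⁻¹) = (2 * (Cs * Ca)) / A by ring, div_le_one hApos]
      linarith
    calc _ ≤ ‖DD w φ q‖ + ‖∑ j ∈ Finset.range m, DD w (incr χ n M A ψ (iter χ n M A ψ φ j) j) q‖ :=
          norm_sub_le _ _
      _ ≤ B + 2 * (Cs * Ca * A⁻¹) * (rr m)⁻¹ ^ (w.length - 2) :=
          add_le_add (hφB w hw q) ((norm_sum_le _ _).trans h5)
      _ ≤ B * (rr m)⁻¹ ^ (w.length - 2) + 1 * (rr m)⁻¹ ^ (w.length - 2) :=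
          add_le_add (le_mul_of_one_le_right hB h4)
            (mul_le_mul_of_nonneg_right h6 (zero_le_one.trans h4))
      _ = _ := by ring
  have hall : ∀ m, Smooth (incr χ n M A ψ (iter χ n M A ψ φ m) m) ∧
      (∀ p, SB (incr χ n M A ψ (iter χ n M A ψ φ m) m) p (Cs * Ca * A⁻¹ * rr m ^ α * rr m ^ 20)
        (rr m)⁻¹ 21) ∧
      (∀ i p, SB (defect χ n ψ (iter χ n M A ψ φ m) m i) p (Cs * Ca * A⁻¹ ^ 2 * rr m ^ 19)
        (rr m)⁻¹ 21) := fun m => by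
    induction m using Nat.strong_induction_on with
    | _ m ih =>
      have e := hbound m fun j hj => ⟨(ih j hj).1, (ih j hj).2.1⟩
      exact main m e.1 e.2
  have hit : ∀ m, Smooth (iter χ n M A ψ φ m) := fun m =>
    (hbound m fun j _ => ⟨(hall j).1, (hall j).2.1⟩).1
  have horth : ∀ m i p, ⟪WD i (iter χ n M A ψ φ m) p, WD i (appr χ n ψ m) p⟫ = 0 := fun m => by
    induction m with
    | zero => exact h0
    | succ m ih =>
      intro i p
      have := inner_WD_sub_corr had.pos.ne' hApos.ne' (half_pos hc) (r := rr m) hχ.bump (hit m)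
        (hχ.bump.smooth_piece (n := n) hψ m) (hχ.bump.smooth_appr (n := n) hψ m)
        (by rw [← appr_succ]; exact hco (m + 1)) i p (ih i p)
      rw [← appr_succ] at this
      exact this
  exact fun m => ⟨hit m, horth m, hall m⟩

end Scheme

section Limit

theorem norm_sub_le_rpow {E : Type*} [NormedAddCommGroup E] [NormedSpace ℝ E] {f : H → E}
    (hf : Smooth f) {K α : ℝ} (h0 : 0 < α) (h1 : α < 1) (hK0 : ∀ p, ‖f p‖ ≤ K)
    (hK : ∀ b p, ‖WD b f p‖ ≤ K) (p q : H) : ‖f p - f q‖ ≤ 2 * K * ccDist p q ^ α := by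
  have hKn : 0 ≤ K := (norm_nonneg _).trans (hK0 p)
  have hd := ccDist_nonneg p q
  rcases le_total (ccDist p q) 1 with h | h
  · have h2 : ccDist p q ≤ ccDist p q ^ α := by
      rcases hd.eq_or_lt with h3 | h3
      · rw [← h3]; positivity
      · have := Real.rpow_le_rpow_of_exponent_ge h3 h h1.le
        rwa [Real.rpow_one] at this
    calc ‖f p - f q‖ ≤ K * ccDist p q := norm_sub_le_ccDist hf hK p q
      _ ≤ K * ccDist p q ^ α := by gcongr
      _ ≤ 2 * K * ccDist p q ^ α := by
        have := mul_nonneg hKn (Real.rpow_nonneg hd α)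
        linarith
  · have h2 : 1 ≤ ccDist p q ^ α := Real.one_le_rpow h h0.le
    calc ‖f p - f q‖ ≤ K + K := (norm_sub_le _ _).trans (add_le_add (hK0 p) (hK0 q))
      _ = 2 * K := by ring
      _ ≤ _ := le_mul_of_one_le_right (by positivity) h2

theorem frame_sub {M A : ℝ} {ψ θ : H → Vec} (hψ : Smooth ψ) (hθ : Smooth θ) (p : H) (i : Fin 4) :
    frame M A (fun p => ψ p - θ p) p i = frame M A ψ p i - frame M A θ p i := by
  have h1 : ∀ c, WD c (fun p => ψ p - θ p) = fun p => WD c ψ p - WD c θ p := fun c =>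
    WD_sub hψ hθ c
  have h2 : ∀ c, WD c (WD c (fun p => ψ p - θ p)) = fun p => WD c (WD c ψ) p - WD c (WD c θ) p :=
    fun c => by rw [h1, WD_sub (hψ.WD c) (hθ.WD c)]
  fin_cases i
  · change M⁻¹ • WD true (fun p => ψ p - θ p) p = M⁻¹ • WD true ψ p - M⁻¹ • WD true θ p
    rw [h1, smul_sub]
  · change M⁻¹ • WD false (fun p => ψ p - θ p) p = M⁻¹ • WD false ψ p - M⁻¹ • WD false θ p
    rw [h1, smul_sub]
  · change A • WD true (WD true (fun p => ψ p - θ p)) p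
      = A • WD true (WD true ψ) p - A • WD true (WD true θ) p
    rw [h2, smul_sub]
  · change A • WD false (WD false (fun p => ψ p - θ p)) p
      = A • WD false (WD false ψ) p - A • WD false (WD false θ) p
    rw [h2, smul_sub]

theorem inner_WD_of_frame {M A : ℝ} (hM : M ≠ 0) {ψ ψ' : H → Vec} {p : H} {e e' : Vec}
    (h : ∀ i, ⟪frame M A ψ p i, e⟫ = ⟪frame M A ψ' p i, e'⟫) (c : Bool) :
    ⟪e, WD c ψ p⟫ = ⟪e', WD c ψ' p⟫ := by
  cases c
  · have := h 1
    simp only [frame, frameC, Matrix.cons_val_one, Matrix.cons_val_zero, inner_smul_left] at this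
    rw [real_inner_comm, real_inner_comm (WD false ψ' p)]
    exact mul_left_cancel₀ (by simpa using hM) this
  · have := h 0
    simp only [frame, frameC, Matrix.cons_val_zero, inner_smul_left] at this
    rw [real_inner_comm, real_inner_comm (WD true ψ' p)]
    exact mul_left_cancel₀ (by simpa using hM) this

theorem inner_WD_WD_of_frame {M A : ℝ} (hA : A ≠ 0) {ψ ψ' : H → Vec} {p : H} {e e' : Vec}
    (h : ∀ i, ⟪frame M A ψ p i, e⟫ = ⟪frame M A ψ' p i, e'⟫) (c : Bool) :
    ⟪e, WD c (WD c ψ) p⟫ = ⟪e', WD c (WD c ψ') p⟫ := by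
  cases c
  · have := h 3
    change ⟪A • WD false (WD false ψ) p, e⟫ = ⟪A • WD false (WD false ψ') p, e'⟫ at this
    simp only [inner_smul_left] at this
    rw [real_inner_comm, real_inner_comm (WD false (WD false ψ') p)]
    exact mul_left_cancel₀ (by simpa using hA) this
  · have := h 2
    change ⟪A • WD true (WD true ψ) p, e⟫ = ⟪A • WD true (WD true ψ') p, e'⟫ at this
    simp only [inner_smul_left] at this
    rw [real_inner_comm, real_inner_comm (WD true (WD true ψ') p)]
    exact mul_left_cancel₀ (by simpa using hA) this

/-- The base map can be approximated so well that the remaining error is absorbed by a small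
pointwise linear correction. -/
theorem exists_absorb {χ : H → ℝ} (hχ : Bump χ) (h1 : ∫ g, χ g = 1) {ψ : H → Vec} (hψ : Smooth ψ)
    {M A c : ℝ} (hM : 0 < M) (hA : 0 < A) (hc : 0 < c) (hco : ∀ p, Coer c (frame M A ψ p)) :
    ∃ (n : Lat → ℕ) (T : H → Vec →L[ℝ] Vec), Smooth T ∧ (∀ p, SB T p A⁻¹ 1 21) ∧
      ∀ p i e, ⟪frame M A ψ p i, e + T p e⟫
        = ⟪frame M A (fun p => ψ p - rest χ n ψ p) p i, e⟫ := by
  have hR := (Smooth.frame (M := M) (A := A) hψ).rinv hc hco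
  set W : Finset (List Bool) := (List.finite_length_le Bool 21).toFinset with hW
  set R : H → ℝ := fun p => ∑ w ∈ W, ‖DD w (fun p => rinv (frame M A ψ p)) p‖ with hRdef
  have hRc : Continuous R := continuous_finsetSum _ fun w _ => (hR.DD w).continuous.norm
  have hR0 : ∀ p, 0 ≤ R p := fun p => Finset.sum_nonneg fun _ _ => norm_nonneg _
  have hRS : ∀ p, SB (fun p => rinv (frame M A ψ p)) p (R p) 1 21 := fun p w hw => by
    rw [one_pow, mul_one]
    exact Finset.single_le_sum (f := fun w => ‖DD w (fun p => rinv (frame M A ψ p)) p‖)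
      (fun _ _ => norm_nonneg _) (by simpa [hW] using hw)
  set s : H → ℝ := fun p => A⁻¹ * ((2 ^ 21 * (1 + R p) * (1 + ‖ana‖)))⁻¹ with hs
  have hden : ∀ p, 0 < 2 ^ 21 * (1 + R p) * (1 + ‖ana‖) := fun p => by
    have := hR0 p
    positivity
  have hs0 : ∀ p, 0 < s p := fun p => mul_pos (by positivity) (inv_pos.2 (hden p))
  have hsc : Continuous s := continuous_const.mul
    (((continuous_const.mul (continuous_const.add hRc)).mul continuous_const).inv₀
      fun p => (hden p).ne')
  obtain ⟨n, hn⟩ := exists_SB_rest hχ h1 hψ 23 (L := fun p => min M A⁻¹ * s p)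
    (continuous_const.mul hsc) fun p => mul_pos (lt_min hM (by positivity)) (hs0 p)
  have hθ : Smooth (rest χ n ψ) := hχ.smooth_rest hψ
  have hF : ∀ p, SB (frame M A (rest χ n ψ)) p (s p) 1 21 := fun p => by
    refine SB.frame hθ (fun b => ?_) (fun b => ?_) hM.ne' hA.ne'
    · refine ((hn p).WD b).mono ?_ zero_le_one (by norm_num)
      rw [abs_of_pos (by positivity), inv_inv, mul_one]
      exact mul_le_mul_of_nonneg_right (min_le_left _ _) (hs0 p).le
    · refine (((hn p).WD b).WD b).mono ?_ zero_le_one (by norm_num)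
      rw [abs_of_pos hA, mul_one, mul_one]
      exact mul_le_mul_of_nonneg_right (min_le_right _ _) (hs0 p).le
  have hana : Smooth fun p => ana (frame M A (rest χ n ψ) p) := (Smooth.frame hθ).ana
  have hcomp : Smooth fun p => (rinv (frame M A ψ p)).comp (ana (frame M A (rest χ n ψ) p)) :=
    ContDiff.clm_comp hR hana
  refine ⟨n, fun p => -(rinv (frame M A ψ p)).comp (ana (frame M A (rest χ n ψ) p)), hcomp.neg,
    fun p => ?_, fun p i e => ?_⟩
  · have e1 := SB.clm_comp hR hana zero_le_one (hRS p) ((hF p).clm ana (Smooth.frame hθ))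
    refine (SB.neg e1).mono ?_ zero_le_one le_rfl
    have h3 := hR0 p
    have h4 := hs0 p
    calc 2 ^ 21 * R p * (‖ana‖ * s p) ≤ 2 ^ 21 * (1 + R p) * ((1 + ‖ana‖) * s p) := by
          gcongr <;> linarith
      _ = A⁻¹ := by
        have := (hden p).ne'
        rw [hs]
        field_simp
  · rw [frame_sub hψ hθ, inner_add_right, inner_sub_left]
    have := (hco p).inner_rinv hc (ana (frame M A (rest χ n ψ) p) e) i
    rw [ana_apply] at this
    change _ + ⟪frame M A ψ p i, -rinv (frame M A ψ p) (ana (frame M A (rest χ n ψ) p) e)⟫ = _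
    rw [inner_neg_right, this]
    ring

variable {χ : H → ℝ} {n : Lat → ℕ} {M A : ℝ} {ψ φ : H → Vec}

theorem incr_eventually_eq_zero {p : H} {m : ℕ} (h : ∀ᶠ q in nhds p, piece χ n ψ m q = 0) :
    incr χ n M A ψ φ m p = 0 := by
  have h0 : piece χ n ψ m =ᶠ[nhds p] fun _ => 0 := h
  have e0 : piece χ n ψ m p = 0 := h.self_of_nhds
  have e1 : ∀ c, WD c (piece χ n ψ m) p = 0 := fun c => by
    have := (DD_congr_of_eventuallyEq h0 [c]).self_of_nhds
    rwa [DD_zero] at this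
  have e2 : ∀ c, WD c (WD c (piece χ n ψ m)) p = 0 := fun c => by
    have := (DD_congr_of_eventuallyEq h0 [c, c]).self_of_nhds
    rwa [DD_zero] at this
  have ea : ∀ c, stepA χ (rr m) φ (piece χ n ψ m) c p = 0 := fun c => by
    rw [stepA, e0, e1, inner_zero_right, inner_zero_right, add_zero]
  have eb : ∀ c, stepB χ (rr m) φ (piece χ n ψ m) c p = 0 := fun c => by
    rw [stepB, e0, e2, inner_zero_right, inner_zero_right, add_zero]
  rw [incr, corr, ea, ea, eb, eb]
  have : (![M⁻¹ * 0, M⁻¹ * 0, A * 0, A * 0] : Fin 4 → ℝ) = 0 := by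
    funext i
    fin_cases i <;> simp
  rw [this, map_zero, map_zero]

/-- Near each point the iteration becomes stationary. -/
theorem IsKernel.exists_stationary {k : ℕ} (hχ : IsKernel k χ) (hψ : Smooth ψ) (p : H) :
    ∃ N : ℕ, ∀ᶠ q in nhds p, ∀ m, N ≤ m → appr χ n ψ m q = ψ q - rest χ n ψ q ∧
      ∀ (M A : ℝ) (φ : H → Vec), incr χ n M A ψ φ m q = 0 := by
  obtain ⟨N, hN⟩ := (LF_piece (χ := χ) (n := n) (ψ := ψ)).exists_nat p
  refine ⟨N, hN.eventually_nhds.mono fun q hq m hm => ⟨?_, fun M A φ => ?_⟩⟩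
  · rw [← sub_lsum_piece hχ hψ q, lsum_nat_eq_sum_range (n := m)
      fun i hi => hq.self_of_nhds i (hm.trans hi), appr]
    abel
  · exact incr_eventually_eq_zero (hq.mono fun x hx => hx m hm)

end Limit

section Correction

variable {χ : H → ℝ} {n : Lat → ℕ} {M A : ℝ} {ψ φ : H → Vec}

theorem inner_iter_eq {c : ℝ} (hc : 0 < c) (hM : M ≠ 0) (hχ : Bump χ) (hψ : Smooth ψ)
    (h : ∀ m p, Coer c (frame M A (appr χ n ψ m) p)) (i : Bool)
    (h0 : ∀ p, ⟪φ p, WD i (appr χ n ψ 0) p⟫ = 0) (m : ℕ) (p : H) :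
    ⟪iter χ n M A ψ φ m p, WD i (appr χ n ψ m) p⟫
      = ∑ j ∈ Finset.range m, defect χ n ψ (iter χ n M A ψ φ j) j i p := by
  induction m with
  | zero => simpa [iter] using h0 p
  | succ m ih => rw [inner_iter_succ hc hM hχ hψ m (h (m + 1)), ih, Finset.sum_range_succ]

theorem smooth_defect (hχ : Bump χ) (hψ : Smooth ψ) (hφ : Smooth φ) (m : ℕ) (i : Bool) :
    Smooth (defect χ n ψ φ m i) :=
  (Smooth.inner hφ ((hχ.smooth_piece hψ m).WD i)).sub
    (hχ.smooth_stepA hφ (hχ.smooth_piece hψ m) i)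

/-- Limit of the iteration. -/
theorem exists_limit {k : ℕ} (hχ : IsKernel k χ) (hψ : Smooth ψ) (hφ : Smooth φ)
    (hi : ∀ m, Smooth (incr χ n M A ψ (iter χ n M A ψ φ m) m))
    (h0 : ∀ m i p, ⟪WD i (iter χ n M A ψ φ m) p, WD i (appr χ n ψ m) p⟫ = 0) :
    ∃ φ' : H → Vec, Smooth φ' ∧
      (∀ p i, ⟪WD i φ' p, WD i (fun p => ψ p - rest χ n ψ p) p⟫ = 0) ∧
      ∀ p, ∃ N, ∀ᶠ q in nhds p, ∀ m, N ≤ m → φ' q = iter χ n M A ψ φ m q ∧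
        ψ q - rest χ n ψ q = appr χ n ψ m q := by
  set η : ℕ → H → Vec := fun m => incr χ n M A ψ (iter χ n M A ψ φ m) m with hη
  have hLF : LF η := fun p => by
    obtain ⟨N, hN⟩ := hχ.exists_stationary (n := n) hψ p
    exact ⟨Finset.range N, hN.mono fun q hq m hm => (hq m (by simpa using hm)).2 M A _⟩
  have hev : ∀ p, ∃ N, ∀ᶠ q in nhds p, ∀ m, N ≤ m →
      φ q - lsum η q = iter χ n M A ψ φ m q ∧ ψ q - rest χ n ψ q = appr χ n ψ m q := fun p => by
    obtain ⟨N, hN⟩ := hχ.exists_stationary (n := n) hψ p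
    refine ⟨N, hN.mono fun q hq m hm => ⟨?_, (hq m hm).1.symm⟩⟩
    rw [iter_eq_sub_sum, lsum_nat_eq_sum_range fun j hj => (hq j (hm.trans hj)).2 M A _]
  refine ⟨fun p => φ p - lsum η p, hφ.sub (hLF.smooth hi), fun p i => ?_, hev⟩
  obtain ⟨N, hN⟩ := hev p
  have e1 : (fun p => φ p - lsum η p) =ᶠ[nhds p] iter χ n M A ψ φ N :=
    hN.mono fun q hq => (hq N le_rfl).1
  have e2 : (fun p => ψ p - rest χ n ψ p) =ᶠ[nhds p] appr χ n ψ N :=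
    hN.mono fun q hq => (hq N le_rfl).2
  rw [(WD_congr_of_eventuallyEq e1 i).self_of_nhds, (WD_congr_of_eventuallyEq e2 i).self_of_nhds]
  exact h0 N i p

theorem inner_WD_eq_zero_of_frame {A M : ℝ} (hA : A ≠ 0) (hM : M ≠ 0) {φ φ' ψ ψ' : H → Vec}
    (hφ : Smooth φ) (hφ' : Smooth φ') (hψ : Smooth ψ) (hψ' : Smooth ψ')
    (h : ∀ p i, ⟪frame M A ψ p i, φ p⟫ = ⟪frame M A ψ' p i, φ' p⟫) {i : Bool} {p : H}
    (h0 : ⟪WD i φ' p, WD i ψ' p⟫ = 0) : ⟪WD i φ p, WD i ψ p⟫ = 0 := by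
  have e : (fun p => ⟪φ p, WD i ψ p⟫) = fun p => ⟪φ' p, WD i ψ' p⟫ :=
    funext fun p => inner_WD_of_frame hM (h p) i
  rw [inner_WD_WD hφ hψ, e, inner_WD_WD_of_frame hA (h p) i, ← inner_WD_WD hφ' hψ', h0]

theorem exists_correction {α : ℝ} (hα : 0 < α) (hα1 : α < 1) {D : ℝ} (hD : 1 ≤ D) {c : ℝ}
    (hc : 0 < c) {B : ℝ} (hB : 0 ≤ B) : ∃ A₁ C : ℝ, 1 ≤ A₁ ∧ 0 ≤ C ∧
    ∀ {A M : ℝ} {ψ : H → Vec}, A₁ ≤ A → Adm α D c A M ψ → ∃ ψ₀ : H → Vec, Smooth ψ₀ ∧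
      (∀ p, Coer (c / 2) (frame M A ψ₀ p)) ∧ (∀ p, SB (frame M A ψ₀) p C 1 21) ∧
      (∀ p, ∀ w : List Bool, w.length ≤ 2 → ‖DD w ψ₀ p - DD w ψ p‖ ≤ C * A⁻¹ ^ 2) ∧
      (∀ p, ∀ w : List Bool, 2 ≤ w.length → w.length ≤ 23 → ‖DD w ψ₀ p‖ ≤ C * A⁻¹) ∧
      (∀ p, ∀ w : List Bool, 3 ≤ w.length → w.length ≤ 23 → ‖DD w ψ₀ p‖ ≤ C * A⁻¹ ^ 2) ∧
      ∀ {φ₀ : H → Vec}, Smooth φ₀ → (∀ w : List Bool, w.length ≤ 21 → ∀ q, ‖DD w φ₀ q‖ ≤ B) →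
        (∀ p i, ⟪frame M A ψ₀ p i, φ₀ p⟫ = 0) → ∃ φ : H → Vec, Smooth φ ∧
          (∀ i p, ⟪WD i φ p, WD i ψ p⟫ = 0) ∧
          (∀ w : List Bool, w.length ≤ 20 → ∀ p, ‖DD w φ p - DD w φ₀ p‖ ≤ C * A⁻¹) ∧
          (∀ w : List Bool, w.length = 20 → ∀ p q, ‖(DD w φ p - DD w φ₀ p) - (DD w φ q - DD w φ₀ q)‖
            ≤ C * A⁻¹ * ccDist p q ^ α) ∧
          (∀ i, ∀ w : List Bool, w.length ≤ 2 → ∀ p,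
            ‖DD w (fun p => ⟪φ p, WD i ψ p⟫) p‖ ≤ C * A⁻¹) := by
  obtain ⟨χ, hb, hInt, hord⟩ := exists_kernel 20
  have hχ : IsKernel 21 χ := ⟨hb, hInt, hord⟩
  have hD0 : 0 ≤ D := zero_le_one.trans hD
  obtain ⟨Ca, hCa, ha⟩ := hχ.exists_norm_DD_appr_le hα hD0
  obtain ⟨A₁, Cf, hA₁, hCf, hf⟩ := hχ.exists_frame_appr hα hD hc
  obtain ⟨A₂, Ci, hA₂, hCi, hi⟩ := hχ.exists_iter_bounds hα hD hc hB
  obtain ⟨Ch, hCh, hh⟩ := exists_holder_sum (E := Vec) hα hα1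
  set S : ℝ := Ci * (1 + 2 ^ 21) with hS
  have hS0 : 0 ≤ S := by positivity
  refine ⟨A₁ + A₂, Ca + Cf + 2 * Ci + (2 * (2 ^ 21 * B) + Ch * S), by linarith, by positivity,
    fun {A M ψ} hA had => ?_⟩
  have hA1 := had.one_le
  have hApos : 0 < A := by linarith
  have hAi0 : 0 ≤ A⁻¹ := by positivity
  have hAi : A⁻¹ ≤ 1 := inv_le_one_of_one_le₀ hA1
  have hAi2 : A⁻¹ ^ 2 ≤ A⁻¹ := by nlinarith
  have hψ := had.smooth
  have hMpos := had.pos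
  obtain ⟨n, T, hT, hTS, hTi⟩ := exists_absorb hb hInt hψ hMpos hApos hc had.coer
  obtain ⟨-, ha1, ha2, ha3⟩ := ha had n
  have hfr : ∀ m p, Coer (c / 2) (frame M A (appr χ n ψ m) p) :=
    fun m p => (hf (by linarith) had n m p).1
  have hSB : 0 ≤ 2 * (2 ^ 21 * B) + Ch * S := by positivity
  refine ⟨appr χ n ψ 0, hb.smooth_appr hψ 0, hfr 0, fun p => ?_, fun p w hw => ?_,
    fun p w hw hw' => ?_, fun p w hw hw' => ?_, fun {φ₀} hφ₀ hφB hφo => ?_⟩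
  · have := (hf (by linarith) had n 0 p).2
    rw [rr, pow_zero, inv_one] at this
    exact this.mono (by linarith) zero_le_one le_rfl
  · refine (ha1 0 p w hw).trans ?_
    gcongr
    linarith
  · refine (ha2 0 p w hw hw').trans ?_
    rw [rr, pow_zero, inv_one, one_pow, mul_one]
    gcongr
    linarith
  · refine (ha3 p w hw hw').trans ?_
    gcongr
    linarith
  have hψ0 : Smooth (appr χ n ψ 0) := hb.smooth_appr hψ 0
  have hz : ∀ p i, ⟪frame M A (appr χ n ψ 0) p i, φ₀ p⟫
      = ⟪frame M A (appr χ n ψ 0) p i, (0 : Vec)⟫ := fun p i => by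
    rw [hφo, inner_zero_right]
  have ho1 : ∀ i p, ⟪φ₀ p, WD i (appr χ n ψ 0) p⟫ = 0 := fun i p => by
    rw [inner_WD_of_frame hMpos.ne' (hz p) i, inner_zero_left]
  have ho : ∀ i p, ⟪WD i φ₀ p, WD i (appr χ n ψ 0) p⟫ = 0 := fun i p => by
    have e : (fun p => ⟪φ₀ p, WD i (appr χ n ψ 0) p⟫) = fun _ => 0 := funext (ho1 i)
    have e' : WD i (fun _ : H => (0 : ℝ)) = fun _ => 0 := by
      have := DD_zero (E := ℝ) [i]
      exact this
    rw [inner_WD_WD hφ₀ hψ0, e, e', inner_WD_WD_of_frame hApos.ne' (hz p) i, inner_zero_left,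
      sub_zero]
  have hit := hi (by linarith : A₂ ≤ A) had n hφ₀ hφB ho
  obtain ⟨φ', hφ', horth, hev⟩ := exists_limit hχ hψ hφ₀ (fun m => (hit m).2.2.1)
    fun m => (hit m).2.1
  have hθ : Smooth (rest χ n ψ) := hb.smooth_rest hψ
  have hTφ' : Smooth fun p => T p (φ' p) := ContDiff.clm_apply hT hφ'
  have hTφ₀ : Smooth fun p => T p (φ₀ p) := ContDiff.clm_apply hT hφ₀
  have hφ : Smooth fun p => φ' p + T p (φ' p) := hφ'.add hTφ'
  set η : ℕ → H → Vec := fun m => incr χ n M A ψ (iter χ n M A ψ φ₀ m) m with hη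
  have hηs : ∀ m, Smooth (η m) := fun m => (hit m).2.2.1
  have hTη : ∀ m, Smooth fun p => T p (η m p) := fun m => ContDiff.clm_apply hT (hηs m)
  set g : ℕ → H → Vec := fun m p => η m p + T p (η m p) with hg
  have hgs : ∀ m, Smooth (g m) := fun m => (hηs m).add (hTη m)
  have hgb : ∀ m (w : List Bool), w.length ≤ 20 + 1 → ∀ p,
      ‖DD w (g m) p‖ ≤ S * A⁻¹ * ((rr m)⁻¹ ^ w.length * rr m ^ 20 * rr m ^ α) :=
    fun m w hw p => by
      have hr := rr_pos m
      have e1 := (hit m).2.2.2.1 p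
      have e2 := SB.apply hT (hηs m) (by positivity)
        ((hTS p).mono_scale hAi0 zero_le_one (one_le_inv_rr m)) e1
      refine ((e1.add (hηs m) (hTη m) e2) w hw).trans ?_
      have h3 : 2 ^ 21 * A⁻¹ * (Ci * A⁻¹ * rr m ^ α * rr m ^ 20)
          ≤ 2 ^ 21 * 1 * (Ci * A⁻¹ * rr m ^ α * rr m ^ 20) := by gcongr
      calc _ ≤ (Ci * A⁻¹ * rr m ^ α * rr m ^ 20 + 2 ^ 21 * 1 * (Ci * A⁻¹ * rr m ^ α * rr m ^ 20))
            * (rr m)⁻¹ ^ w.length := by gcongr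
        _ = _ := by rw [hS]; ring
  have hdiff : ∀ p, ∃ N, ∀ m, N ≤ m → ∀ w : List Bool,
      DD w (fun p => φ' p + T p (φ' p)) p - DD w φ₀ p
        = DD w (fun p => T p (φ₀ p)) p - ∑ j ∈ Finset.range m, DD w (g j) p := fun p => by
    obtain ⟨N, hN⟩ := hev p
    refine ⟨N, fun m hm w => ?_⟩
    have hgsum : Smooth fun p => ∑ j ∈ Finset.range m, g j p := Smooth.finset_sum _ fun j _ => hgs j
    have e : (fun p => φ' p + T p (φ' p)) =ᶠ[nhds p]
        fun p => φ₀ p + (T p (φ₀ p) - ∑ j ∈ Finset.range m, g j p) := hN.mono fun q hq => by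
      have h5 : φ' q = φ₀ q - ∑ j ∈ Finset.range m, η j q := by
        rw [(hq m hm).1, iter_eq_sub_sum]
      beta_reduce
      rw [h5, map_sub, map_sum]
      simp only [hg, Finset.sum_add_distrib]
      abel
    rw [(DD_congr_of_eventuallyEq e w).self_of_nhds, DD_add hφ₀ (hTφ₀.sub hgsum),
      DD_sub hTφ₀ hgsum, DD_sum _ fun j _ => hgs j]
    exact add_sub_cancel_left _ _
  have hTb : ∀ w : List Bool, w.length ≤ 21 → ∀ p,
      ‖DD w (fun p => T p (φ₀ p)) p‖ ≤ 2 ^ 21 * B * A⁻¹ := fun w hw p => by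
    have e1 : SB φ₀ p B 1 21 := fun w hw => by rw [one_pow, mul_one]; exact hφB w hw p
    have e2 := SB.apply hT hφ₀ zero_le_one (hTS p) e1 w hw
    rw [one_pow, mul_one] at e2
    exact e2.trans (le_of_eq (by ring))
  have hsum := fun m => hh (k := 20) (s := S * A⁻¹) (by positivity) hgs hgb m
  refine ⟨fun p => φ' p + T p (φ' p), hφ, fun i p => ?_, fun w hw p => ?_, fun w hw p q => ?_,
    fun i w hw p => ?_⟩
  · exact inner_WD_eq_zero_of_frame hApos.ne' hMpos.ne' hφ hφ' hψ (hψ.sub hθ)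
      (fun p i => hTi p i (φ' p)) (horth p i)
  · obtain ⟨N, hN⟩ := hdiff p
    rw [hN N le_rfl]
    refine (norm_sub_le _ _).trans ((add_le_add (hTb w (by omega) p)
      ((norm_sum_le _ _).trans ((hsum N).1 w hw p))).trans ?_)
    have : 0 ≤ (Ca + Cf + 2 * Ci + 2 ^ 21 * B) * A⁻¹ := by positivity
    linarith
  · obtain ⟨N, hN⟩ := hdiff p
    obtain ⟨N', hN'⟩ := hdiff q
    rw [hN (max N N') (le_max_left _ _), hN' (max N N') (le_max_right _ _)]
    have e1 := norm_sub_le_rpow (hTφ₀.DD w) hα hα1 (hTb w (by omega))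
      (fun b p => hTb (b :: w) (by simp [hw]) p) p q
    have e2 := (norm_sum_le _ _).trans ((hsum (max N N')).2 w hw p q)
    rw [Finset.sum_sub_distrib] at e2
    have hd : 0 ≤ ccDist p q ^ α := Real.rpow_nonneg (ccDist_nonneg p q) α
    rw [sub_sub_sub_comm]
    refine (norm_sub_le _ _).trans ((add_le_add e1 e2).trans ?_)
    have : 0 ≤ (Ca + Cf + 2 * Ci) * A⁻¹ * ccDist p q ^ α := by positivity
    linarith
  · obtain ⟨N, hN⟩ := hev p
    have e : (fun p => ⟪φ' p + T p (φ' p), WD i ψ p⟫) =ᶠ[nhds p]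
        fun p => ∑ j ∈ Finset.range N, defect χ n ψ (iter χ n M A ψ φ₀ j) j i p := by
      filter_upwards [hN.eventually_nhds] with q hq
      rw [inner_WD_of_frame hMpos.ne' (fun i => hTi q i (φ' q)) i,
        ← inner_iter_eq (half_pos hc) hMpos.ne' hb hψ hfr i (ho1 i) N q]
      have e1 : (fun p => ψ p - rest χ n ψ p) =ᶠ[nhds q] appr χ n ψ N :=
        hq.mono fun x hx => (hx N le_rfl).2
      rw [(WD_congr_of_eventuallyEq e1 i).self_of_nhds, (hq.self_of_nhds N le_rfl).1]
    rw [(DD_congr_of_eventuallyEq e w).self_of_nhds,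
      DD_sum _ fun j _ => smooth_defect hb hψ (hit j).1 j i]
    refine (norm_sum_le _ _).trans ((sum_norm_DD_le (s := Ci * A⁻¹ ^ 2) (by positivity) (k := 19)
      le_rfl (fun j _ => (hit j).2.2.2.2 i p) w (by omega)).trans ?_)
    rw [Nat.sub_eq_zero_of_le hw, pow_zero, mul_one]
    have h6 : 0 ≤ (Ca + Cf + (2 * (2 ^ 21 * B) + Ch * S)) * A⁻¹ := by positivity
    have h7 : Ci * A⁻¹ ^ 2 ≤ Ci * A⁻¹ := by gcongr
    linarith

end Correction

section Jet

variable {E : Type*} [NormedAddCommGroup E] [NormedSpace ℝ E]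

/-- The derivatives `Xf, Yf, Zf, XXf, YYf, XYf`. -/
def jet (f : H → E) (p : H) : Fin 6 → E :=
  ![DD [true] f p, DD [false] f p, DD [false, true] f p - DD [true, false] f p,
    DD [true, true] f p, DD [false, false] f p, DD [true, false] f p]

abbrev V6 : Type := EuclideanSpace ℝ (Fin 6)

theorem jet_of_DD_sum {ι : Type*} {s : Finset ι} {f : H → E} {p : H} {g : H → V6}
    {q : ι → H} {L : ι → V6 →L[ℝ] E} (h : ∀ w, DD w f p = ∑ a ∈ s, L a (DD w g (q a)))
    (i : Fin 6) : jet f p i = ∑ a ∈ s, L a (jet g (q a) i) := by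
  fin_cases i <;> simp [jet, h, Finset.sum_sub_distrib]

theorem jet_congr {f g : H → E} {p : H} (h : f =ᶠ[nhds p] g) : jet f p = jet g p := by
  have := fun w => (DD_congr_of_eventuallyEq h w).self_of_nhds
  simp only [jet, this]

theorem jet_clm {F : Type*} [NormedAddCommGroup F] [NormedSpace ℝ F] (L : E →L[ℝ] F) {f : H → E}
    (hf : Smooth f) (p : H) (i : Fin 6) : jet (fun p => L (f p)) p i = L (jet f p i) := by
  fin_cases i <;> simp [jet, DD_clm L hf]

theorem smooth_jet {f : H → E} (hf : Smooth f) (i : Fin 6) : Smooth fun p => jet f p i := by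
  fin_cases i
  exacts [hf.DD _, hf.DD _, (hf.DD _).sub (hf.DD _), hf.DD _, hf.DD _, hf.DD _]

/-- The monomials `x, y, z, x²/2, y²/2, xy`. -/
def mon (p : H) : Fin 6 → ℝ :=
  ![p.1, p.2.1, p.2.2, p.1 ^ 2 / 2, p.2.1 ^ 2 / 2, p.1 * p.2.1]

theorem smooth_mon (i : Fin 6) : Smooth fun p => mon p i := by
  unfold Smooth
  fin_cases i <;> simp only [mon] <;> simp <;> fun_prop

theorem WD_of_hasFDerivAt {f : H → ℝ} {f' : H → H →L[ℝ] ℝ} (h : ∀ p, HasFDerivAt f (f' p) p)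
    (b : Bool) : WD b f = fun p => f' p (vf b p) :=
  funext fun p => by rw [WD_apply, (h p).fderiv]

theorem WD_fst (b : Bool) : WD b (fun p : H => p.1) = fun p => (vf b p).1 :=
  WD_of_hasFDerivAt (fun _ => hasFDerivAt_fst) b

theorem WD_snd_fst (b : Bool) : WD b (fun p : H => p.2.1) = fun p => (vf b p).2.1 :=
  WD_of_hasFDerivAt (f' := fun _ => (ContinuousLinearMap.fst ℝ ℝ ℝ).comp
    (ContinuousLinearMap.snd ℝ ℝ (ℝ × ℝ))) (fun _ => ContinuousLinearMap.hasFDerivAt _) b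

theorem WD_snd_snd (b : Bool) : WD b (fun p : H => p.2.2) = fun p => (vf b p).2.2 :=
  WD_of_hasFDerivAt (f' := fun _ => (ContinuousLinearMap.snd ℝ ℝ ℝ).comp
    (ContinuousLinearMap.snd ℝ ℝ (ℝ × ℝ))) (fun _ => ContinuousLinearMap.hasFDerivAt _) b

theorem WD_fst_sq (b : Bool) :
    WD b (fun p : H => p.1 ^ 2 / 2) = fun p => p.1 * (vf b p).1 := by
  refine (WD_of_hasFDerivAt (fun p => ((hasFDerivAt_fst (p := p)).pow 2).mul_const 2⁻¹) b).trans ?_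
  funext p
  simp
  ring

theorem WD_snd_sq (b : Bool) :
    WD b (fun p : H => p.2.1 ^ 2 / 2) = fun p => p.2.1 * (vf b p).2.1 := by
  refine (WD_of_hasFDerivAt (fun p => (((hasFDerivAt_fst (p := p.2)).comp p
    hasFDerivAt_snd).pow 2).mul_const 2⁻¹) b).trans ?_
  funext p
  simp
  ring

theorem WD_fst_mul (b : Bool) :
    WD b (fun p : H => p.1 * p.2.1) = fun p => p.1 * (vf b p).2.1 + (vf b p).1 * p.2.1 := by
  refine (WD_of_hasFDerivAt (fun p => (hasFDerivAt_fst (p := p)).mul ((hasFDerivAt_fst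
    (p := p.2)).comp p hasFDerivAt_snd)) b).trans ?_
  funext p
  simp
  ring

theorem WD_const' (b : Bool) (c : ℝ) : WD b (fun _ : H => c) = fun _ => 0 :=
  WD_of_hasFDerivAt (fun p => hasFDerivAt_const c p) b

theorem jet_mon_sum (p : H) (l : V6) (h : ∀ i, ∑ j, l j * jet (fun p => mon p i) p j = 0) :
    l = 0 := by
  have h0 := h 0
  have h1 := h 1
  have h2 := h 2
  have h3 := h 3
  have h4 := h 4
  have h5 := h 5
  simp [Fin.sum_univ_succ, jet, mon, DD_cons, DD_nil, WD_fst, WD_snd_fst, WD_snd_snd, WD_fst_sq,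
    WD_snd_sq, WD_fst_mul, WD_const', vf] at h0 h1 h2 h3 h4 h5
  simp only [h0, h1, zero_mul, zero_add] at h2 h3 h4 h5
  ext i
  fin_cases i <;> assumption

/-- A compactly supported map equal to `(x, y, z, x²/2, y²/2, xy)` near the unit cube. -/
theorem exists_bump_mon : ∃ F : H → V6, Bump F ∧
    ∀ p ∈ Cube, ∀ l : V6, ∑ j, l j • jet F p j = 0 → l = 0 := by
  let c : ContDiffBump (0 : H) := ⟨2, 3, by norm_num, by norm_num⟩
  let e : (Fin 6 → ℝ) →L[ℝ] V6 := (EuclideanSpace.equiv (Fin 6) ℝ).symm.toContinuousLinearMap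
  have hs : Smooth fun p => e (mon p) :=
    e.contDiff.comp (contDiff_pi.2 smooth_mon)
  have hc : Bump (c : H → ℝ) := ⟨c.contDiff, c.hasCompactSupport⟩
  refine ⟨fun p => c p • e (mon p), hc.smul hs, fun p hp l hl => jet_mon_sum p l fun i => ?_⟩
  have hp' : p ∈ Metric.ball (0 : H) 2 := by
    simp only [Cube, Set.mem_prod, Set.mem_Icc] at hp
    rw [mem_ball_zero_iff, Prod.norm_def, Prod.norm_def]
    simp only [Real.norm_eq_abs]
    refine max_lt ?_ (max_lt ?_ ?_) <;> rw [abs_lt] <;> constructor <;> linarith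
  have ev : (fun p => c p • e (mon p)) =ᶠ[nhds p] fun p => e (mon p) := by
    filter_upwards [Metric.isOpen_ball.mem_nhds hp'] with q hq
    rw [c.one_of_mem_closedBall (Metric.ball_subset_closedBall hq), one_smul]
  rw [jet_congr ev] at hl
  have h1 := congrArg (EuclideanSpace.proj (𝕜 := ℝ) i) hl
  rw [map_sum, map_zero] at h1
  refine Eq.trans (Finset.sum_congr rfl fun j _ => ?_) h1
  rw [map_smul, ← jet_clm _ hs, smul_eq_mul]
  rfl

end Jet

section Coefficient

variable (F : H → V6)

/-- The linear combinations of the derivatives of `F`. -/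
def nu (p : H) (l : V6) : V6 := ∑ j, l j • jet F p j

/-- `∑ a, l a • u a` as a bilinear map. -/
def syn6 : (Fin 6 → Vec) →L[ℝ] (V6 →L[ℝ] Vec) :=
  ∑ i, (ContinuousLinearMap.smulRightL ℝ V6 Vec (EuclideanSpace.proj i)).comp
    (ContinuousLinearMap.proj i)

theorem syn6_apply (v : Fin 6 → Vec) (l : V6) : syn6 v l = ∑ i, l i • v i := by
  simp [syn6]

variable {F}

theorem smooth_nu (hF : Smooth F) : ContDiff ℝ (⊤ : ℕ∞) fun x : H × V6 => nu F x.1 x.2 :=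
  ContDiff.sum fun j _ => ContDiff.smul
    ((EuclideanSpace.proj (𝕜 := ℝ) j).contDiff.comp contDiff_snd)
    ((smooth_jet hF j).comp contDiff_fst)

theorem nu_smul (p : H) (c : ℝ) (l : V6) : nu F p (c • l) = c • nu F p l := by
  simp [nu, Finset.smul_sum, mul_smul]

theorem exists_norm_nu_le (hF : Bump F) : ∃ C : ℝ, 0 ≤ C ∧ ∀ p l, ‖nu F p l‖ ≤ C * ‖l‖ := by
  obtain ⟨C, hC0, hC⟩ := hF.exists_norm_DD_le 2
  have hj : ∀ p i, ‖jet F p i‖ ≤ 2 * C := fun p i => by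
    have h1 : ∀ w : List Bool, w.length ≤ 2 → ‖DD w F p‖ ≤ 2 * C := fun w hw =>
      (hC w hw p).trans (by linarith)
    fin_cases i
    exacts [h1 _ (by simp), h1 _ (by simp), (norm_sub_le _ _).trans (by
      linarith [hC [false, true] (by simp) p, hC [true, false] (by simp) p]), h1 _ (by simp),
      h1 _ (by simp), h1 _ (by simp)]
  refine ⟨6 * (2 * C), by positivity, fun p l => (norm_sum_le _ _).trans ?_⟩
  calc ∑ j, ‖l j • jet F p j‖ ≤ ∑ _j : Fin 6, ‖l‖ * (2 * C) := by
        refine Finset.sum_le_sum fun j _ => ?_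
        rw [norm_smul]
        exact mul_le_mul (PiLp.norm_apply_le l j) (hj p j) (norm_nonneg _) (norm_nonneg _)
    _ = _ := by simp; ring

/-- Projection to the orthogonal complement of an orthonormal family. -/
def pk (k : Fin 4 → Vec) (e : Vec) : Vec := e - syn k (ana k e)

theorem ana_syn {k : Fin 4 → Vec} (hk : Orthonormal ℝ k) (l : K4) : ana k (syn k l) = l := by
  ext i
  rw [ana_apply, syn_apply, hk.inner_right_fintype]

theorem norm_pk_le {k : Fin 4 → Vec} (hk : Orthonormal ℝ k) (e : Vec) : ‖pk k e‖ ≤ ‖e‖ := by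
  have h1 : ‖pk k e‖ ^ 2 = ‖e‖ ^ 2 - ‖ana k e‖ ^ 2 := by
    have e1 : ⟪e, syn k (ana k e)⟫ = ‖ana k e‖ ^ 2 := by
      rw [real_inner_comm, inner_syn, real_inner_self_eq_norm_sq]
    have e2 : ‖syn k (ana k e)‖ ^ 2 = ‖ana k e‖ ^ 2 := by
      rw [← real_inner_self_eq_norm_sq, inner_syn, ana_syn hk, real_inner_self_eq_norm_sq]
    rw [pk, norm_sub_sq_real, e1, e2]
    ring
  exact (sq_le_sq₀ (norm_nonneg _) (norm_nonneg _)).1 (by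
    rw [h1]
    linarith [sq_nonneg ‖ana k e‖])

theorem norm_pk_le_sub {k : Fin 4 → Vec} (hk : Orthonormal ℝ k) (e : Vec) (m : K4) :
    ‖pk k e‖ ≤ ‖e - ∑ i, m i • k i‖ := by
  have : pk k e = pk k (e - syn k m) := by
    simp only [pk, map_sub, ana_syn hk]
    abel
  rw [this, ← syn_apply]
  exact norm_pk_le hk _

theorem pk_add (k : Fin 4 → Vec) (e e' : Vec) : pk k (e + e') = pk k e + pk k e' := by
  simp only [pk, map_add]
  abel

theorem pk_smul (k : Fin 4 → Vec) (c : ℝ) (e : Vec) : pk k (c • e) = c • pk k e := by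
  simp only [pk, map_smul, smul_sub]

theorem continuous_pk : Continuous fun x : (Fin 4 → Vec) × Vec => pk x.1 x.2 := by
  unfold pk
  fun_prop

theorem isCompact_orthonormal : IsCompact {k : Fin 4 → Vec | Orthonormal ℝ k} := by
  refine (isCompact_closedBall (0 : Fin 4 → Vec) 1).of_isClosed_subset ?_ fun k hk => ?_
  · simp only [orthonormal_iff_ite, Set.ofPred_forall]
    exact isClosed_iInter fun i => isClosed_iInter fun j =>
      isClosed_eq (by fun_prop) continuous_const
  · rw [mem_closedBall_zero_iff, pi_norm_le_iff_of_nonneg zero_le_one]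
    exact fun i => (hk.norm_eq_one i).le

/-- Almost every choice of coefficients makes the derivatives independent. -/
theorem exists_generic (hF : Smooth F) (hν : ∀ p ∈ Cube, ∀ l, nu F p l = 0 → l = 0)
    {β : H → V6 → Vec} (hβ : ContDiff ℝ (⊤ : ℕ∞) fun x : H × V6 => β x.1 x.2)
    (hβ' : ∀ p (c : ℝ) l, β p (c • l) = c • β p l) (k : Fin 4 → Vec) {ε : ℝ} (hε : 0 < ε) :
    ∃ U : Fin 6 → Vec, ‖U‖ ≤ ε ∧ ∀ p ∈ Cube, ∀ l, l ≠ 0 → ∀ m : K4,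
      β p l + syn6 U (nu F p l) ≠ syn k m := by
  let Q := (H × V6) × K4 × (Fin 5 → Vec)
  let f : Fin 6 → Q → (Fin 6 → Vec) := fun a x => a.insertNth (α := fun _ => Vec)
    (syn k x.2.1 - β x.1.1 x.1.2 - ∑ i, nu F x.1.1 x.1.2 (a.succAbove i) • x.2.2 i) x.2.2
  have hf : ∀ a, ContDiff ℝ 1 (f a) := fun a => by
    refine contDiff_pi.2 ((Fin.forall_iff_succAbove a).2 ⟨?_, fun i => ?_⟩)
    · simp only [f, Fin.insertNth_apply_same]
      have h1 : ContDiff ℝ (⊤ : ℕ∞) fun x : Q => β x.1.1 x.1.2 := hβ.comp contDiff_fst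
      have h2 : ContDiff ℝ (⊤ : ℕ∞) fun x : Q => nu F x.1.1 x.1.2 :=
        (smooth_nu hF).comp contDiff_fst
      have h3 : ∀ i, ContDiff ℝ (⊤ : ℕ∞) fun x : Q => nu F x.1.1 x.1.2 (a.succAbove i) := fun i =>
        (EuclideanSpace.proj (𝕜 := ℝ) (a.succAbove i)).contDiff.comp h2
      have h4 : ∀ i, ContDiff ℝ (⊤ : ℕ∞) fun x : Q => x.2.2 i := fun i => by fun_prop
      have h5 : ContDiff ℝ (⊤ : ℕ∞) fun x : Q => syn k x.2.1 := by fun_prop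
      exact ((h5.sub h1).sub (ContDiff.sum fun i _ => (h3 i).smul (h4 i))).of_le (by simp)
    · simp only [f, Fin.insertNth_apply_succAbove]
      fun_prop
  have hd : Dense (⋃ a, Set.range (f a))ᶜ := by
    refine dense_compl_of_dimH_lt_finrank ?_
    rw [dimH_iUnion]
    refine (iSup_le fun a => (hf a).dimH_range_le).trans_lt ?_
    have e1 : Module.finrank ℝ Q = 158 := by
      simp [Q, H, V6, Module.finrank_pi_fintype]
    have e2 : Module.finrank ℝ (Fin 6 → Vec) = 174 := by simp [Module.finrank_pi_fintype]
    rw [e1, e2]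
    norm_num
  obtain ⟨U, hU, hUb⟩ := hd.inter_open_nonempty _ Metric.isOpen_ball
    ⟨(0 : Fin 6 → Vec), Metric.mem_ball_self hε⟩
  refine ⟨U, (mem_ball_zero_iff.1 hU).le, fun p hp l hl m h => hUb ?_⟩
  obtain ⟨a, ha⟩ : ∃ a, nu F p l a ≠ 0 := by
    by_contra! hc
    exact hl (hν p hp l (by ext i; exact hc i))
  set c := (nu F p l a)⁻¹ with hc
  refine Set.mem_iUnion.2 ⟨a, ⟨((p, c • l), c • m, fun i => U (a.succAbove i)), ?_⟩⟩
  have h1 : c • (β p l + syn6 U (nu F p l)) = c • syn k m := by rw [h]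
  rw [smul_add, ← hβ', ← map_smul, ← map_smul, ← nu_smul, syn6_apply,
    Fin.sum_univ_succAbove _ a, nu_smul, PiLp.smul_apply, smul_eq_mul, hc, inv_mul_cancel₀ ha,
    one_smul, ← hc, ← nu_smul] at h1
  funext j
  revert j
  refine (Fin.forall_iff_succAbove a).2 ⟨?_, fun i => ?_⟩
  · simp only [f, Fin.insertNth_apply_same]
    rw [← h1]
    abel
  · simp only [f, Fin.insertNth_apply_succAbove]

end Coefficient

section Coercive

variable {F : H → V6}

theorem smooth_nu_tr (hF : Smooth F) (s : Lat) :
    ContDiff ℝ (⊤ : ℕ∞) fun x : H × V6 => nu F (tr s x.1) x.2 :=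
  (smooth_nu hF).comp ((((smooth_tr s).comp contDiff_fst).prodMk contDiff_snd) :
    ContDiff ℝ (⊤ : ℕ∞) fun x : H × V6 => (tr s x.1, x.2))

/-- The projected derivatives as a function of all coefficients. -/
def genVal (F : H → V6) {S : Finset Lat} (θ : (S → Fin 6 → Vec) × (Fin 4 → Vec))
    (U : Fin 6 → Vec) (x : H × V6) : Vec :=
  pk θ.2 (∑ s, syn6 (θ.1 s) (nu F (tr s x.1) x.2) + syn6 U (nu F x.1 x.2))

theorem continuous_genVal (hF : Smooth F) {S : Finset Lat} (U : Fin 6 → Vec) :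
    Continuous fun z : ((S → Fin 6 → Vec) × (Fin 4 → Vec)) × (H × V6) =>
      genVal F z.1 U z.2 := by
  refine continuous_pk.comp (((continuous_snd.comp continuous_fst)).prodMk
    (((continuous_finsetSum _ fun s _ => ?_)).add ?_))
  · have h1 : Continuous fun z : ((S → Fin 6 → Vec) × (Fin 4 → Vec)) × (H × V6) =>
        syn6 (z.1.1 s) :=
      syn6.continuous.comp ((continuous_apply s).comp (continuous_fst.comp continuous_fst))
    exact h1.clm_apply ((smooth_nu_tr hF s).continuous.comp continuous_snd)
  · exact (syn6 U).continuous.comp ((smooth_nu hF).continuous.comp continuous_snd)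

theorem exists_genVal_ne_zero (hF : Smooth F) (hν : ∀ p ∈ Cube, ∀ l, nu F p l = 0 → l = 0)
    {S : Finset Lat} (θ : (S → Fin 6 → Vec) × (Fin 4 → Vec)) {ε : ℝ} (hε : 0 < ε) :
    ∃ U : Fin 6 → Vec, ‖U‖ ≤ ε ∧
      ∀ x ∈ Cube ×ˢ Metric.sphere (0 : V6) 1, 0 < ‖genVal F θ U x‖ := by
  obtain ⟨U, hU, hgen⟩ := exists_generic hF hν
    (β := fun p l => ∑ s, syn6 (θ.1 s) (nu F (tr s p) l))
    (ContDiff.sum fun s _ => (syn6 (θ.1 s)).contDiff.comp (smooth_nu_tr hF s))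
    (fun p c l => by simp only [nu_smul, map_smul, Finset.smul_sum]) θ.2 hε
  refine ⟨U, hU, fun x hx => ?_⟩
  have hx2 : ‖x.2‖ = 1 := mem_sphere_zero_iff_norm.1 hx.2
  have hl : x.2 ≠ 0 := fun h => by rw [h, norm_zero] at hx2; exact zero_ne_one hx2
  exact norm_pos_iff.2 fun h => hgen x.1 hx.1 x.2 hl (ana θ.2 _) (sub_eq_zero.1 h)

theorem exists_pos_le_near {X Y : Type*} [TopologicalSpace X] [TopologicalSpace Y] {K : Set Y}
    (hK : IsCompact K) {f : X × Y → ℝ} (hf : Continuous f) {x₀ : X}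
    (h : ∀ y ∈ K, 0 < f (x₀, y)) :
    ∃ δ : ℝ, 0 < δ ∧ ∀ᶠ x in nhds x₀, ∀ y ∈ K, δ ≤ f (x, y) := by
  obtain ⟨δ, hδ, hb⟩ := hK.exists_forall_le' (f := fun y => f (x₀, y))
    (hf.comp (Continuous.prodMk_right x₀)).continuousOn h
  refine ⟨δ / 2, half_pos hδ, ?_⟩
  have hev : ∀ᶠ x in nhds x₀, ∀ y ∈ K, δ / 2 < f (x, y) :=
    hK.eventually_forall_of_forall_eventually (P := fun x y => δ / 2 < f (x, y))
      fun y hy => (isOpen_lt continuous_const hf).mem_nhds ((half_lt_self hδ).trans_le (hb y hy))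
  exact hev.mono fun x h y hy => (h y hy).le

theorem exists_genVal_near (hF : Smooth F) (hν : ∀ p ∈ Cube, ∀ l, nu F p l = 0 → l = 0)
    {S : Finset Lat} (θ : (S → Fin 6 → Vec) × (Fin 4 → Vec)) {ε : ℝ} (hε : 0 < ε) :
    ∃ δ : ℝ, 0 < δ ∧ ∃ U : Fin 6 → Vec, ‖U‖ ≤ ε ∧ ∀ᶠ θ' in nhds θ,
      ∀ x ∈ Cube ×ˢ Metric.sphere (0 : V6) 1, δ ≤ ‖genVal F θ' U x‖ := by
  obtain ⟨U, hU, hpos⟩ := exists_genVal_ne_zero hF hν θ hε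
  have hc : Continuous fun z : ((S → Fin 6 → Vec) × (Fin 4 → Vec)) × (H × V6) =>
    ‖genVal F z.1 U z.2‖ := (continuous_genVal hF U).norm
  have hK : IsCompact (Cube ×ˢ Metric.sphere (0 : V6) 1) :=
    isCompact_Cube.prod (isCompact_sphere _ _)
  have h1 := exists_pos_le_near hK hc (x₀ := θ)
  dsimp only at h1
  obtain ⟨δ, hδ, h⟩ := h1 hpos
  exact ⟨δ, hδ, U, hU, h⟩

/-- A quantitative version of `exists_generic`, uniform over coefficients of neighbouring terms. -/
theorem exists_generic_uniform (hF : Smooth F) (hν : ∀ p ∈ Cube, ∀ l, nu F p l = 0 → l = 0)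
    (S : Finset Lat) (ρ : ℝ) {ε : ℝ} (hε : 0 < ε) : ∃ δ : ℝ, 0 < δ ∧
    ∀ (b : S → Fin 6 → Vec) (k : Fin 4 → Vec), ‖b‖ ≤ ρ → Orthonormal ℝ k →
      ∃ U : Fin 6 → Vec, ‖U‖ ≤ ε ∧ ∀ p ∈ Cube, ∀ l,
        δ * ‖l‖ ≤ ‖pk k (∑ s, syn6 (b s) (nu F (tr s p) l) + syn6 U (nu F p l))‖ := by
  have hK : IsCompact (Metric.closedBall (0 : S → Fin 6 → Vec) ρ ×ˢ
      {k : Fin 4 → Vec | Orthonormal ℝ k}) := (isCompact_closedBall _ _).prod isCompact_orthonormal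
  obtain ⟨δ, hδ, hu⟩ : ∃ δ : ℝ, 0 < δ ∧ ∀ θ ∈ (Metric.closedBall (0 : S → Fin 6 → Vec) ρ ×ˢ
      {k : Fin 4 → Vec | Orthonormal ℝ k}), ∃ U : Fin 6 → Vec, ‖U‖ ≤ ε ∧
      ∀ x ∈ Cube ×ˢ Metric.sphere (0 : V6) 1, δ ≤ ‖genVal F θ U x‖ := by
    refine hK.induction_on (p := fun t : Set ((S → Fin 6 → Vec) × (Fin 4 → Vec)) => ∃ δ : ℝ, 0 < δ ∧ ∀ θ ∈ t, ∃ U : Fin 6 → Vec,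
      ‖U‖ ≤ ε ∧ ∀ x ∈ Cube ×ˢ Metric.sphere (0 : V6) 1, δ ≤ ‖genVal F θ U x‖) ?_ ?_ ?_ ?_
    · exact ⟨1, one_pos, fun θ h => h.elim⟩
    · rintro s t hst ⟨δ, hδ, h⟩
      exact ⟨δ, hδ, fun θ hθ => h θ (hst hθ)⟩
    · rintro s t ⟨δ, hδ, h⟩ ⟨δ', hδ', h'⟩
      refine ⟨min δ δ', lt_min hδ hδ', fun θ hθ => ?_⟩
      rcases hθ with hθ | hθ
      · obtain ⟨U, hU, hx⟩ := h θ hθ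
        exact ⟨U, hU, fun x hxm => (min_le_left _ _).trans (hx x hxm)⟩
      · obtain ⟨U, hU, hx⟩ := h' θ hθ
        exact ⟨U, hU, fun x hxm => (min_le_right _ _).trans (hx x hxm)⟩
    · intro θ hθ
      obtain ⟨δ, hδ, U, hU, hev⟩ := exists_genVal_near hF hν θ hε
      exact ⟨_, mem_nhdsWithin_of_mem_nhds hev, δ, hδ, fun θ' h => ⟨U, hU, h⟩⟩
  refine ⟨δ, hδ, fun b k hb hk => ?_⟩
  obtain ⟨U, hU, hx⟩ := hu (b, k) ⟨mem_closedBall_zero_iff.2 hb, hk⟩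
  refine ⟨U, hU, fun p hp l => ?_⟩
  rcases eq_or_ne l 0 with rfl | hl
  · simp
  have hl' := norm_pos_iff.2 hl
  have h1 := hx (p, ‖l‖⁻¹ • l) ⟨hp, by
    rw [mem_sphere_zero_iff_norm, norm_smul, norm_inv, norm_norm, inv_mul_cancel₀ hl'.ne']⟩
  simp only [genVal, nu_smul, map_smul, ← Finset.smul_sum, ← smul_add, pk_smul] at h1
  rw [norm_smul, norm_inv, norm_norm, inv_mul_eq_div, le_div_iff₀ hl'] at h1
  exact h1

/-- A finite colouring of the lattice separating `s γ` from `γ`. -/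
theorem exists_coloring (S : Finset Lat) : ∃ (m : ℕ) (_ : NeZero m)
    (col : Lat → ZMod m × ZMod m × ZMod m), ∀ s ∈ S, s ≠ 0 → ∀ γ, col (lmul s γ) ≠ col γ := by
  obtain ⟨m, hm⟩ : ∃ m : ℕ, ∀ s ∈ S,
      s.1.natAbs < m ∧ s.2.1.natAbs < m ∧ s.2.2.natAbs < m := by
    refine ⟨∑ s ∈ S, (s.1.natAbs + s.2.1.natAbs + s.2.2.natAbs) + 1, fun s hs => ?_⟩
    have := Finset.single_le_sum (f := fun s : Lat => s.1.natAbs + s.2.1.natAbs + s.2.2.natAbs)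
      (fun _ _ => Nat.zero_le _) hs
    beta_reduce at this
    omega
  have hz : ∀ a : ℤ, a.natAbs < m → ((a : ZMod (m + 1)) = 0) → a = 0 := fun a ha h =>
    Int.eq_zero_of_abs_lt_dvd ((ZMod.intCast_zmod_eq_zero_iff_dvd _ _).1 h) (by
      rw [Int.abs_eq_natAbs]
      omega)
  refine ⟨m + 1, inferInstance, fun γ => (γ.1, γ.2.1, γ.2.2), fun s hs hs0 γ h => hs0 ?_⟩
  obtain ⟨h1, h2, h3⟩ := hm s hs
  simp only [lmul, Prod.mk.injEq, Int.cast_add, Int.cast_mul] at h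
  obtain ⟨e1, e2, e3⟩ := h
  have f1 := hz s.1 (by omega) (by simpa using e1)
  have f2 := hz s.2.1 (by omega) (by simpa using e2)
  have f3 := hz s.2.2 (by omega) (by simpa [f1] using e3)
  exact Prod.ext f1 (Prod.ext f2 f3)

/-- The derivatives at a point of the `γ`-cube of the field with coefficients `U`. -/
def valS (F : H → V6) (S : Finset Lat) (U : Lat → Fin 6 → Vec) (γ : Lat) (p : H) (l : V6) : Vec :=
  ∑ s ∈ S, syn6 (U (lmul s γ)) (nu F (tr s p) l)

theorem valS_add (S : Finset Lat) (U U' : Lat → Fin 6 → Vec) (γ : Lat) (p : H) (l : V6) :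
    valS F S (fun γ => U γ + U' γ) γ p l = valS F S U γ p l + valS F S U' γ p l := by
  simp only [valS, map_add, _root_.add_apply, Finset.sum_add_distrib]

theorem exists_coefficients (hF : Bump F) (hν : ∀ p ∈ Cube, ∀ l, nu F p l = 0 → l = 0)
    {S : Finset Lat} (h0 : (0 : Lat) ∈ S) {ρ : ℝ} (hρ : 0 < ρ) : ∃ δ : ℝ, 0 < δ ∧
    ∀ k : Lat → Fin 4 → Vec, (∀ γ, Orthonormal ℝ (k γ)) → ∃ U : Lat → Fin 6 → Vec,
      (∀ γ, ‖U γ‖ ≤ ρ) ∧ ∀ γ, ∀ p ∈ Cube, ∀ l, δ * ‖l‖ ≤ ‖pk (k γ) (valS F S U γ p l)‖ := by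
  obtain ⟨m, _, col, hcol⟩ := exists_coloring S
  obtain ⟨Cν, hCν0, hCν⟩ := exists_norm_nu_le hF
  set K : ℝ := S.card * (‖syn6‖ * Cν) with hK
  have hK0 : 0 ≤ K := by positivity
  have hval : ∀ (U : Lat → Fin 6 → Vec) (r : ℝ), 0 ≤ r → (∀ γ, ‖U γ‖ ≤ r) → ∀ γ p l,
      ‖valS F S U γ p l‖ ≤ K * r * ‖l‖ := fun U r hr hU γ p l => by
    refine (norm_sum_le _ _).trans ((Finset.sum_le_card_nsmul _ _ (‖syn6‖ * r * (Cν * ‖l‖))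
      fun s _ => ?_).trans (le_of_eq (by rw [hK, nsmul_eq_mul]; ring)))
    refine ((syn6 _).le_opNorm _).trans (mul_le_mul ((syn6.le_opNorm _).trans
      (mul_le_mul_of_nonneg_left (hU _) (norm_nonneg _))) (hCν _ _) (norm_nonneg _)
      (by positivity))
  have tr0 : ∀ p : H, tr 0 p = p := fun p => by rw [tr_eq]; simp
  have l0 : ∀ γ, lmul 0 γ = γ := fun γ => by simp [lmul]
  have key : ∀ T : Finset (ZMod m × ZMod m × ZMod m), ∃ δ : ℝ, 0 < δ ∧
      ∀ k : Lat → Fin 4 → Vec, (∀ γ, Orthonormal ℝ (k γ)) → ∃ U : Lat → Fin 6 → Vec,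
        (∀ γ, ‖U γ‖ ≤ ρ) ∧ (∀ γ, col γ ∉ T → U γ = 0) ∧ ∀ γ, col γ ∈ T → ∀ p ∈ Cube, ∀ l,
          δ * ‖l‖ ≤ ‖pk (k γ) (valS F S U γ p l)‖ := fun T => by
    induction T using Finset.induction_on with
    | empty => exact ⟨1, one_pos, fun k _ => ⟨fun _ => 0, by simp [hρ.le], by simp, by simp⟩⟩
    | insert c T hc ih =>
      obtain ⟨δ, hδ, ih⟩ := ih
      have hε : 0 < min ρ (δ / (2 * (K + 1))) := lt_min hρ (by positivity)
      obtain ⟨δ', hδ', hg⟩ := exists_generic_uniform hF.smooth hν S ρ hε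
      refine ⟨min (δ / 2) δ', lt_min (half_pos hδ) hδ', fun k hk => ?_⟩
      obtain ⟨U, hU, hU0, hUc⟩ := ih k hk
      have hb : ∀ γ, ‖fun s : S => U (lmul s γ)‖ ≤ ρ := fun γ =>
        (pi_norm_le_iff_of_nonneg hρ.le).2 fun s => hU _
      choose V hV hVc using fun γ => hg (fun s : S => U (lmul s γ)) (k γ) (hb γ) (hk γ)
      classical
      let V' : Lat → Fin 6 → Vec := fun γ => if col γ = c then V γ else 0
      have hV' : ∀ γ, ‖V' γ‖ ≤ min ρ (δ / (2 * (K + 1))) := fun γ => by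
        by_cases h : col γ = c
        · simpa [V', h] using hV γ
        · simpa [V', h] using hε.le
      refine ⟨fun γ => U γ + V' γ, fun γ => ?_, fun γ hγ => ?_, fun γ hγ p hp l => ?_⟩
      · beta_reduce
        by_cases h : col γ = c
        · rw [hU0 γ (h ▸ hc), zero_add]
          exact (hV' γ).trans (min_le_left _ _)
        · simpa [V', h] using hU γ
      · rw [Finset.mem_insert, not_or] at hγ
        simp [V', hγ.1, hU0 γ hγ.2]
      · rw [valS_add]
        by_cases h : col γ = c
        · have e1 : valS F S V' γ p l = syn6 (V γ) (nu F p l) := by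
            rw [valS, Finset.sum_eq_single_of_mem 0 h0 fun s hs hs0 => ?_]
            · simp [V', l0, tr0, h]
            · have : V' (lmul s γ) = 0 := if_neg fun h' => hcol s hs hs0 γ (h'.trans h.symm)
              rw [this, map_zero, _root_.zero_apply]
          have e2 : valS F S U γ p l = ∑ s : S, syn6 (U (lmul s γ)) (nu F (tr s p) l) :=
            (Finset.sum_coe_sort S fun s => syn6 (U (lmul s γ)) (nu F (tr s p) l)).symm
          rw [e1, e2]
          exact (mul_le_mul_of_nonneg_right (min_le_right _ _) (norm_nonneg _)).trans
            (hVc γ p hp l)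
        · have h1 := hUc γ ((Finset.mem_insert.1 hγ).resolve_left h) p hp l
          have h2 := (norm_pk_le (hk γ) _).trans (hval V' _ hε.le hV' γ p l)
          have h3 : K * min ρ (δ / (2 * (K + 1))) ≤ δ / 2 := by
            calc _ ≤ K * (δ / (2 * (K + 1))) := mul_le_mul_of_nonneg_left (min_le_right _ _) hK0
              _ ≤ _ := by
                rw [mul_div_assoc', div_le_div_iff₀ (by positivity) two_pos]
                nlinarith
          have h4 := mul_le_mul_of_nonneg_right h3 (norm_nonneg l)
          have h5 := mul_le_mul_of_nonneg_right (min_le_left (δ / 2) δ') (norm_nonneg l)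
          rw [pk_add]
          have h6 := norm_sub_le_norm_add (pk (k γ) (valS F S U γ p l))
            (pk (k γ) (valS F S V' γ p l))
          linarith
  obtain ⟨δ, hδ, h⟩ := key Finset.univ
  refine ⟨δ, hδ, fun k hk => ?_⟩
  obtain ⟨U, hU, -, hc⟩ := h k hk
  exact ⟨U, hU, fun γ => hc γ (Finset.mem_univ _)⟩

/-- A field whose derivatives up to second order are uniformly independent modulo
prescribed four-dimensional spaces. -/
theorem exists_generic_field : ∃ δ C : ℝ, 0 < δ ∧ 0 ≤ C ∧
    ∀ k : Lat → Fin 4 → Vec, (∀ γ, Orthonormal ℝ (k γ)) → ∃ f : H → Vec, Smooth f ∧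
      (∀ w : List Bool, w.length ≤ 21 → ∀ p, ‖DD w f p‖ ≤ C) ∧
      ∀ γ p, tr γ p ∈ Cube → ∀ (l : V6) (m : K4),
        δ * ‖l‖ ≤ ‖∑ j, l j • jet f p j - ∑ i, m i • k γ i‖ := by
  obtain ⟨F, hF, hν⟩ := exists_bump_mon
  have hfin : {γ : Lat | ∃ p ∈ Cube, tr γ p ∈ tsupport F}.Finite :=
    finite_lat_of_isCompact isCompact_Cube hF.supp
  set S : Finset Lat := insert 0 hfin.toFinset with hS
  have hρ : 0 < (1 + ‖syn6‖)⁻¹ := by positivity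
  obtain ⟨δ, hδ, hU⟩ := exists_coefficients hF hν (Finset.mem_insert_self 0 hfin.toFinset) hρ
  rw [← hS] at hU
  obtain ⟨C, hC0, hC⟩ := exists_norm_DD_lsum_tr_le (E := Vec) hF 21
  refine ⟨δ, C, hδ, hC0, fun k hk => ?_⟩
  obtain ⟨U, hUρ, hUc⟩ := hU k hk
  have hn : ∀ γ, ‖syn6 (U γ)‖ ≤ 1 := fun γ => by
    refine (syn6.le_opNorm _).trans ((mul_le_mul_of_nonneg_left (hUρ γ) (norm_nonneg _)).trans ?_)
    rw [mul_inv_le_iff₀ (by positivity)]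
    linarith
  set g : Lat → H → Vec := fun γ p => syn6 (U γ) (F (tr γ p)) with hg
  have hgs : ∀ γ, Smooth (g γ) := fun γ =>
    (syn6 (U γ)).contDiff.comp (hF.smooth.comp (smooth_tr γ))
  have hLF : LF g := LF_of_tsupport hF.supp fun γ p h => by
    simp [hg, image_eq_zero_of_notMem_tsupport h]
  have hDg : ∀ γ w p, DD w (g γ) p = syn6 (U γ) (DD w F (tr γ p)) := fun γ w p => by
    have e1 : DD w (g γ) = fun p => syn6 (U γ) (DD w (fun p => F (tr γ p)) p) :=
      DD_clm (syn6 (U γ)) (hF.smooth.comp (smooth_tr γ)) w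
    have e2 : DD w (fun p => F (tr γ p)) = fun p => DD w F (tr γ p) :=
      DD_mul_right hF.smooth (inv (lat γ)) w
    rw [e1, e2]
  refine ⟨lsum g, hLF.smooth hgs, hC hn, fun γ p hp l m => ?_⟩
  refine (hUc γ _ hp l).trans ?_
  have hD : ∀ w, DD w (lsum g) p
      = ∑ s ∈ S, syn6 (U (lmul s γ)) (DD w F (tr s (tr γ p))) := fun w => by
    classical
    rw [hLF.DD_lsum hgs w, lsum_eq_sum (s := S.image fun s => lmul s γ), Finset.sum_image]
    · exact Finset.sum_congr rfl fun s _ => by rw [hDg, tr_tr]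
    · exact fun a _ b _ h => (lmulRightEquiv γ).injective h
    · intro γ' hγ'
      obtain ⟨s, rfl⟩ := (lmulRightEquiv γ).surjective γ'
      have hs : s ∉ S := fun h => hγ' (Finset.mem_image_of_mem _ h)
      have h1 : tr s (tr γ p) ∉ tsupport F := fun h => hs (Finset.mem_insert_of_mem
        (hfin.mem_toFinset.2 ⟨_, hp, h⟩))
      have h2 : DD w F (tr s (tr γ p)) = 0 := by
        have : F =ᶠ[nhds (tr s (tr γ p))] fun _ => 0 := notMem_tsupport_iff_eventuallyEq.mp h1
        rw [(DD_congr_of_eventuallyEq this w).self_of_nhds, DD_zero]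
      change DD w (g (lmul s γ)) p = 0
      rw [hDg, tr_tr, h2, map_zero]
  have hj := jet_of_DD_sum hD
  have hv : valS F S U γ (tr γ p) l = ∑ j, l j • jet (lsum g) p j := by
    simp only [valS, hj, nu, map_sum, map_smul, Finset.smul_sum]
    exact Finset.sum_comm
  rw [hv]
  exact norm_pk_le_sub (hk γ) _ m

end Coercive

/-- Leibniz rule with the top order term singled out. -/
theorem norm_DD_bilin_sub_le {E F G : Type*} [NormedAddCommGroup E] [NormedSpace ℝ E]
    [NormedAddCommGroup F] [NormedSpace ℝ F] [NormedAddCommGroup G] [NormedSpace ℝ G]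
    (B : E →L[ℝ] F →L[ℝ] G) {f : H → E} {g : H → F} (hf : Smooth f)
    (hg : Smooth g) {p : H} {a b : ℝ} {J : ℕ}
    (h : ∀ c, SB (Heisenberg.WD c f) p a 1 J)
    (h' : SB g p b 1 J) (w : List Bool) (hw : w.length ≤ J + 1) :
    ‖DD w (fun p => B (f p) (g p)) p - B (f p) (DD w g p)‖ ≤ w.length * (2 ^ J * ‖B‖ * a * b) := by
  induction J generalizing g w with
  | zero =>
    rcases List.eq_nil_or_concat w with rfl | ⟨v, c, rfl⟩
    · simp
    obtain rfl : v = [] := by simpa using hw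
    have e1 := (SB.bilin B (hf.WD c) hg zero_le_one (h c) h').norm_le
    simpa [DD_cons, DD_nil, WD_bilin B hf hg] using e1
  | succ J ih =>
    have ha := (h true).nonneg
    have hb := h'.nonneg
    rcases List.eq_nil_or_concat w with rfl | ⟨v, c, rfl⟩
    · simp
    rw [List.concat_eq_append] at hw ⊢
    have hv : v.length ≤ J + 1 := by simpa using hw
    rw [DD_concat, DD_concat, WD_bilin B hf hg, DD_add ((hf.WD c).bilin B hg)
      (hf.bilin B (hg.WD c))]
    have h1 : ∀ c, SB (Heisenberg.WD c f) p a 1 J := fun c =>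
      (h c).mono le_rfl zero_le_one (Nat.le_succ J)
    have e1 := (SB.bilin B (hf.WD c) hg zero_le_one (h c) h') v hv
    have e2 := ih (hg.WD c) h1 (by simpa using h'.WD c) v hv
    simp only [one_pow, mul_one] at e1
    have hK : 2 ^ J * ‖B‖ * a * b ≤ 2 ^ (J + 1) * ‖B‖ * a * b := by
      gcongr
      · norm_num
      · omega
    rw [add_sub_assoc]
    refine (norm_add_le _ _).trans ((add_le_add e1 e2).trans ?_)
    have hl : (0 : ℝ) ≤ v.length := by positivity
    simp only [List.length_append, List.length_cons, List.length_nil, Nat.cast_add,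
      Nat.cast_one, zero_add]
    nlinarith [mul_le_mul_of_nonneg_left hK hl]

/-- The projections vary slowly when the frame does. -/
theorem exists_SB_WD_prj {a c η : ℝ} (ha : 0 < a) (hc : 0 < c) (hη : 0 < η) : ∃ s : ℝ, 0 < s ∧
    ∀ {v : H → Fin 4 → Vec}, Smooth v → (∀ p, Coer c (v p)) → ∀ {p : H}, ‖v p‖ ≤ a →
      (∀ w : List Bool, 1 ≤ w.length → w.length ≤ 21 → ‖DD w v p‖ ≤ s) →
      ∀ b, SB (WD b fun p => prj (v p)) p η 1 20 := by
  obtain ⟨K, hK, hr⟩ := exists_SB_rinv 21 a hc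
  set L : ℝ := 2 ^ 21 * K * (‖ana‖ * a) with hL
  have hL0 : 0 ≤ L := by positivity
  set N : ℝ := min 1 (η / (L + 1)) with hN
  have hN0 : 0 < N := lt_min one_pos (by positivity)
  have hN1 : N ≤ 1 := min_le_left _ _
  have hLN : L * N ≤ η := by
    have : N * (L + 1) ≤ η := (le_div_iff₀ (by positivity)).1 (min_le_right _ _)
    nlinarith
  refine ⟨a * N ^ 21, by positivity, fun {v} hv hco {p} h0 h1 b => ?_⟩
  have hS : SB v p a N 21 := fun w hw => by
    rcases Nat.eq_zero_or_pos w.length with h | h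
    · obtain rfl := List.eq_nil_of_length_eq_zero h
      simpa using h0
    · exact (h1 w h hw).trans (mul_le_mul_of_nonneg_left
        (pow_le_pow_of_le_one hN0.le hN1 hw) ha.le)
  have hR := hr hv hco hN0.le hS
  have hC := SB.clm_comp (hv.rinv hc hco) hv.ana hN0.le hR (hS.clm ana hv)
  have hW := ((hC.WD (J := 20) b).mono_scale (by positivity) hN0.le hN1).mono hLN zero_le_one le_rfl
  have hs : Smooth fun p => (rinv (v p)).comp (ana (v p)) :=
    ContDiff.clm_comp (hv.rinv hc hco) hv.ana
  have he : (WD b fun p => prj (v p)) = fun p => - WD b (fun p => (rinv (v p)).comp (ana (v p))) p := by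
    have : (fun p => prj (v p)) = fun p => ContinuousLinearMap.id ℝ Vec -
      (fun p => (rinv (v p)).comp (ana (v p))) p := rfl
    rw [this, WD_sub contDiff_const hs, WD_const]
    simp
  rw [he]
  exact hW.neg

theorem Coer.exists_orthonormal {c : ℝ} (hc : 0 < c) {v : Fin 4 → Vec} (h : Coer c v) :
    ∃ k : Fin 4 → Vec, Orthonormal ℝ k ∧ ∀ l : K4, ∃ m : K4, ∑ i, l i • v i = ∑ i, m i • k i := by
  have hli : LinearIndependent ℝ v := by
    rw [Fintype.linearIndependent_iff]
    intro g hg i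
    have h1 := h (WithLp.toLp 2 g)
    rw [syn_apply] at h1
    have h2 : ∑ i, (WithLp.toLp 2 g : K4) i • v i = 0 := hg
    rw [h2, norm_zero] at h1
    have h3 : ‖(WithLp.toLp 2 g : K4)‖ ≤ 0 := by
      by_contra! h4
      nlinarith [mul_pos hc h4]
    have h4 := norm_le_zero_iff.1 h3
    have h5 := congrArg (fun x : K4 => x i) h4
    simpa using h5
  have hf : Module.finrank ℝ (Submodule.span ℝ (Set.range v)) = 4 := by
    simpa using finrank_span_eq_card hli
  let b := (stdOrthonormalBasis ℝ (Submodule.span ℝ (Set.range v))).reindex (finCongr hf)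
  refine ⟨fun i => (b i : Vec), ?_, fun l => ?_⟩
  · exact b.orthonormal.comp_linearIsometry (Submodule.subtypeₗᵢ _)
  · let x : Submodule.span ℝ (Set.range v) := ⟨∑ i, l i • v i,
      Submodule.sum_mem _ fun i _ => Submodule.smul_mem _ _ (Submodule.subset_span ⟨i, rfl⟩)⟩
    refine ⟨b.repr x, ?_⟩
    have := congrArg (Subtype.val) (b.sum_repr x)
    simpa [x] using this.symm

theorem norm_jet_sub_le {E F : Type*} [NormedAddCommGroup E] [NormedSpace ℝ E]
    [NormedAddCommGroup F] [NormedSpace ℝ F] {f : H → E} {g : H → F} {p : H} (L : F →L[ℝ] E)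
    {s : ℝ} (hs : 0 ≤ s) (h : ∀ w : List Bool, w.length ≤ 2 → ‖DD w f p - L (DD w g p)‖ ≤ s)
    (i : Fin 6) : ‖jet f p i - L (jet g p i)‖ ≤ 2 * s := by
  have h2 : s ≤ 2 * s := by linarith
  fin_cases i
  · exact (h [true] (by simp)).trans h2
  · exact (h [false] (by simp)).trans h2
  · have e : jet f p 2 - L (jet g p 2) = (DD [false, true] f p - L (DD [false, true] g p))
        - (DD [true, false] f p - L (DD [true, false] g p)) := by
      simp only [jet, Matrix.cons_val, map_sub]
      abel
    change ‖jet f p 2 - L (jet g p 2)‖ ≤ 2 * s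
    rw [e, two_mul]
    exact (norm_sub_le _ _).trans (add_le_add (h _ (by simp)) (h _ (by simp)))
  · exact (h [true, true] (by simp)).trans h2
  · exact (h [false, false] (by simp)).trans h2
  · exact (h [true, false] (by simp)).trans h2

theorem norm_sum_smul_le {E : Type*} [NormedAddCommGroup E] [NormedSpace ℝ E] {s : ℝ}
    {u : Fin 6 → E} (h : ∀ j, ‖u j‖ ≤ s) (l : V6) : ‖∑ j, l j • u j‖ ≤ 6 * s * ‖l‖ := by
  refine (norm_sum_le _ _).trans ?_
  have : ∀ j ∈ Finset.univ, ‖l j • u j‖ ≤ ‖l‖ * s := fun j _ => by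
    rw [norm_smul]
    exact mul_le_mul (PiLp.norm_apply_le l j) (h j) (norm_nonneg _) (norm_nonneg _)
  refine (Finset.sum_le_sum this).trans (le_of_eq ?_)
  simp
  ring

theorem norm_jet_le {E : Type*} [NormedAddCommGroup E] [NormedSpace ℝ E] {f : H → E} {p : H} {s : ℝ}
    (hs : 0 ≤ s) (h : ∀ w : List Bool, w.length ≤ 2 → ‖DD w f p‖ ≤ s) (i : Fin 6) :
    ‖jet f p i‖ ≤ 2 * s := by
  simpa using norm_jet_sub_le (f := f) (g := fun _ : H => (0 : ℝ)) (p := p) 0 hs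
    (by simpa using h) i

theorem ccDist_lat_le {γ : Lat} {p : H} (h : tr γ p ∈ Cube) : ccDist (lat γ) p ≤ 6 := by
  have h1 := ccDist_mul_left_le (tr γ p) (lat γ)
  rw [mul_tr] at h1
  obtain ⟨⟨a, b⟩, ⟨c, d⟩, e, f⟩ := h
  refine h1.trans ?_
  rw [abs_of_nonneg a, abs_of_nonneg c, abs_of_nonneg e]
  have : √(tr γ p).2.2 ≤ 1 := Real.sqrt_le_one.2 f
  linarith

/-- A map with nondegenerate jets that is orthogonal to a slowly varying frame. -/
theorem exists_orthogonal_field : ∃ δ B : ℝ, 0 < δ ∧ 0 ≤ B ∧ ∀ {a c : ℝ}, 0 < a → 0 < c →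
    ∃ s : ℝ, 0 < s ∧ ∀ {v : H → Fin 4 → Vec}, Smooth v → (∀ p, Coer c (v p)) →
      (∀ p, ‖v p‖ ≤ a) →
      (∀ p, ∀ w : List Bool, 1 ≤ w.length → w.length ≤ 21 → ‖DD w v p‖ ≤ s) →
      ∃ φ : H → Vec, Smooth φ ∧ (∀ w : List Bool, w.length ≤ 21 → ∀ p, ‖DD w φ p‖ ≤ B) ∧
        (∀ p i, ⟪v p i, φ p⟫ = 0) ∧ ∀ p (l : V6), δ * ‖l‖ ≤ ‖∑ j, l j • jet φ p j‖ := by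
  obtain ⟨δ, C, hδ, hC, hf⟩ := exists_generic_field
  refine ⟨δ / 2, C + 1, by positivity, by positivity, fun {a c} ha hc => ?_⟩
  set Q : ℝ := 12 * (21 * 2 ^ 20 * C) + 72 * C + 1 with hQ
  have hQ0 : 0 < Q := by positivity
  set η : ℝ := min 1 (δ / 2) / Q with hη
  have hη0 : 0 < η := by positivity
  have hηQ : η * Q = min 1 (δ / 2) := div_mul_cancel₀ _ hQ0.ne'
  have hη1 : η * Q ≤ 1 := hηQ ▸ min_le_left _ _
  have hη2 : η * Q ≤ δ / 2 := hηQ ▸ min_le_right _ _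
  obtain ⟨s, hs, hprj⟩ := exists_SB_WD_prj ha hc hη0
  refine ⟨s, hs, fun {v} hv hco hva hvs => ?_⟩
  choose k hk hkv using fun γ : Lat => (hco (lat γ)).exists_orthonormal hc
  obtain ⟨f, hfs, hfC, hfδ⟩ := hf k hk
  have hP : Smooth fun p => prj (v p) := hv.prj hc hco
  have hW : ∀ p b, SB (WD b fun p => prj (v p)) p η 1 20 := fun p b =>
    hprj hv hco (hva p) (hvs p) b
  set err : ℝ := 21 * (2 ^ 20 * 1 * η * C) with herr
  have herr0 : 0 ≤ err := by positivity
  have hmain : ∀ p, ∀ w : List Bool, w.length ≤ 21 →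
      ‖DD w (fun p => prj (v p) (f p)) p - prj (v p) (DD w f p)‖ ≤ err := fun p w hw => by
    have h1 := norm_DD_bilin_sub_le (ContinuousLinearMap.id ℝ (Vec →L[ℝ] Vec)) hP hfs (hW p)
      (b := C) (fun w hw => by simpa using hfC w (by omega) p) w hw
    have h2 : ‖ContinuousLinearMap.id ℝ (Vec →L[ℝ] Vec)‖ ≤ 1 := ContinuousLinearMap.norm_id_le
    refine LE.le.trans h1 ?_
    have h3 : (w.length : ℝ) ≤ 21 := by exact_mod_cast hw
    rw [herr]
    gcongr
  have hpn : ∀ p, ‖prj (v p)‖ ≤ 1 := fun p => (hco p).norm_prj_le hc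
  refine ⟨fun p => prj (v p) (f p), ContDiff.clm_apply hP hfs, fun w hw p => ?_, fun p i =>
    (hco p).inner_prj hc _ i, fun p l => ?_⟩
  · have h1 := hmain p w hw
    have h2 : ‖prj (v p) (DD w f p)‖ ≤ C :=
      ((prj (v p)).le_of_opNorm_le (hpn p) _).trans (by simpa using hfC w hw p)
    have h3 : err ≤ 1 := by nlinarith
    calc ‖DD w (fun p => prj (v p) (f p)) p‖
        ≤ ‖DD w (fun p => prj (v p) (f p)) p - prj (v p) (DD w f p)‖ + ‖prj (v p) (DD w f p)‖ :=
          norm_le_norm_sub_add _ _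
      _ ≤ C + 1 := by linarith
  · obtain ⟨γ, hγ⟩ := exists_tr_mem_Cube p
    set e : Vec := ∑ j, l j • jet f p j with he
    have hj : ∀ j, ‖jet (fun p => prj (v p) (f p)) p j - prj (v p) (jet f p j)‖ ≤ 2 * err :=
      norm_jet_sub_le _ herr0 fun w hw => hmain p w (by omega)
    have h1 := norm_sum_smul_le hj l
    have h2 : ∑ j, l j • (jet (fun p => prj (v p) (f p)) p j - prj (v p) (jet f p j))
        = ∑ j, l j • jet (fun p => prj (v p) (f p)) p j - prj (v p) e := by
      simp [he, smul_sub, Finset.sum_sub_distrib]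
    rw [h2] at h1
    have h3 : ‖e‖ ≤ 6 * (2 * C) * ‖l‖ :=
      norm_sum_smul_le (norm_jet_le hC fun w hw => hfC w (by omega) p) l
    have h4 : ‖prj (v (lat γ)) - prj (v p)‖ ≤ η * 6 :=
      (norm_sub_le_ccDist hP (fun b p => (hW p b).norm_le) (lat γ) p).trans
        (mul_le_mul_of_nonneg_left (ccDist_lat_le hγ) hη0.le)
    have h5 : ‖prj (v (lat γ)) e - prj (v p) e‖ ≤ η * 6 * (6 * (2 * C) * ‖l‖) := by
      have := (prj (v (lat γ)) - prj (v p)).le_of_opNorm_le h4 e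
      rw [_root_.sub_apply] at this
      exact this.trans (by gcongr)
    have h6 : δ * ‖l‖ ≤ ‖prj (v (lat γ)) e‖ := by
      obtain ⟨m, hm⟩ := prj_eq_sub_sum (v (lat γ)) e
      obtain ⟨m', hm'⟩ := hkv γ m
      rw [hm, hm']
      exact hfδ γ p hγ l m'
    have h7 : ‖prj (v (lat γ)) e‖ ≤ ‖prj (v (lat γ)) e - prj (v p) e‖ + ‖prj (v p) e‖ :=
      norm_le_norm_sub_add _ _
    have h8 : ‖prj (v p) e‖ ≤ ‖∑ j, l j • jet (fun p => prj (v p) (f p)) p j - prj (v p) e‖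
        + ‖∑ j, l j • jet (fun p => prj (v p) (f p)) p j‖ := by
      rw [norm_sub_rev]
      exact norm_le_norm_sub_add _ _
    have h9 : 6 * (2 * err) * ‖l‖ + η * 6 * (6 * (2 * C) * ‖l‖) ≤ δ / 2 * ‖l‖ := by
      have : 6 * (2 * err) + η * 6 * (6 * (2 * C)) ≤ δ / 2 := by
        rw [herr]
        nlinarith
      nlinarith [norm_nonneg l]
    change δ / 2 * ‖l‖ ≤ ‖∑ j, l j • jet (fun p => prj (v p) (f p)) p j‖
    linarith

theorem wedgeNorm_sum_smul {n : ℕ} (B : Matrix (Fin n) (Fin n) ℝ) (u : Fin n → Vec) :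
    wedgeNorm (fun i => ∑ j, B i j • u j) = |B.det| * wedgeNorm u := by
  unfold wedgeNorm
  have : (Matrix.of fun i j => ⟪∑ k, B i k • u k, ∑ k, B j k • u k⟫ : Matrix (Fin n) (Fin n) ℝ)
      = B * (Matrix.of fun i j => ⟪u i, u j⟫) * B.transpose := by
    ext i j
    simp only [Matrix.of_apply, Matrix.mul_apply, Matrix.transpose_apply, sum_inner, inner_sum,
      real_inner_smul_left, real_inner_smul_right, Finset.sum_mul]
    refine Finset.sum_congr rfl fun _ _ => Finset.sum_congr rfl fun _ _ => ?_
    ring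
  rw [this, Matrix.det_mul, Matrix.det_mul, Matrix.det_transpose,
    show ∀ x : ℝ, B.det * x * B.det = B.det ^ 2 * x by intro x; ring,
    Real.sqrt_mul (sq_nonneg _), Real.sqrt_sq_eq_abs]

theorem one_le_wedgeNorm {n : ℕ} {u : Fin n → Vec}
    (h : ∀ l : EuclideanSpace ℝ (Fin n), ‖l‖ ≤ ‖∑ i, l i • u i‖) : 1 ≤ wedgeNorm u := by
  set G : Matrix (Fin n) (Fin n) ℝ := Matrix.of fun i j => ⟪u i, u j⟫ with hG
  have hH : G.IsHermitian := by
    ext i j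
    simp [hG, Matrix.conjTranspose_apply, real_inner_comm]
  have h1 : ∀ i, 1 ≤ hH.eigenvalues i := fun i => by
    have hv := hH.mulVec_eigenvectorBasis i
    set x := hH.eigenvectorBasis i with hx
    have hx1 : ‖x‖ = 1 := hH.eigenvectorBasis.orthonormal.1 i
    have h2 : ‖∑ j, x j • u j‖ ^ 2 = hH.eigenvalues i := by
      rw [← real_inner_self_eq_norm_sq]
      simp only [sum_inner, inner_sum, real_inner_smul_left, real_inner_smul_right]
      have h3 : ∀ j, ∑ k, x k * ⟪u j, u k⟫ = hH.eigenvalues i * x j := fun j => by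
        have := congrFun hv j
        simp only [Matrix.mulVec, dotProduct, hG, Matrix.of_apply, Pi.smul_apply,
          smul_eq_mul] at this
        rw [← this]
        exact Finset.sum_congr rfl fun _ _ => mul_comm _ _
      have h4 : ∑ j, x j ^ 2 = 1 := by
        rw [← EuclideanSpace.real_norm_sq_eq, hx1, one_pow]
      calc ∑ j, ∑ k, x j * (x k * ⟪u k, u j⟫) = ∑ j, x j * ∑ k, x k * ⟪u j, u k⟫ := by
            refine Finset.sum_congr rfl fun j _ => ?_
            rw [Finset.mul_sum]
            refine Finset.sum_congr rfl fun k _ => ?_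
            rw [real_inner_comm]
        _ = hH.eigenvalues i * ∑ j, x j ^ 2 := by
            rw [Finset.mul_sum]
            refine Finset.sum_congr rfl fun j _ => ?_
            rw [h3]
            ring
        _ = _ := by rw [h4, mul_one]
    have h5 := h x
    rw [hx1] at h5
    rw [← h2]
    exact one_le_pow₀ h5
  unfold wedgeNorm
  rw [Real.one_le_sqrt, ← hG, hH.det_eq_prod_eigenvalues]
  have : (∏ _i : Fin n, (1 : ℝ)) ≤ ∏ i, hH.eigenvalues i :=
    Finset.prod_le_prod (fun _ _ => zero_le_one) fun i _ => h1 i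
  simpa using this

theorem wedgeNorm_two_sq (a b : Vec) :
    wedgeNorm ![a, b] ^ 2 = ‖a‖ ^ 2 * ‖b‖ ^ 2 - ⟪a, b⟫ ^ 2 := by
  unfold wedgeNorm
  rw [Real.sq_sqrt]
  · rw [Matrix.det_fin_two]
    simp [real_inner_comm a b, sq]
  · rw [Matrix.det_fin_two]
    have := real_inner_mul_inner_self_le a b
    simp [real_inner_comm a b] at this ⊢
    linarith

theorem le_wedgeNorm_of_forms {u : Fin 6 → Vec} {a b : Vec} {s : ℝ} (hs : 0 < s)
    (hab : 0 < wedgeNorm ![a, b])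
    (h : ∀ l : V6, ‖l 0 • a + l 1 • b‖ ^ 2 + s ^ 2 * ‖l‖ ^ 2 ≤ ‖∑ i, l i • u i‖ ^ 2) :
    s ^ 4 * wedgeNorm ![a, b] ≤ wedgeNorm u := by
  have hsq := wedgeNorm_two_sq a b
  set W := wedgeNorm ![a, b] with hW
  have hW2 : 0 < W ^ 2 := by positivity
  have hb : 0 < ‖b‖ := by
    by_contra! h0
    have : ‖b‖ = 0 := le_antisymm h0 (norm_nonneg _)
    rw [this] at hsq
    nlinarith [sq_nonneg ⟪a, b⟫]
  set y := ‖b‖ with hy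
  set t := ⟪a, b⟫ / y ^ 2 with ht
  set x := W / y with hx
  have hx0 : 0 < x := by positivity
  have hty : t * y ^ 2 = ⟪a, b⟫ := div_mul_cancel₀ _ (by positivity)
  have hxy : x * y = W := div_mul_cancel₀ _ hb.ne'
  have ha : ‖a‖ ^ 2 = x ^ 2 + t ^ 2 * y ^ 2 := by
    have : (‖a‖ ^ 2 - x ^ 2 - t ^ 2 * y ^ 2) * y ^ 2 = 0 := by
      rw [← hxy, ← hty] at hsq
      linear_combination -hsq
    have h2 := (mul_eq_zero.1 this).resolve_right (by positivity)
    linarith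
  let B : Matrix (Fin 6) (Fin 6) ℝ := !![x⁻¹, -t * x⁻¹, 0, 0, 0, 0; 0, y⁻¹, 0, 0, 0, 0;
    0, 0, s⁻¹, 0, 0, 0; 0, 0, 0, s⁻¹, 0, 0; 0, 0, 0, 0, s⁻¹, 0; 0, 0, 0, 0, 0, s⁻¹]
  have hB : B.det = x⁻¹ * y⁻¹ * s⁻¹ ^ 4 := by
    rw [Matrix.det_of_isUpperTriangular]
    · simp [B, Fin.prod_univ_succ]
      ring
    · intro i j hij
      fin_cases i <;> fin_cases j <;> first | rfl | (exfalso; revert hij; decide)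
  have h1 : 1 ≤ wedgeNorm fun i => ∑ j, B i j • u j := by
    refine one_le_wedgeNorm fun m => ?_
    let l : V6 := !₂[x⁻¹ * m 0, y⁻¹ * m 1 - t * x⁻¹ * m 0, s⁻¹ * m 2, s⁻¹ * m 3, s⁻¹ * m 4,
      s⁻¹ * m 5]
    have e1 : ∑ i, m i • ∑ j, B i j • u j = ∑ i, l i • u i := by
      simp [B, l, Fin.sum_univ_succ, smul_smul, smul_add]
      module
    have e2 := h l
    rw [← e1] at e2
    have e3 : ‖l 0 • a + l 1 • b‖ ^ 2 = m 0 ^ 2 + m 1 ^ 2 := by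
      rw [norm_add_sq_real, norm_smul, norm_smul, real_inner_smul_left, real_inner_smul_right,
        mul_pow, mul_pow, Real.norm_eq_abs, Real.norm_eq_abs, sq_abs, sq_abs, ha, ← hty, ← hy]
      simp [l]
      field_simp
      ring
    have e4 : m 2 ^ 2 + m 3 ^ 2 + m 4 ^ 2 + m 5 ^ 2 ≤ s ^ 2 * ‖l‖ ^ 2 := by
      rw [EuclideanSpace.real_norm_sq_eq]
      simp only [Fin.sum_univ_six]
      simp [l]
      have : s ^ 2 * ((x⁻¹ * m 0) ^ 2 + (y⁻¹ * m 1 - t * x⁻¹ * m 0) ^ 2 + (s⁻¹ * m 2) ^ 2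
          + (s⁻¹ * m 3) ^ 2 + (s⁻¹ * m 4) ^ 2 + (s⁻¹ * m 5) ^ 2)
          = (s * (x⁻¹ * m 0)) ^ 2 + (s * (y⁻¹ * m 1 - t * x⁻¹ * m 0)) ^ 2
            + (m 2 ^ 2 + m 3 ^ 2 + m 4 ^ 2 + m 5 ^ 2) := by
        field_simp
        ring
      rw [this]
      nlinarith [sq_nonneg (s * (x⁻¹ * m 0)), sq_nonneg (s * (y⁻¹ * m 1 - t * x⁻¹ * m 0))]
    refine abs_le_of_sq_le_sq' ?_ (norm_nonneg _) |>.2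
    rw [EuclideanSpace.real_norm_sq_eq, Fin.sum_univ_six]
    linarith
  rw [wedgeNorm_sum_smul, hB, abs_of_pos (by positivity)] at h1
  have h2 : x⁻¹ * y⁻¹ * s⁻¹ ^ 4 * wedgeNorm u = wedgeNorm u / (s ^ 4 * W) := by
    rw [← hxy]
    field_simp
  rw [h2, le_div_iff₀ (by positivity), one_mul] at h1
  exact h1

theorem le_wedgeNorm_add_sub {X Y x y : Vec} {δ ε : ℝ}
    (hx : ⟪x, X⟫ = 0) (hy : ⟪y, Y⟫ = 0) (hc : |⟪x, Y⟫ + ⟪y, X⟫| ≤ ε)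
    (h : ∀ s t : ℝ, δ ^ 2 * (s ^ 2 + t ^ 2) ≤ ‖s • x + t • y‖ ^ 2) :
    δ ^ 2 * (‖X‖ ^ 2 + ‖Y‖ ^ 2) - 2 * ε * (‖X‖ * ‖Y‖ + ‖x‖ * ‖y‖) - ε ^ 2 ≤
      wedgeNorm ![X + x, Y + y] ^ 2 - wedgeNorm ![X, Y] ^ 2 := by
  rw [wedgeNorm_two_sq, wedgeNorm_two_sq]
  have h1 : δ ^ 2 * (‖X‖ ^ 2 + ‖Y‖ ^ 2)
      ≤ ‖X‖ ^ 2 * ‖y‖ ^ 2 + ‖Y‖ ^ 2 * ‖x‖ ^ 2 - 2 * ⟪X, Y⟫ * ⟪x, y⟫ := by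
    have e : ∀ k, δ ^ 2 * (X k ^ 2 + Y k ^ 2)
        ≤ X k ^ 2 * ‖y‖ ^ 2 + Y k ^ 2 * ‖x‖ ^ 2 - 2 * (X k * Y k) * ⟪x, y⟫ := fun k => by
      have := h (-(Y k)) (X k)
      rw [norm_add_sq_real, norm_smul, norm_smul, real_inner_smul_left, real_inner_smul_right,
        mul_pow, mul_pow, Real.norm_eq_abs, Real.norm_eq_abs, sq_abs, sq_abs] at this
      nlinarith
    have e2 := Finset.sum_le_sum fun k (_ : k ∈ Finset.univ) => e k
    rw [← Finset.mul_sum, Finset.sum_add_distrib, Finset.sum_sub_distrib, Finset.sum_add_distrib,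
      ← Finset.sum_mul, ← Finset.sum_mul, ← Finset.sum_mul, ← Finset.mul_sum,
      ← EuclideanSpace.real_norm_sq_eq, ← EuclideanSpace.real_norm_sq_eq] at e2
    have e3 : ⟪X, Y⟫ = ∑ k, X k * Y k := by
      simp [PiLp.inner_apply, mul_comm]
    rw [e3]
    linarith
  have h2 : ⟪x, y⟫ ^ 2 ≤ ‖x‖ ^ 2 * ‖y‖ ^ 2 := by
    rw [← mul_pow, ← sq_abs]
    exact pow_le_pow_left₀ (abs_nonneg _) (abs_real_inner_le_norm x y) 2
  have n1 : ‖X + x‖ ^ 2 = ‖X‖ ^ 2 + ‖x‖ ^ 2 := by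
    rw [norm_add_sq_real, real_inner_comm, hx]
    ring
  have n2 : ‖Y + y‖ ^ 2 = ‖Y‖ ^ 2 + ‖y‖ ^ 2 := by
    rw [norm_add_sq_real, real_inner_comm, hy]
    ring
  set c := ⟪x, Y⟫ + ⟪y, X⟫ with hcd
  have n3 : ⟪X + x, Y + y⟫ = ⟪X, Y⟫ + ⟪x, y⟫ + c := by
    rw [inner_add_left, inner_add_right, inner_add_right, real_inner_comm y X]
    ring
  rw [n1, n2, n3]
  have hε : 0 ≤ ε := (abs_nonneg _).trans hc
  have h3 : c ^ 2 ≤ ε ^ 2 := by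
    rw [← sq_abs]
    exact pow_le_pow_left₀ (abs_nonneg _) hc 2
  have h4 : c * (⟪X, Y⟫ + ⟪x, y⟫) ≤ ε * (‖X‖ * ‖Y‖ + ‖x‖ * ‖y‖) := by
    refine (le_abs_self _).trans ?_
    rw [abs_mul]
    exact mul_le_mul hc ((abs_add_le _ _).trans (add_le_add (abs_real_inner_le_norm _ _)
      (abs_real_inner_le_norm _ _))) (abs_nonneg _) hε
  nlinarith

theorem exists_adm {C₀ : ℝ} (hC : 1 ≤ C₀) : ∃ c : ℝ, 0 < c ∧ ∀ {α A M : ℝ} {ψ : H → Vec},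
    0 < α → 1 ≤ A → C₀⁻¹ ≤ M → Smooth ψ → (∀ b p, ‖WD b ψ p‖ ≤ C₀ * M) →
    (∀ p, C₀ ^ (-(20 : ℝ)) * A ^ (-(4 : ℝ)) * M ^ 2 ≤
      wedgeNorm ![XD ψ p, YD ψ p, ZD ψ p, XD (XD ψ) p, YD (YD ψ) p, XD (YD ψ) p]) →
    CkAS 2 18 α A ψ ≤ ENNReal.ofReal (C₀ ^ 2 * A⁻¹) → Adm α (C₀ ^ 2) c A M ψ := by
  have hC0 : 0 < C₀ := by linarith
  obtain ⟨c, hc, hco⟩ := exists_coercive_of_wedgeNorm 6 (2 * C₀ ^ 2)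
    (d := C₀ ^ (-(20 : ℝ))) (by positivity)
  refine ⟨c, hc, fun {α A M ψ} hα hA hM hψ h1 h2 h3 => ?_⟩
  have hA0 : 0 < A := by linarith
  have hM0 : 0 < M := (inv_pos.2 hC0).trans_le hM
  have hAi : A⁻¹ ≤ 1 := inv_le_one_of_one_le₀ hA
  have hCC : C₀ ≤ C₀ ^ 2 := by nlinarith
  have hc0 : 0 ≤ C₀ ^ 2 * A⁻¹ := by positivity
  have hsnd : ∀ w : List Bool, w.length = 2 → ∀ p, ‖DD w ψ p‖ ≤ C₀ ^ 2 * A⁻¹ := fun w hw p => by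
    simpa using norm_DD_le_of_CkAS hA0 hc0 h3 (j := 0) (by omega) w (by omega) p
  refine ⟨hψ, hA, hM0, ?_, fun b p => (h1 b p).trans (by gcongr), hsnd, fun w hw p => ?_,
    fun w hw p q => ?_, fun p l => ?_⟩
  · calc M⁻¹ ≤ (C₀⁻¹)⁻¹ := inv_anti₀ (by positivity) hM
      _ = C₀ := inv_inv _
      _ ≤ _ := hCC
  · have := norm_DD_le_of_CkAS hA0 hc0 h3 (j := 1) (by omega) w (by omega) p
    rwa [pow_one, mul_assoc, ← sq] at this
  · have := holder_of_CkAS hA0 (by positivity : 0 < C₀ ^ 2 * A⁻¹) h3 w (by omega) p q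
    refine this.trans ?_
    have h4 : (A ^ (((18 : ℕ) : ℝ) + α))⁻¹ ≤ A⁻¹ := by
      refine inv_anti₀ hA0 ?_
      calc A = A ^ (1 : ℝ) := (Real.rpow_one A).symm
        _ ≤ _ := Real.rpow_le_rpow_of_exponent_le hA (by push_cast; linarith)
    rw [sq (A⁻¹), ← mul_assoc]
    exact mul_le_mul_of_nonneg_right (mul_le_mul_of_nonneg_left h4 hc0)
      (Real.rpow_nonneg (ccDist_nonneg _ _) _)
  · let J : Fin 6 → Vec := ![XD ψ p, YD ψ p, ZD ψ p, XD (XD ψ) p, YD (YD ψ) p, XD (YD ψ) p]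
    let s : Fin 6 → ℝ := ![M⁻¹, M⁻¹, A, A, A, A]
    have hX : ∀ b, ‖M⁻¹ • WD b ψ p‖ ≤ 2 * C₀ ^ 2 := fun b => by
      rw [norm_smul, Real.norm_of_nonneg (by positivity)]
      calc M⁻¹ * ‖WD b ψ p‖ ≤ M⁻¹ * (C₀ * M) := by gcongr; exact h1 b p
        _ = C₀ := by field_simp
        _ ≤ _ := by nlinarith
    have hX2 : ∀ e : Vec, ‖e‖ ≤ 2 * (C₀ ^ 2 * A⁻¹) → ‖A • e‖ ≤ 2 * C₀ ^ 2 := fun e he => by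
      rw [norm_smul, Real.norm_of_nonneg hA0.le]
      calc A * ‖e‖ ≤ A * (2 * (C₀ ^ 2 * A⁻¹)) := by gcongr
        _ = _ := by field_simp
    have hb : ∀ b b', ‖WD b (WD b' ψ) p‖ ≤ C₀ ^ 2 * A⁻¹ := fun b b' => hsnd [b, b'] rfl p
    have hb' : ∀ b b', ‖WD b (WD b' ψ) p‖ ≤ 2 * (C₀ ^ 2 * A⁻¹) := fun b b' =>
      (hb b b').trans (by linarith)
    have hZ : ‖ZD ψ p‖ ≤ 2 * (C₀ ^ 2 * A⁻¹) := by
      rw [ZD_eq hψ, two_mul]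
      exact (norm_sub_le _ _).trans (add_le_add (hb false true) (hb true false))
    have hu : ∀ i, ‖s i • J i‖ ≤ 2 * C₀ ^ 2 := by
      intro i
      fin_cases i
      · exact hX true
      · exact hX false
      · exact hX2 _ hZ
      · exact hX2 _ (hb' true true)
      · exact hX2 _ (hb' false false)
      · exact hX2 _ (hb' true false)
    have hw : C₀ ^ (-(20 : ℝ)) ≤ wedgeNorm fun i => s i • J i := by
      rw [wedgeNorm_smul]
      have hp : |∏ i, s i| = M⁻¹ ^ 2 * A ^ 4 := by
        rw [abs_of_nonneg]
        · simp [s, Fin.prod_univ_succ]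
          ring
        · refine Finset.prod_nonneg fun i _ => ?_
          fin_cases i <;> simp [s] <;> positivity
      have hA4 : A ^ (-(4 : ℝ)) = (A ^ 4)⁻¹ := by
        rw [Real.rpow_neg hA0.le]
        norm_cast
      have := h2 p
      rw [hA4] at this
      rw [hp]
      calc C₀ ^ (-(20 : ℝ)) = M⁻¹ ^ 2 * A ^ 4 * (C₀ ^ (-(20 : ℝ)) * (A ^ 4)⁻¹ * M ^ 2) := by
            field_simp
        _ ≤ _ := by gcongr
    have h4 := hco (fun i => s i • J i) hu hw (!₂[l 0, l 1, 0, l 2, l 3, 0])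
    have e1 : ‖(!₂[l 0, l 1, 0, l 2, l 3, 0] : EuclideanSpace ℝ (Fin 6))‖ = ‖l‖ := by
      rw [EuclideanSpace.norm_eq, EuclideanSpace.norm_eq]
      simp [Fin.sum_univ_succ]
    rw [e1] at h4
    rw [syn_apply]
    convert! h4 using 2
    simp [Fin.sum_univ_succ, s, J, frame, frameC, WD]

theorem le_wedgeNorm_jets {U V : Fin 6 → Vec} {δ B t : ℝ} (hδ : 0 < δ) (hB : 0 ≤ B) (ht : 0 ≤ t)
    (ht1 : t ≤ 1) (htδ : t * (96 + 144 * B) ≤ δ ^ 2 * (3 / 4))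
    (hV : ∀ l : V6, δ * ‖l‖ ≤ ‖∑ j, l j • V j‖) (hVB : ∀ j, ‖V j‖ ≤ 2 * B)
    (hU : ∀ j, 2 ≤ j → ‖U j‖ ≤ t) (h0 : ∀ j, |⟪U 0, V j⟫| ≤ t) (h1 : ∀ j, |⟪U 1, V j⟫| ≤ t)
    (hw : 0 < wedgeNorm ![U 0, U 1]) :
    (δ / 2) ^ 4 / 4 * wedgeNorm ![U 0, U 1] ≤ wedgeNorm fun j => U j + V j := by
  have e0 : wedgeNorm ![(2 : ℝ)⁻¹ • U 0, (2 : ℝ)⁻¹ • U 1] = 4⁻¹ * wedgeNorm ![U 0, U 1] := by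
    have := wedgeNorm_smul (fun _ : Fin 2 => (2 : ℝ)⁻¹) ![U 0, U 1]
    rw [show (fun i => (2 : ℝ)⁻¹ • (![U 0, U 1] : Fin 2 → Vec) i)
      = ![(2 : ℝ)⁻¹ • U 0, (2 : ℝ)⁻¹ • U 1] by ext i : 1; fin_cases i <;> rfl] at this
    rw [this, Fin.prod_univ_two]
    norm_num
  rw [show (δ / 2) ^ 4 / 4 * wedgeNorm ![U 0, U 1]
    = (δ / 2) ^ 4 * wedgeNorm ![(2 : ℝ)⁻¹ • U 0, (2 : ℝ)⁻¹ • U 1] by rw [e0]; ring]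
  refine le_wedgeNorm_of_forms (by positivity) (by rw [e0]; positivity) fun l => ?_
  set P : Vec := ∑ j, l j • V j with hP
  set R : Vec := l 0 • U 0 + l 1 • U 1 with hR
  set E : Vec := ∑ j, l j • (if (2 : Fin 6) ≤ j then U j else 0) with hE
  have hsum : ∑ j, l j • (U j + V j) = R + E + P := by
    simp only [smul_add, Finset.sum_add_distrib, ← hP]
    congr 1
    rw [hR, hE]
    simp [Fin.sum_univ_six, show ¬ (2 : Fin 6) ≤ 0 by decide, show ¬ (2 : Fin 6) ≤ 1 by decide,
      show (2 : Fin 6) ≤ 3 by decide, show (2 : Fin 6) ≤ 4 by decide,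
      show (2 : Fin 6) ≤ 5 by decide]
    abel
  have hEn : ‖E‖ ≤ 6 * t * ‖l‖ := norm_sum_smul_le (fun j => by
    split_ifs with h
    · exact hU j h
    · simpa using ht) l
  have hPn : ‖P‖ ≤ 6 * (2 * B) * ‖l‖ := norm_sum_smul_le hVB l
  have hin : ∀ u : Vec, (∀ j, |⟪u, V j⟫| ≤ t) → |⟪u, P⟫| ≤ 6 * t * ‖l‖ := fun u hu => by
    have := norm_sum_smul_le (u := fun j => ⟪u, V j⟫) hu l
    rw [hP, inner_sum]
    simpa [real_inner_smul_right] using this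
  have hRP : |⟪R, P⟫| ≤ 12 * t * ‖l‖ ^ 2 := by
    rw [hR, inner_add_left, real_inner_smul_left, real_inner_smul_left]
    refine (abs_add_le _ _).trans ?_
    rw [abs_mul, abs_mul]
    have a0 := mul_le_mul (PiLp.norm_apply_le l 0) (hin _ h0) (abs_nonneg _) (norm_nonneg _)
    have a1 := mul_le_mul (PiLp.norm_apply_le l 1) (hin _ h1) (abs_nonneg _) (norm_nonneg _)
    rw [Real.norm_eq_abs] at a0 a1
    linarith
  have hRE : |⟪R, E⟫| ≤ ‖R‖ * ‖E‖ := abs_real_inner_le_norm _ _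
  have hEP : |⟪E, P⟫| ≤ ‖E‖ * ‖P‖ := abs_real_inner_le_norm _ _
  have hEP2 : ‖E‖ * ‖P‖ ≤ (6 * t * ‖l‖) * (6 * (2 * B) * ‖l‖) := by gcongr
  have hE2 : ‖E‖ ^ 2 ≤ (6 * t * ‖l‖) ^ 2 := by gcongr
  have hP2 : (δ * ‖l‖) ^ 2 ≤ ‖P‖ ^ 2 := pow_le_pow_left₀ (by positivity) (hV l) 2
  have hl : ‖l 0 • (2 : ℝ)⁻¹ • U 0 + l 1 • (2 : ℝ)⁻¹ • U 1‖ ^ 2 = ‖R‖ ^ 2 / 4 := by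
    rw [show l 0 • (2 : ℝ)⁻¹ • U 0 + l 1 • (2 : ℝ)⁻¹ • U 1 = (2 : ℝ)⁻¹ • R by rw [hR]; module,
      norm_smul, mul_pow]
    norm_num
    ring
  rw [hsum, hl, norm_add_sq_real (R + E) P, norm_add_sq_real R E, inner_add_left R E P]
  have k1 := (abs_le.1 hRP).1
  have k2 := (abs_le.1 hRE).1
  have k3 := (abs_le.1 hEP).1
  have k4 : 72 * t ^ 2 * ‖l‖ ^ 2 ≤ 72 * t * ‖l‖ ^ 2 := by
    have : t ^ 2 ≤ t := by nlinarith
    gcongr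
  have k5 : t * (96 + 144 * B) * ‖l‖ ^ 2 ≤ δ ^ 2 * (3 / 4) * ‖l‖ ^ 2 := by gcongr
  nlinarith [sq_nonneg (‖R‖ - 2 * ‖E‖), sq_nonneg ‖R‖]

theorem norm_DD_frame_le {M A D C : ℝ} {ψ : H → Vec} (hψ : Smooth ψ) (hA : 0 < A) (hM : 0 < M)
    (hD : 1 ≤ D) (hMD : M⁻¹ ≤ D) (hC : 0 ≤ C) {p : H}
    (h2 : ∀ w : List Bool, 2 ≤ w.length → w.length ≤ 23 → ‖DD w ψ p‖ ≤ C * A⁻¹)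
    (h3 : ∀ w : List Bool, 3 ≤ w.length → w.length ≤ 23 → ‖DD w ψ p‖ ≤ C * A⁻¹ ^ 2)
    (w : List Bool) (hw : 1 ≤ w.length) (hw' : w.length ≤ 21) :
    ‖DD w (frame M A ψ) p‖ ≤ D * C * A⁻¹ := by
  have h0 : 0 ≤ D * C * A⁻¹ := by positivity
  have e : DD w (frame M A ψ) p = fun i => DD w (frameC M A ψ i) p :=
    DD_pi (fun i => hψ.frameC i) w p
  rw [e, pi_norm_le_iff_of_nonneg h0]
  have k1 : ∀ b, ‖DD w (fun p => M⁻¹ • WD b ψ p) p‖ ≤ D * C * A⁻¹ := fun b => by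
    rw [DD_const_smul _ (hψ.WD b), norm_smul, Real.norm_of_nonneg (by positivity), mul_assoc]
    have : WD b ψ = DD [b] ψ := rfl
    rw [this, ← DD_append]
    exact mul_le_mul hMD (h2 _ (by simp; omega) (by simp; omega)) (norm_nonneg _) (by linarith)
  have k2 : ∀ b, ‖DD w (fun p => A • WD b (WD b ψ) p) p‖ ≤ D * C * A⁻¹ := fun b => by
    rw [DD_const_smul _ ((hψ.WD b).WD b), norm_smul, Real.norm_of_nonneg hA.le]
    have : WD b (WD b ψ) = DD [b, b] ψ := rfl
    rw [this, ← DD_append]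
    calc A * ‖DD (w ++ [b, b]) ψ p‖ ≤ A * (C * A⁻¹ ^ 2) := by
          gcongr
          exact h3 _ (by simp; omega) (by simp; omega)
      _ = 1 * C * A⁻¹ := by field_simp
      _ ≤ _ := by gcongr
  intro i
  fin_cases i
  exacts [k1 true, k1 false, k2 true, k2 false]

theorem Adm.inner_DD_le {α D c A M B C : ℝ} {ψ φ : H → Vec} (h : Adm α D c A M ψ) (hφ : Smooth φ)
    (hD : 0 ≤ D) (hB : ∀ w : List Bool, w.length ≤ 20 → ∀ p, ‖DD w φ p‖ ≤ B)
    (hC : ∀ i, ∀ w : List Bool, w.length ≤ 2 → ∀ p,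
      ‖DD w (fun p => ⟪φ p, WD i ψ p⟫) p‖ ≤ C * A⁻¹)
    (i : Bool) (w : List Bool) (hw : w.length ≤ 2) (p : H) :
    |⟪WD i ψ p, DD w φ p⟫| ≤ (C + 4 * D * B) * A⁻¹ := by
  have hA : 0 < A := by linarith [h.one_le]
  have hB0 : 0 ≤ B := (norm_nonneg _).trans (hB [] (by simp) p)
  have h1 : ∀ b, SB (WD b (WD i ψ)) p (D * A⁻¹) 1 1 := fun b w hw => by
    simp only [one_pow, mul_one]
    have e : DD w (WD b (WD i ψ)) = DD (w ++ [b, i]) ψ := by rw [DD_append]; rfl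
    rw [e]
    rcases Nat.eq_zero_or_pos w.length with h0 | h0
    · exact h.snd _ (by simp [h0]) p
    · refine (h.trd _ (by simp; omega) p).trans ?_
      have : A⁻¹ ≤ 1 := inv_le_one_of_one_le₀ h.one_le
      have : A⁻¹ ^ 2 ≤ A⁻¹ := by
        have : 0 < A⁻¹ := by positivity
        nlinarith
      gcongr
  have h2 := norm_DD_bilin_sub_le dotL (h.smooth.WD i) hφ h1 (b := B)
    (fun w hw => by simpa using hB w (by omega) p) w (by omega)
  simp only [dotL_apply] at h2
  have h3 : (fun p => ⟪WD i ψ p, φ p⟫) = fun p => ⟪φ p, WD i ψ p⟫ := by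
    ext p
    exact real_inner_comm _ _
  rw [h3, Real.norm_eq_abs] at h2
  have h4 := hC i w hw p
  rw [Real.norm_eq_abs] at h4
  have h5 : (w.length : ℝ) * (2 ^ 1 * ‖dotL‖ * (D * A⁻¹) * B) ≤ 2 * (2 ^ 1 * 1 * (D * A⁻¹) * B) := by
    gcongr
    · exact_mod_cast hw
    · exact norm_dotL_le
  have h6 := abs_sub_abs_le_abs_sub ⟪WD i ψ p, DD w φ p⟫ (DD w (fun p => ⟪φ p, WD i ψ p⟫) p)
  rw [abs_sub_comm] at h6
  linarith

theorem exists_perturbation : ∃ δ B : ℝ, 0 < δ ∧ 1 ≤ B ∧ ∀ {α : ℝ}, 0 < α → α < 1 →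
    ∀ {D : ℝ}, 1 ≤ D → ∀ {c : ℝ}, 0 < c → ∀ {θ : ℝ}, 0 < θ → ∃ A₀ : ℝ, 1 ≤ A₀ ∧
      ∀ {A M : ℝ} {ψ : H → Vec}, A₀ ≤ A → Adm α D c A M ψ → ∃ φ : H → Vec, Smooth φ ∧
        (∀ b p, ⟪WD b φ p, WD b ψ p⟫ = 0) ∧
        (∀ w : List Bool, w.length ≤ 20 → ∀ p, ‖DD w φ p‖ ≤ B) ∧
        (∀ w : List Bool, w.length = 20 → ∀ p q,
          ‖DD w φ p - DD w φ q‖ ≤ 2 * B * ccDist p q ^ α) ∧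
        (∀ p (l : V6), δ * ‖l‖ ≤ ‖∑ j, l j • jet φ p j‖) ∧
        (∀ i, ∀ w : List Bool, w.length ≤ 2 → ∀ p, |⟪WD i ψ p, DD w φ p⟫| ≤ θ) ∧
        ∀ w : List Bool, w.length = 2 → ∀ p, ‖DD w ψ p‖ ≤ θ := by
  obtain ⟨δ, B, hδ, hB, hfield⟩ := exists_orthogonal_field
  refine ⟨δ / 2, B + 1, by positivity, by linarith,
    fun {α} hα hα1 {D} hD {c} hc {θ} hθ => ?_⟩
  obtain ⟨A₁, C, hA₁, hC, hcor⟩ := exists_correction hα hα1 hD hc hB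
  obtain ⟨s, hs, hfield⟩ := hfield (a := C + 1) (c := c / 2) (by positivity) (by positivity)
  set T : ℝ := D * C + (C + 4 * D * (B + 1)) + D with hT
  have hT0 : 0 < T := by positivity
  set ε : ℝ := min (min s θ) (min 1 (δ / 24)) with hε
  have hε0 : 0 < ε := by positivity
  refine ⟨max A₁ (T / ε), hA₁.trans (le_max_left _ _), fun {A M ψ} hA hadm => ?_⟩
  have hA1 : 1 ≤ A := hadm.one_le
  have hA0 : 0 < A := by linarith
  have hTA : T * A⁻¹ ≤ ε := by
    rw [← div_eq_mul_inv, div_le_iff₀ hA0, mul_comm]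
    exact (div_le_iff₀ hε0).1 ((le_max_right _ _).trans hA)
  have hle : ∀ x : ℝ, x ≤ T → x * A⁻¹ ≤ ε := fun x hx =>
    (mul_le_mul_of_nonneg_right hx (by positivity)).trans hTA
  have hεs : ε ≤ s := (min_le_left _ _).trans (min_le_left _ _)
  have hεθ : ε ≤ θ := (min_le_left _ _).trans (min_le_right _ _)
  have hε1 : ε ≤ 1 := (min_le_right _ _).trans (min_le_left _ _)
  have hεδ : ε ≤ δ / 24 := (min_le_right _ _).trans (min_le_right _ _)
  have hDC : 0 ≤ D * C := by positivity
  have hDB : 0 ≤ 4 * D * (B + 1) := by positivity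
  have hCA : C * A⁻¹ ≤ ε := hle _ (by linarith)
  obtain ⟨ψ₀, hψ₀, hco, hfr, -, h2, h3, hφ⟩ := hcor ((le_max_left _ _).trans hA) hadm
  obtain ⟨φ₀, hφ₀, hφ₀B, hφ₀o, hφ₀δ⟩ := hfield hψ₀.frame hco
    (fun p => (hfr p).norm_le.trans (by linarith))
    fun p w hw hw' => (norm_DD_frame_le hψ₀ hA0 hadm.pos hD hadm.inv_le hC (h2 p) (h3 p) w hw
      hw').trans ((hle _ (by linarith)).trans hεs)
  obtain ⟨φ, hφs, hφo, hφB, hφh, hφi⟩ := hφ hφ₀ hφ₀B hφ₀o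
  have hB20 : ∀ w : List Bool, w.length ≤ 20 → ∀ p, ‖DD w φ p‖ ≤ B + 1 := fun w hw p => by
    have e1 := hφB w hw p
    have e2 := hφ₀B w (by omega) p
    have e3 := norm_le_norm_sub_add (DD w φ p) (DD w φ₀ p)
    linarith
  refine ⟨φ, hφs, hφo, hB20, fun w hw p q => ?_, fun p l => ?_, fun i w hw p => ?_,
    fun w hw p => (hadm.snd w hw p).trans ((hle _ (by linarith)).trans hεθ)⟩
  · have e1 := hφh w hw p q
    have e2 := norm_sub_le_rpow (hφ₀.DD w) hα hα1 (hφ₀B w (by omega))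
      (fun b p => hφ₀B (b :: w) (by simp [hw]) p) p q
    have e3 : DD w φ p - DD w φ q
        = ((DD w φ p - DD w φ₀ p) - (DD w φ q - DD w φ₀ q)) + (DD w φ₀ p - DD w φ₀ q) := by abel
    have e4 : 0 ≤ ccDist p q ^ α := Real.rpow_nonneg (ccDist_nonneg _ _) _
    rw [e3]
    refine (norm_add_le _ _).trans ((add_le_add e1 e2).trans ?_)
    rw [← add_mul]
    exact mul_le_mul_of_nonneg_right (by linarith) e4
  · have e1 : ∀ j, ‖jet φ p j - ContinuousLinearMap.id ℝ Vec (jet φ₀ p j)‖ ≤ 2 * (C * A⁻¹) :=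
      norm_jet_sub_le _ (by positivity) fun w hw => hφB w (by omega) p
    have e2 := norm_sum_smul_le e1 l
    have e3 : ∑ j, l j • (jet φ p j - ContinuousLinearMap.id ℝ Vec (jet φ₀ p j))
        = ∑ j, l j • jet φ p j - ∑ j, l j • jet φ₀ p j := by
      simp [smul_sub, Finset.sum_sub_distrib]
    rw [e3, norm_sub_rev] at e2
    have e4 := hφ₀δ p l
    have e5 := norm_le_norm_sub_add (∑ j, l j • jet φ₀ p j) (∑ j, l j • jet φ p j)
    have e6 : 6 * (2 * (C * A⁻¹)) * ‖l‖ ≤ δ / 2 * ‖l‖ :=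
      mul_le_mul_of_nonneg_right (by linarith) (norm_nonneg _)
    linarith
  · exact (hadm.inner_DD_le hφs (by linarith) hB20 hφi i w hw p).trans
      ((hle _ (by linarith)).trans hεθ)

theorem wedgeNorm_jet (f : H → Vec) (hf : Smooth f) (p : H) :
    wedgeNorm ![XD f p, YD f p, ZD f p, XD (XD f) p, YD (YD f) p, XD (YD f) p] =
      wedgeNorm (jet f p) := by
  rw [ZD_eq hf]; rfl

theorem jet_add {f g : H → Vec} (hf : Smooth f) (hg : Smooth g) (p : H) :
    jet (f + g) p = fun j => jet f p j + jet g p j := by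
  have h : ∀ w, DD w (f + g) p = DD w f p + DD w g p := fun w => congrFun (DD_add hf hg w) p
  funext j
  fin_cases j <;> simp [jet, h]
  abel

theorem sq_mul_le_norm_smul_add_smul {V : Fin 6 → Vec} {δ : ℝ} (s t : ℝ) (hδ : 0 ≤ δ)
    (hV : ∀ l : V6, δ * ‖l‖ ≤ ‖∑ j, l j • V j‖) :
    δ ^ 2 * (s ^ 2 + t ^ 2) ≤ ‖s • V 0 + t • V 1‖ ^ 2 := by
  have h := pow_le_pow_left₀ (by positivity) (hV !₂[s, t, 0, 0, 0, 0]) 2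
  rw [mul_pow, EuclideanSpace.real_norm_sq_eq] at h
  simpa [Fin.sum_univ_succ] using h

theorem le_norm_of_le_norm_smul_add_smul {x y : Vec} {δ : ℝ} (hδ : 0 ≤ δ)
    (h : ∀ s t : ℝ, δ ^ 2 * (s ^ 2 + t ^ 2) ≤ ‖s • x + t • y‖ ^ 2) : δ ≤ ‖x‖ ∧ δ ≤ ‖y‖ := by
  constructor
  · exact (sq_le_sq₀ hδ (norm_nonneg _)).1 (by simpa using h 1 0)
  · exact (sq_le_sq₀ hδ (norm_nonneg _)).1 (by simpa using h 0 1)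

theorem wedgeNorm_gain {X Y x y : Vec} {C M B δ ε : ℝ} (hC : 1 ≤ C) (hM : C⁻¹ ≤ M)
    (hε : 0 ≤ ε) (hε1 : ε ≤ 1) (hεδ : ε * (C ^ 4 * (3 + 2 * B ^ 2)) ≤ δ ^ 2)
    (hX : C⁻¹ * M ≤ ‖X‖) (hY : C⁻¹ * M ≤ ‖Y‖) (hX' : ‖X‖ ≤ C * M) (hY' : ‖Y‖ ≤ C * M)
    (hxB : ‖x‖ ≤ B) (hyB : ‖y‖ ≤ B)
    (hx : ⟪x, X⟫ = 0) (hy : ⟪y, Y⟫ = 0) (hc : |⟪x, Y⟫ + ⟪y, X⟫| ≤ ε)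
    (h : ∀ s t : ℝ, δ ^ 2 * (s ^ 2 + t ^ 2) ≤ ‖s • x + t • y‖ ^ 2) :
    δ ^ 2 * C⁻¹ ^ 2 * M ^ 2 ≤ wedgeNorm ![X + x, Y + y] ^ 2 - wedgeNorm ![X, Y] ^ 2 := by
  have hC0 : 0 < C := by linarith
  have hM0 : 0 < M := (inv_pos.2 hC0).trans_le hM
  have hCM : 1 ≤ C * M := by
    calc 1 = C * C⁻¹ := (mul_inv_cancel₀ hC0.ne').symm
      _ ≤ _ := by gcongr
  have hB : 0 ≤ B := (norm_nonneg _).trans hxB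
  have h1 := le_wedgeNorm_add_sub hx hy hc h
  have h2 : (C⁻¹ * M) ^ 2 ≤ ‖X‖ ^ 2 := by gcongr
  have h3 : (C⁻¹ * M) ^ 2 ≤ ‖Y‖ ^ 2 := by gcongr
  have h4 : ‖X‖ * ‖Y‖ + ‖x‖ * ‖y‖ ≤ (C * M) ^ 2 + B ^ 2 * (C * M) ^ 2 := by
    rw [sq, sq B]
    have : ‖x‖ * ‖y‖ ≤ B * B * 1 := by rw [mul_one]; gcongr
    have h6 : B * B * 1 ≤ B * B * (C * M * (C * M)) := by
      gcongr; nlinarith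
    have : ‖X‖ * ‖Y‖ ≤ (C * M) * (C * M) := by gcongr
    linarith
  have h5 : ε ^ 2 ≤ ε * (C * M) ^ 2 := by
    rw [sq]; gcongr; exact hε1.trans (one_le_pow₀ hCM)
  have h6 : ε * (C * M) ^ 2 * (3 + 2 * B ^ 2) ≤ δ ^ 2 * (C⁻¹ * M) ^ 2 := by
    calc _ = ε * (C ^ 4 * (3 + 2 * B ^ 2)) * (C⁻¹ * M) ^ 2 := by field_simp
      _ ≤ _ := by gcongr
  have h7 := mul_le_mul_of_nonneg_left h4 (mul_nonneg zero_le_two hε)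
  have h8 := mul_le_mul_of_nonneg_left (add_le_add h2 h3) (sq_nonneg δ)
  rw [mul_assoc, ← mul_pow]
  nlinarith

theorem exists_incr_const {δ B : ℝ} (hδ : 0 < δ) (hB0 : 0 ≤ B) : ∃ κ : ℝ, 1 ≤ κ ∧ κ⁻¹ ≤ δ ∧
    κ⁻¹ ≤ δ ^ 2 ∧ κ⁻¹ ≤ (δ / 2) ^ 4 / 4 ∧
      ((20 : ℕ) + 1) * 2 ^ 20 * B + 2 ^ 20 * (2 * B) ≤ κ := by
  refine ⟨1 + δ⁻¹ + (δ ^ 2)⁻¹ + ((δ / 2) ^ 4 / 4)⁻¹ +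
    (((20 : ℕ) + 1) * 2 ^ 20 * B + 2 ^ 20 * (2 * B)), ?_, ?_, ?_, ?_, ?_⟩
  · have : 0 ≤ δ⁻¹ + (δ ^ 2)⁻¹ + ((δ / 2) ^ 4 / 4)⁻¹ +
      (((20 : ℕ) + 1) * 2 ^ 20 * B + 2 ^ 20 * (2 * B)) := by positivity
    linarith
  iterate 3
    refine inv_le_of_inv_le₀ (by positivity) ?_
    have := inv_pos.2 hδ
    have : 0 < (δ ^ 2)⁻¹ := by positivity
    have : 0 < ((δ / 2) ^ 4 / 4)⁻¹ := by positivity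
    have : 0 ≤ ((20 : ℕ) + 1) * 2 ^ 20 * B + 2 ^ 20 * (2 * B) := by positivity
    linarith
  · have : 0 ≤ 1 + δ⁻¹ + (δ ^ 2)⁻¹ + ((δ / 2) ^ 4 / 4)⁻¹ := by positivity
    linarith

theorem exists_small_const {δ B C : ℝ} (hδ : 0 < δ) (hB0 : 0 ≤ B) (hC0 : 0 < C) :
    ∃ θ : ℝ, 0 < θ ∧ 2 * θ ≤ 1 ∧ 2 * θ * (96 + 144 * B) ≤ δ ^ 2 * (3 / 4) ∧
      2 * θ * (C ^ 4 * (3 + 2 * B ^ 2)) ≤ δ ^ 2 := by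
  have h1 : 0 < 96 + 144 * B := by positivity
  have h2 : 0 < C ^ 4 * (3 + 2 * B ^ 2) := by positivity
  refine ⟨min 1 (min (δ ^ 2 * (3 / 4) / (96 + 144 * B)) (δ ^ 2 / (C ^ 4 * (3 + 2 * B ^ 2)))) / 2,
    by positivity, ?_, ?_, ?_⟩ <;> rw [mul_div_cancel₀ _ two_ne_zero]
  · exact min_le_left _ _
  · rw [← le_div_iff₀ h1]
    exact (min_le_right _ _).trans (min_le_left _ _)
  · rw [← le_div_iff₀ h2]
    exact (min_le_right _ _).trans (min_le_right _ _)

theorem le_wedgeNorm_jet_add {ψ φ : H → Vec} {δ B θ : ℝ} {p : H} (hδ : 0 < δ) (hB0 : 0 ≤ B)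
    (hθ : 0 < θ) (hθ1 : 2 * θ ≤ 1) (hθδ : 2 * θ * (96 + 144 * B) ≤ δ ^ 2 * (3 / 4))
    (hψ : Smooth ψ) (hφ : Smooth φ) (hfree : ∀ l : V6, δ * ‖l‖ ≤ ‖∑ j, l j • jet φ p j‖)
    (hφB : ∀ w : List Bool, w.length ≤ 2 → ‖DD w φ p‖ ≤ B)
    (hψθ : ∀ w : List Bool, w.length = 2 → ‖DD w ψ p‖ ≤ θ)
    (hθi : ∀ i, ∀ w : List Bool, w.length ≤ 2 → |⟪WD i ψ p, DD w φ p⟫| ≤ θ)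
    (hw : 0 < wedgeNorm ![XD ψ p, YD ψ p]) :
    (δ / 2) ^ 4 / 4 * wedgeNorm ![XD ψ p, YD ψ p] ≤
      wedgeNorm ![XD (ψ + φ) p, YD (ψ + φ) p, ZD (ψ + φ) p,
        XD (XD (ψ + φ)) p, YD (YD (ψ + φ)) p, XD (YD (ψ + φ)) p] := by
  rw [wedgeNorm_jet (ψ + φ) (hψ.add hφ), jet_add hψ hφ]
  have hinner : ∀ i j, |⟪WD i ψ p, jet φ p j⟫| ≤ 2 * θ := fun i j => by
    have h0 : jet (fun _ : H => (0 : ℝ)) p j = 0 := by fin_cases j <;> simp [jet, DD_zero]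
    simpa [h0] using norm_jet_sub_le (f := fun _ => (0 : ℝ)) (g := φ) (p := p) (dotL (WD i ψ p)) hθ.le
      (fun w hw => by simpa [DD_zero] using hθi i w hw) j
  refine le_wedgeNorm_jets (U := jet ψ p) (V := jet φ p) hδ hB0 (by positivity) hθ1 hθδ hfree
    (norm_jet_le hB0 hφB) (fun j hj => ?_) (hinner true) (hinner false) hw
  have hd : ∀ w : List Bool, w.length = 2 → ‖DD w ψ p‖ ≤ 2 * θ := fun w hw =>
    (hψθ w hw).trans (by linarith)
  fin_cases j
  · simp at hj
  · simp at hj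
  · exact (norm_sub_le _ _).trans ((add_le_add (hψθ _ rfl) (hψθ _ rfl)).trans (by linarith))
  all_goals exact hd _ rfl

end Heisenberg

/-- **The key iterative step** (Proposition 4.1 of the paper).  Given a slowly varying map
`ψ : H → ℝ²⁹` with non-degenerate first derivatives, which is a locally free embedding and
has Hölder regularity at scale `A`, one can find a map `φ` with non-degenerate first
derivatives which increments the wedge product, keeps `ψ+φ` locally free, has bounded
`C^{20,α}` norm, and satisfies the orthogonality `B(φ,ψ) = 0`. -/
theorem statement3 :
    ∃ κ : ℝ, 1 ≤ κ ∧
      ∀ α : ℝ, 0 < α → α < 1 →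
        ∃ C₀' : ℝ, 1 < C₀' ∧
          ∀ C₀ : ℝ, C₀' ≤ C₀ →
            ∃ A₀ : ℝ, 1 ≤ A₀ ∧
              ∀ A : ℝ, IsDyadic A → A₀ ≤ A →
                ∀ M : ℝ, C₀⁻¹ ≤ M →
                  ∀ ψ : H → EuclideanSpace ℝ (Fin 29), ContDiff ℝ (⊤ : ℕ∞) ψ →
                    -- (i) non-degenerate first derivatives
                    (∀ p : H,
                      C₀⁻¹ * M ≤ ‖XD ψ p‖ ∧ ‖XD ψ p‖ ≤ C₀ * M ∧
                      C₀⁻¹ * M ≤ ‖YD ψ p‖ ∧ ‖YD ψ p‖ ≤ C₀ * M ∧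
                      C₀ ^ (-(6 : ℝ)) * M ^ 2 ≤ wedgeNorm ![XD ψ p, YD ψ p]) →
                    -- (ii) locally free embedding
                    (∀ p : H,
                      C₀ ^ (-(20 : ℝ)) * A ^ (-(4 : ℝ)) * M ^ 2 ≤
                        wedgeNorm ![XD ψ p, YD ψ p, ZD ψ p,
                          XD (XD ψ) p, YD (YD ψ) p, XD (YD ψ) p]) →
                    -- (iii) Hölder regularity at scale `A`: `‖∇²ψ‖_{C^{18,α}_A} ≤ C₀²/A`
                    CkAS 2 18 α A ψ ≤ ENNReal.ofReal (C₀ ^ 2 * A⁻¹) →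
                    ∃ φ : H → EuclideanSpace ℝ (Fin 29), ContDiff ℝ (⊤ : ℕ∞) φ ∧
                      -- (iv) non-degenerate first derivatives
                      (∀ p : H, κ⁻¹ ≤ ‖XD φ p‖ ∧ κ⁻¹ ≤ ‖YD φ p‖) ∧
                      (∀ p : H,
                        κ⁻¹ * C₀ ^ (-(4 : ℝ)) * M ^ 2 ≤
                          wedgeNorm ![XD (ψ + φ) p, YD (ψ + φ) p] ^ 2 -
                            wedgeNorm ![XD ψ p, YD ψ p] ^ 2) ∧
                      -- (v) locally free embedding
                      (∀ p : H,
                        κ⁻¹ * C₀ ^ (-(12 : ℝ)) * M ^ 2 ≤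
                          wedgeNorm ![XD (ψ + φ) p, YD (ψ + φ) p, ZD (ψ + φ) p,
                            XD (XD (ψ + φ)) p, YD (YD (ψ + φ)) p, XD (YD (ψ + φ)) p]) ∧
                      -- (vi) Hölder regularity at scale `1`
                      CkA 20 α 1 φ ≤ ENNReal.ofReal κ ∧
                      -- (vii) orthogonality: `B(φ,ψ) = 0`
                      (∀ p : H, ⟪XD φ p, XD ψ p⟫ = 0 ∧ ⟪YD φ p, YD ψ p⟫ = 0) := by
  obtain ⟨δ, B, hδ, hB, hP⟩ := exists_perturbation
  have hB0 : 0 ≤ B := by linarith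
  obtain ⟨κ, hκ1, hκδ, hκδ2, hκδ4, hκB⟩ := exists_incr_const hδ hB0
  have hκ0 : 0 < κ⁻¹ := inv_pos.2 (by linarith)
  refine ⟨κ, hκ1, fun α hα hα1 => ⟨2, one_lt_two, fun C₀ hC => ?_⟩⟩
  have hC1 : 1 ≤ C₀ := by linarith
  have hC0 : 0 < C₀ := by linarith
  obtain ⟨c, hc, hadm⟩ := exists_adm hC1
  obtain ⟨θ, hθ, hθ1, hθδ, hθC⟩ := exists_small_const hδ hB0 hC0
  obtain ⟨A₀, hA₀, hA⟩ := hP hα hα1 (one_le_pow₀ hC1 : 1 ≤ C₀ ^ 2) hc hθ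
  refine ⟨A₀, hA₀, fun A _ hAA M hM ψ hψ hi hii hiii => ?_⟩
  have hM0 : 0 < M := (inv_pos.2 hC0).trans_le hM
  obtain ⟨φ, hφ, hort, hφB, hφH, hfree, hθi, hψθ⟩ := hA hAA (hadm hα (hA₀.trans hAA) hM hψ
    (fun b p => by cases b; exacts [(hi p).2.2.2.1, (hi p).2.1]) hii hiii)
  have hrpow : ∀ n : ℕ, C₀ ^ (-(n : ℝ)) = C₀⁻¹ ^ n := fun n => by
    rw [Real.rpow_neg hC0.le, Real.rpow_natCast, inv_pow]
  have hCi : C₀⁻¹ ≤ 1 := inv_le_one_of_one_le₀ hC1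
  have hCi0 : 0 < C₀⁻¹ := inv_pos.2 hC0
  have hlin (p : H) (s t : ℝ) : δ ^ 2 * (s ^ 2 + t ^ 2) ≤ ‖s • XD φ p + t • YD φ p‖ ^ 2 :=
    sq_mul_le_norm_smul_add_smul (V := jet φ p) s t hδ.le (hfree p)
  have hnorm (p : H) := le_norm_of_le_norm_smul_add_smul hδ.le (hlin p)
  have hadd : ∀ b, WD b (ψ + φ) = fun p => WD b ψ p + WD b φ p := WD_add hψ hφ
  have hX := hadd true
  have hY := hadd false
  refine ⟨φ, hφ, fun p => ⟨hκδ.trans (hnorm p).1, hκδ.trans (hnorm p).2⟩, fun p => ?_, fun p => ?_,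
    (CkA_le hB0 (by positivity) hφB hφH).trans (ENNReal.ofReal_le_ofReal hκB),
    fun p => ⟨hort true p, hort false p⟩⟩
  · obtain ⟨h1, h2, h3, h4, -⟩ := hi p
    have hx1 := hθi false [true] (by simp) p
    have hx2 := hθi true [false] (by simp) p
    have hc : |⟪XD φ p, YD ψ p⟫ + ⟪YD φ p, XD ψ p⟫| ≤ 2 * θ := by
      rw [real_inner_comm, real_inner_comm (XD ψ p), two_mul]
      exact (abs_add_le _ _).trans (add_le_add hx1 hx2)
    have := wedgeNorm_gain hC1 hM (by positivity) hθ1 hθC h1 h3 h2 h4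
      (hφB [true] (by simp) p) (hφB [false] (by simp) p) (hort true p) (hort false p) hc (hlin p)
    change _ ≤ wedgeNorm ![WD true (ψ + φ) p, WD false (ψ + φ) p] ^ 2 - _
    rw [hX, hY]
    refine le_trans ?_ this
    have h5 := hrpow 4
    norm_cast at h5 ⊢
    rw [h5]
    gcongr ?_ * ?_ * M ^ 2
    exact pow_le_pow_of_le_one hCi0.le hCi (by norm_num)
  · have hw := (hi p).2.2.2.2
    have h6 := hrpow 6
    have h12 := hrpow 12
    norm_cast at h6 h12 hw ⊢
    rw [h6] at hw
    refine le_trans ?_ (le_wedgeNorm_jet_add hδ hB0 hθ hθ1 hθδ hψ hφ (hfree p)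
      (fun w hw => hφB w (by omega) p) (fun w hw => hψθ w hw p) (fun i w hw => hθi i w hw p)
      (lt_of_lt_of_le (by positivity) hw))
    rw [h12, mul_assoc]
    gcongr
    refine le_trans ?_ hw
    gcongr ?_ * M ^ 2
    exact pow_le_pow_of_le_one hCi0.le hCi (by norm_num)
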